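/- Let m ≥ 1 be an integer. There exists a real number p₀ with 2.57 < p₀ < 2.58 such that for all real p: if 1 < p ≤ 2 or p ≥ p₀ then Δ(2^m•D_p) = 4^{m − 1/p}·(1 + τ_p)/(1 − τ_p), and if 2 ≤ p ≤ p₀ then Δ(2^m•D_p) = 2^{2m − 1}·(2^p − 1)^{1/p}; here τ_p ∈ [0,1) is determined by 2(1 − τ_p)^p = 1 + τ_p^p. -/

import Mathlib

open scoped Pointwise

/-- The open Minkowski ball `D_p = {(x,y) : |x|^p + |y|^p < 1}` in `ℝ²`. -/
def ballD (p : ℝ) : Set (ℝ × ℝ) :=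
  {v : ℝ × ℝ | |v.1| ^ p + |v.2| ^ p < 1}

/-- The Minkowski curve `C_p = {(x,y) : |x|^p + |y|^p = 1}`, the boundary of `D_p`. -/
def curveC (p : ℝ) : Set (ℝ × ℝ) :=
  {v : ℝ × ℝ | |v.1| ^ p + |v.2| ^ p = 1}

/-- The lattice (ℤ-span) generated by two vectors `a b : ℝ²`. -/
def latticeSet (a b : ℝ × ℝ) : Set (ℝ × ℝ) :=
  {v : ℝ × ℝ | ∃ m n : ℤ, v = (m : ℝ) • a + (n : ℝ) • b}

/-- The determinant of the 2×2 matrix with rows `a` and `b`. -/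
def det2 (a b : ℝ × ℝ) : ℝ := a.1 * b.2 - a.2 * b.1

/-- A lattice with basis `a, b` is admissible for `D` if it meets `D` at most in `0`. -/
def IsAdmissible (D : Set (ℝ × ℝ)) (a b : ℝ × ℝ) : Prop :=
  latticeSet a b ∩ D ⊆ {0}

/-- The critical determinant `Δ(D)`: the infimum of covolumes `|det(a,b)|` over all
full-rank lattices `ℤa + ℤb` admissible for `D` (with value `∞` if none exists). -/
noncomputable def criticalDet (D : Set (ℝ × ℝ)) : ENNReal :=
  sInf {d : ENNReal | ∃ a b : ℝ × ℝ, LinearIndependent ℝ ![a, b] ∧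
    IsAdmissible D a b ∧ d = ENNReal.ofReal |det2 a b|}

set_option linter.all false

/-- the basic function on [0,1/2] -/
noncomputable def hf (p a : ℝ) : ℝ := (1 - (1 - a) ^ p) / (1 - a ^ p)

noncomputable def hfd (p a : ℝ) : ℝ :=
  p * ((1 - a) ^ (p - 1) * (1 - a ^ p) + a ^ (p - 1) * (1 - (1 - a) ^ p)) / (1 - a ^ p) ^ 2

theorem rpow_lt_one_aux {p a : ℝ} (hp : 1 < p) (h0 : 0 ≤ a) (h1 : a < 1) : a ^ p < 1 :=
  Real.rpow_lt_one h0 h1 (by linarith)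

theorem hf_hasDerivAt {p a : ℝ} (hp : 1 < p) (h0 : 0 ≤ a) (h1 : a < 1) :
    HasDerivAt (hf p) (hfd p a) a := by
  have hA := rpow_lt_one_aux hp h0 h1
  have d1 : HasDerivAt (fun x : ℝ => x ^ p) (p * a ^ (p - 1)) a :=
    Real.hasDerivAt_rpow_const (Or.inr hp.le)
  have d2 : HasDerivAt (fun x : ℝ => (1 - x) ^ p) (p * (1 - a) ^ (p - 1) * (-1)) a := by
    have e : HasDerivAt (fun x : ℝ => 1 - x) (-1) a := by
      simpa using (hasDerivAt_id a).const_sub 1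
    have := (Real.hasDerivAt_rpow_const (x := 1 - a) (Or.inr hp.le)).comp a e
    exact this
  have d3 := ((d2.const_sub 1).div (d1.const_sub 1) (by linarith))
  refine d3.congr_deriv ?_
  unfold hfd
  ring

theorem hfd_pos {p a : ℝ} (hp : 1 < p) (h0 : 0 ≤ a) (h1 : a < 1) : 0 < hfd p a := by
  have hA := rpow_lt_one_aux hp h0 h1
  have h2 : (1 - a) ^ p ≤ 1 := Real.rpow_le_one (by linarith) (by linarith) (by linarith)
  have h3 : 0 < (1 - a) ^ (p - 1) := Real.rpow_pos_of_pos (by linarith) _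
  have h4 : 0 ≤ a ^ (p - 1) := Real.rpow_nonneg h0 _
  unfold hfd
  have : 0 < (1 - a) ^ (p - 1) * (1 - a ^ p) := mul_pos h3 (by linarith)
  have : 0 ≤ a ^ (p - 1) * (1 - (1 - a) ^ p) := mul_nonneg h4 (by linarith)
  apply div_pos (mul_pos (by linarith) (by linarith))
  have : 0 < 1 - a ^ p := by linarith
  positivity

theorem hf_zero {p : ℝ} (_ : 1 < p) : hf p 0 = 0 := by
  simp [hf]

theorem hf_half {p : ℝ} (hp : 1 < p) : hf p (1/2) = 1 := by
  have hA := rpow_lt_one_aux (a := 1/2) hp (by norm_num) (by norm_num)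
  unfold hf
  rw [show (1:ℝ) - 1/2 = 1/2 by norm_num]
  exact div_self (by linarith)

theorem hf_contOn {p : ℝ} (hp : 1 < p) : ContinuousOn (hf p) (Set.Ico 0 1) := fun a ha =>
  (hf_hasDerivAt hp ha.1 ha.2).continuousAt.continuousWithinAt

theorem hf_strictMono {p : ℝ} (hp : 1 < p) : StrictMonoOn (hf p) (Set.Ico 0 1) := by
  apply strictMonoOn_of_deriv_pos (convex_Ico 0 1) (hf_contOn hp)
  intro x hx
  rw [interior_Ico] at hx
  rw [(hf_hasDerivAt hp hx.1.le hx.2).deriv]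
  exact hfd_pos hp hx.1.le hx.2

theorem hf_image {p : ℝ} (hp : 1 < p) : hf p '' (Set.Icc 0 (1/2)) = Set.Icc 0 1 := by
  have hsub : Set.Icc (0:ℝ) (1/2) ⊆ Set.Ico 0 1 := fun x hx => ⟨hx.1, by linarith [hx.2]⟩
  apply Set.Subset.antisymm
  · rintro _ ⟨x, hx, rfl⟩
    have hm := (hf_strictMono hp).monotoneOn
    constructor
    · rw [← hf_zero hp]; exact hm (by norm_num) (hsub hx) hx.1
    · rw [← hf_half hp]; exact hm (hsub hx) (by norm_num) hx.2
  · have := intermediate_value_Icc (f := hf p) (by norm_num : (0:ℝ) ≤ 1/2) ((hf_contOn hp).mono hsub)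
    rwa [hf_zero hp, hf_half hp] at this

theorem exists_inv {p : ℝ} (hp : 1 < p) : ∃ k : ℝ → ℝ, ContinuousOn k (Set.Icc 0 1) ∧
    StrictMonoOn k (Set.Icc 0 1) ∧ (∀ t ∈ Set.Icc (0:ℝ) 1, k t ∈ Set.Icc (0:ℝ) (1/2)) ∧
    (∀ t ∈ Set.Icc (0:ℝ) 1, hf p (k t) = t) ∧ (∀ a ∈ Set.Icc (0:ℝ) (1/2), k (hf p a) = a) ∧
    (∀ t ∈ Set.Ioo (0:ℝ) 1, HasDerivAt k (hfd p (k t))⁻¹ t) := by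
  have hsub : Set.Icc (0:ℝ) (1/2) ⊆ Set.Ico 0 1 := fun x hx => ⟨hx.1, by linarith [hx.2]⟩
  have hmono : StrictMonoOn (hf p) (Set.Icc 0 (1/2)) := (hf_strictMono hp).mono hsub
  have himg := hf_image hp
  set k : ℝ → ℝ := Function.invFunOn (hf p) (Set.Icc 0 (1/2)) with hk
  have hmem : ∀ t ∈ Set.Icc (0:ℝ) 1, k t ∈ Set.Icc (0:ℝ) (1/2) := by
    intro t ht; rw [← himg] at ht; exact Function.invFunOn_mem ht
  have hr : ∀ t ∈ Set.Icc (0:ℝ) 1, hf p (k t) = t := by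
    intro t ht; rw [← himg] at ht; exact Function.invFunOn_eq ht
  have hl : ∀ a ∈ Set.Icc (0:ℝ) (1/2), k (hf p a) = a := by
    intro a ha
    have h2 := himg ▸ Set.mem_image_of_mem (hf p) ha
    exact hmono.injOn (hmem _ h2) ha (hr _ h2)
  have hkm : StrictMonoOn k (Set.Icc 0 1) := by
    intro s hs t ht hst
    rw [← hmono.lt_iff_lt (hmem s hs) (hmem t ht), hr s hs, hr t ht]; exact hst
  have hcont : ContinuousOn k (Set.Icc 0 1) := by
    have him : k '' Set.Icc 0 1 = Set.Icc 0 (1/2) := by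
      apply Set.Subset.antisymm
      · rintro _ ⟨t, ht, rfl⟩; exact hmem t ht
      · intro a ha; exact ⟨hf p a, himg ▸ Set.mem_image_of_mem _ ha, hl a ha⟩
    haveI : Set.OrdConnected (k '' Set.Icc 0 1) := by rw [him]; exact Set.ordConnected_Icc
    have h3 := (hkm.orderIso k (Set.Icc 0 1)).continuous
    rw [continuousOn_iff_continuous_restrict]
    exact continuous_subtype_val.comp h3
  refine ⟨k, hcont, hkm, hmem, hr, hl, ?_⟩
  intro t ht
  have ht' : t ∈ Set.Icc (0:ℝ) 1 := ⟨ht.1.le, ht.2.le⟩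
  have hc : ContinuousAt k t := hcont.continuousAt (Icc_mem_nhds ht.1 ht.2)
  have hkt := hsub (hmem t ht')
  apply HasDerivAt.of_local_left_inverse hc (hf_hasDerivAt hp hkt.1 hkt.2) (hfd_pos hp hkt.1 hkt.2).ne'
  filter_upwards [Icc_mem_nhds ht.1 ht.2] with s hs
  exact hr s hs

noncomputable def Hc (p a b : ℝ) : ℝ :=
  1 - (a * b) ^ p - (1 - a) ^ p - (1 - b) ^ p + (b * (1 - a)) ^ p + (a * (1 - b)) ^ p

noncomputable def En (n a b : ℝ) : ℝ :=
  b * (1 - b) ^ n - a * (1 - a) ^ n + (1 - a - a * b) * (a * (1 - b)) ^ n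
    - (1 - b - a * b) * (b * (1 - a)) ^ n - (1 + b - a * b) * (a * b * (1 - b)) ^ n
    + (1 + a - a * b) * (a * b * (1 - a)) ^ n + a * (a * (a * b * (1 - b))) ^ n
    - b * (b * (a * b * (1 - a))) ^ n

noncomputable def lnG (p a b : ℝ) : ℝ :=
  Real.log (1 - a ^ p) + Real.log (1 - b ^ p) + p * Real.log (1 - a * b)
    - 2 * Real.log (1 - a ^ p * b ^ p)

theorem Hc_eq {p a b : ℝ} (hp : 1 < p) (ha0 : 0 ≤ a) (ha1 : a < 1) (hb0 : 0 ≤ b) (hb1 : b < 1) :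
    Hc p a b = (1 - a ^ p) * (1 - b ^ p) * (hf p a + hf p b - 1) := by
  have hA := rpow_lt_one_aux hp ha0 ha1
  have hB := rpow_lt_one_aux hp hb0 hb1
  have h1 : (1 - a ^ p) ≠ 0 := by linarith
  have h2 : (1 - b ^ p) ≠ 0 := by linarith
  unfold Hc hf
  rw [Real.mul_rpow ha0 hb0, Real.mul_rpow hb0 (by linarith), Real.mul_rpow ha0 (by linarith)]
  field_simp
  ring

theorem Hc_zero_iff {p a b : ℝ} (hp : 1 < p) (ha0 : 0 ≤ a) (ha1 : a < 1) (hb0 : 0 ≤ b)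
    (hb1 : b < 1) : Hc p a b = 0 ↔ hf p a + hf p b = 1 := by
  have hA := rpow_lt_one_aux hp ha0 ha1
  have hB := rpow_lt_one_aux hp hb0 hb1
  rw [Hc_eq hp ha0 ha1 hb0 hb1]
  have h1 : (1 - a ^ p) ≠ 0 := by linarith
  have h2 : (1 - b ^ p) ≠ 0 := by linarith
  constructor
  · intro h
    rcases mul_eq_zero.1 h with h | h
    · exact absurd h (mul_ne_zero h1 h2)
    · linarith
  · intro h; rw [h]; ring

/-- partial derivative of `lnG` in the first variable -/
noncomputable def La (p a b : ℝ) : ℝ :=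
  p * (a ^ (p - 1) * (-1 + 2 * b ^ p - a ^ p * b ^ p) * (1 - a * b)
    - b * (1 - a ^ p) * (1 - a ^ p * b ^ p)) / ((1 - a ^ p) * (1 - a ^ p * b ^ p) * (1 - a * b))

theorem key_identity {a b x y x1 y1 : ℝ} (ha : a < 1)
    (hrel : 1 - a * x * (b * y) - (1 - a) * x1 - (1 - b) * y1 + b * y * ((1 - a) * x1)
      + a * x * ((1 - b) * y1) = 0) :
    (x * (-1 + 2 * (b * y) - a * x * (b * y)) * (1 - a * b)
      - b * (1 - a * x) * (1 - a * x * (b * y))) * (y1 * (1 - b * y) + y * (1 - (1 - b) * y1))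
        * (1 - a * x)
     - (y * (-1 + 2 * (a * x) - a * x * (b * y)) * (1 - a * b)
      - a * (1 - b * y) * (1 - a * x * (b * y))) * (x1 * (1 - a * x) + x * (1 - (1 - a) * x1))
        * (1 - b * y)
    = - ((1 - a * x) * (1 - b * y)) * (b * y1 - a * x1 + (1 - a - a * b) * (x * y1)
    - (1 - b - a * b) * (y * x1) - (1 + b - a * b) * (x * y * y1)
    + (1 + a - a * b) * (x * y * x1) + a * (x * (x * y * y1))
    - b * (y * (x * y * x1))) := by
  have h1 : (1 - a) ≠ 0 := by linarith
  apply mul_left_cancel₀ h1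
  linear_combination (-(-(y * (-1 + 2 * (a * x) - a * x * (b * y)) * (1 - a * b)
      - a * (1 - b * y) * (1 - a * x * (b * y))) * (1 - x) + (1 - a * x) * (-a - (1 - b - a * b) * y
       + (1 + a - a * b) * (x * y) - b * (x * y^2)))) * hrel

theorem lnG_hasDerivAt {p t a b : ℝ} (α β : ℝ → ℝ) (α' β' : ℝ) (hp : 1 < p)
    (ha0 : 0 < a) (ha1 : a < 1) (hb0 : 0 < b) (hb1 : b < 1) (hα : α t = a) (hβ : β t = b)
    (h1 : HasDerivAt α α' t) (h2 : HasDerivAt β β' t) :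
    HasDerivAt (fun s => lnG p (α s) (β s)) (La p a b * α' + La p b a * β') t := by
  subst hα hβ
  have hA := rpow_lt_one_aux hp ha0.le ha1
  have hB := rpow_lt_one_aux hp hb0.le hb1
  have hA0 : 0 < (α t) ^ p := Real.rpow_pos_of_pos ha0 _
  have hB0 : 0 < (β t) ^ p := Real.rpow_pos_of_pos hb0 _
  have hAB : (α t) ^ p * (β t) ^ p < 1 := by nlinarith
  have hab : α t * β t < 1 := by nlinarith
  have dA : HasDerivAt (fun s => (α s) ^ p) (α' * p * (α t) ^ (p - 1)) t :=
    h1.rpow_const (Or.inr hp.le)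
  have dB : HasDerivAt (fun s => (β s) ^ p) (β' * p * (β t) ^ (p - 1)) t :=
    h2.rpow_const (Or.inr hp.le)
  have n1 : 1 - (α t) ^ p ≠ 0 := by linarith
  have n2 : 1 - (β t) ^ p ≠ 0 := by linarith
  have n3 : 1 - α t * β t ≠ 0 := by linarith
  have n4 : 1 - (α t) ^ p * (β t) ^ p ≠ 0 := by linarith
  have e1 := (dA.const_sub 1).log n1
  have e2 := (dB.const_sub 1).log n2
  have e3 := (((h1.mul h2).const_sub 1).log n3).const_mul p
  have e4 := (((dA.mul dB).const_sub 1).log n4).const_mul 2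
  have := ((e1.add e2).add e3).sub e4
  refine this.congr_deriv ?_
  have n5 : 1 - β t * α t ≠ 0 := by rwa [mul_comm]
  have n6 : 1 - (β t) ^ p * (α t) ^ p ≠ 0 := by rwa [mul_comm]
  have eA : (α t) ^ p = α t * (α t) ^ (p - 1) := by
    rw [← Real.rpow_one_add' ha0.le (by linarith)]; congr 1; ring
  have eB : (β t) ^ p = β t * (β t) ^ (p - 1) := by
    rw [← Real.rpow_one_add' hb0.le (by linarith)]; congr 1; ring
  unfold La
  simp only [Pi.mul_apply]
  rw [mul_comm (β t) (α t), mul_comm ((β t) ^ p) ((α t) ^ p)]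
  clear this e1 e2 e3 e4 dA dB h1 h2 n5 n6 hA hB hA0 hB0 hAB
  rw [eA] at n1 n4 ⊢
  rw [eB] at n2 n4 ⊢
  clear eA eB
  generalize (α t) ^ (p - 1) = x at *
  generalize (β t) ^ (p - 1) = y at *
  generalize α t = a at *
  generalize β t = b at *
  generalize hu : 1 - a * x = u at *
  generalize hv : 1 - b * y = v at *
  generalize hw : 1 - a * x * (b * y) = w at *
  generalize hz : 1 - a * b = z at *
  field_simp
  subst hu hv hw hz
  ring

theorem La_comb {p a b : ℝ} (hp : 1 < p) (ha0 : 0 < a) (ha1 : a < 1) (hb0 : 0 < b) (hb1 : b < 1)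
    (hc : Hc p a b = 0) :
    La p a b * (hfd p a)⁻¹ + La p b a * (-(hfd p b)⁻¹) =
     - (p ^ 2 / ((1 - a ^ p) * (1 - b ^ p) * (1 - a ^ p * b ^ p) * (1 - a * b))
        * (hfd p a)⁻¹ * (hfd p b)⁻¹) * En (p - 1) a b := by
  have hA := rpow_lt_one_aux hp ha0.le ha1
  have hB := rpow_lt_one_aux hp hb0.le hb1
  have hA0 : 0 < a ^ p := Real.rpow_pos_of_pos ha0 _
  have hB0 : 0 < b ^ p := Real.rpow_pos_of_pos hb0 _
  have hAB : a ^ p * b ^ p < 1 := by nlinarith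
  have hab : a * b < 1 := by nlinarith
  have n1 : 1 - a ^ p ≠ 0 := by linarith
  have n2 : 1 - b ^ p ≠ 0 := by linarith
  have n3 : 1 - a * b ≠ 0 := by linarith
  have n4 : 1 - a ^ p * b ^ p ≠ 0 := by linarith
  have d1 := (hfd_pos hp ha0.le ha1).ne'
  have d2 := (hfd_pos hp hb0.le hb1).ne'
  have hpw : ∀ z : ℝ, 0 < z → z ^ p = z * z ^ (p - 1) := by
    intro z hz
    rw [← Real.rpow_one_add' hz.le (by linarith)]; congr 1; ring
  have key : (La p a b * hfd p b - La p b a * hfd p a) =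
     - (p ^ 2 / ((1 - a ^ p) * (1 - b ^ p) * (1 - a ^ p * b ^ p) * (1 - a * b))) * En (p - 1) a b := by
    have pa : (0:ℝ) < 1 - a := by linarith
    have pb : (0:ℝ) < 1 - b := by linarith
    unfold Hc at hc
    unfold La hfd En
    rw [Real.mul_rpow (by positivity) (by positivity), Real.mul_rpow (by positivity) (by positivity), Real.mul_rpow (by positivity) (by positivity)] at hc
    have q1 : (a * (1 - b)) ^ (p - 1) = a ^ (p-1) * (1 - b) ^ (p-1) :=
      Real.mul_rpow (by positivity) (by positivity)
    have q2 : (b * (1 - a)) ^ (p - 1) = b ^ (p-1) * (1 - a) ^ (p-1) :=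
      Real.mul_rpow (by positivity) (by positivity)
    have q3 : (a * b * (1 - b)) ^ (p - 1) = a ^ (p-1) * b ^ (p-1) * (1 - b) ^ (p-1) := by
      rw [Real.mul_rpow (by positivity) (by positivity), Real.mul_rpow (by positivity) (by positivity)]
    have q4 : (a * b * (1 - a)) ^ (p - 1) = a ^ (p-1) * b ^ (p-1) * (1 - a) ^ (p-1) := by
      rw [Real.mul_rpow (by positivity) (by positivity), Real.mul_rpow (by positivity) (by positivity)]
    have q5 : (a * (a * b * (1 - b))) ^ (p - 1) = a ^ (p-1) * (a ^ (p-1) * b ^ (p-1) * (1 - b) ^ (p-1)) := by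
      rw [Real.mul_rpow (by positivity) (by positivity), q3]
    have q6 : (b * (a * b * (1 - a))) ^ (p - 1) = b ^ (p-1) * (a ^ (p-1) * b ^ (p-1) * (1 - a) ^ (p-1)) := by
      rw [Real.mul_rpow (by positivity) (by positivity), q4]
    rw [q1, q2, q3, q4, q5, q6]
    rw [hpw _ ha0, hpw _ hb0] at *
    rw [hpw _ pa, hpw _ pb] at *
    rw [mul_comm b a, mul_comm (b * b ^ (p-1)) (a * a ^ (p-1))]
    generalize a ^ (p - 1) = x at *
    generalize b ^ (p - 1) = y at *
    generalize (1 - a) ^ (p - 1) = x1 at *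
    generalize (1 - b) ^ (p - 1) = y1 at *
    have K := key_identity (a := a) (b := b) (x := x) (y := y) (x1 := x1) (y1 := y1) ha1 (by linarith)
    clear q1 q2 q3 q4 q5 q6 hpw d1 d2 hc
    rw [show ∀ E : ℝ, -(p ^ 2 / ((1 - a * x) * (1 - b * y) * (1 - a * x * (b * y)) * (1 - a * b))) * E
       = p ^ 2 * (-((1 - a * x) * (1 - b * y)) * E) / ((1 - a * x)^2 * (1 - b * y)^2 * (1 - a * x * (b * y)) * (1 - a * b)) from ?_]
    · rw [← K]
      generalize (y1 * (1 - b * y) + y * (1 - (1 - b) * y1)) = h1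
      generalize (x1 * (1 - a * x) + x * (1 - (1 - a) * x1)) = h2
      generalize hu : 1 - a * x = u at *
      generalize hv : 1 - b * y = v at *
      generalize hw : 1 - a * x * (b * y) = w at *
      generalize hz : 1 - a * b = z at *
      field_simp
    · intro E
      field_simp
  have : La p a b * (hfd p a)⁻¹ + La p b a * (-(hfd p b)⁻¹) =
    (La p a b * hfd p b - La p b a * hfd p a) * ((hfd p a)⁻¹ * (hfd p b)⁻¹) := by
    field_simp
    ring
  rw [this, key]; ring

theorem lnG_cont {p : ℝ} (hp : 1 < p) (α β : ℝ → ℝ) (S : Set ℝ) (h1 : ContinuousOn α S)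
    (h2 : ContinuousOn β S) (ha : ∀ s ∈ S, 0 ≤ α s ∧ α s < 1) (hb : ∀ s ∈ S, 0 ≤ β s ∧ β s < 1) :
    ContinuousOn (fun s => lnG p (α s) (β s)) S := by
  have hA : ∀ s ∈ S, 0 ≤ (α s) ^ p ∧ (α s) ^ p < 1 := fun s hs =>
    ⟨Real.rpow_nonneg (ha s hs).1 _, rpow_lt_one_aux hp (ha s hs).1 (ha s hs).2⟩
  have hB : ∀ s ∈ S, 0 ≤ (β s) ^ p ∧ (β s) ^ p < 1 := fun s hs =>
    ⟨Real.rpow_nonneg (hb s hs).1 _, rpow_lt_one_aux hp (hb s hs).1 (hb s hs).2⟩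
  have c1 : ContinuousOn (fun s => (α s) ^ p) S :=
    h1.rpow_const (fun s hs => Or.inr (by linarith))
  have c2 : ContinuousOn (fun s => (β s) ^ p) S :=
    h2.rpow_const (fun s hs => Or.inr (by linarith))
  unfold lnG
  apply ContinuousOn.sub
  · apply ContinuousOn.add
    · apply ContinuousOn.add
      · exact (continuousOn_const.sub c1).log (fun s hs => by have := hA s hs; simp; linarith)
      · exact (continuousOn_const.sub c2).log (fun s hs => by have := hB s hs; simp; linarith)
    · exact continuousOn_const.mul ((continuousOn_const.sub (h1.mul h2)).log (fun s hs => by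
        have := ha s hs; have := hb s hs
        have : α s * β s < 1 := by nlinarith
        simp; linarith))
  · exact continuousOn_const.mul ((continuousOn_const.sub (c1.mul c2)).log (fun s hs => by
        have := hA s hs; have := hB s hs
        have : (α s) ^ p * (β s) ^ p < 1 := by nlinarith
        simp; linarith))

/-- the parametrised curve -/
theorem exists_path {p : ℝ} (hp : 1 < p) : ∃ k : ℝ → ℝ, ContinuousOn k (Set.Icc 0 1) ∧
    StrictMonoOn k (Set.Icc 0 1) ∧ (∀ t ∈ Set.Icc (0:ℝ) 1, k t ∈ Set.Icc (0:ℝ) (1/2)) ∧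
    (∀ t ∈ Set.Icc (0:ℝ) 1, Hc p (k t) (k (1 - t)) = 0) ∧
    (∀ a b, 0 ≤ b → b ≤ a → a ≤ 1/2 → Hc p a b = 0 → ∃ t ∈ Set.Icc (1/2:ℝ) 1, k t = a ∧ k (1 - t) = b)
    ∧ k 0 = 0 ∧ k 1 = 1/2 ∧
    (∀ t ∈ Set.Ioo (0:ℝ) 1, ∃ c > 0, HasDerivAt (fun s => lnG p (k s) (k (1 - s)))
      (-c * En (p - 1) (k t) (k (1 - t))) t) := by
  obtain ⟨k, hc, hm, hmem, hr, hl, hd⟩ := exists_inv hp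
  have hsy : ∀ t ∈ Set.Icc (0:ℝ) 1, 1 - t ∈ Set.Icc (0:ℝ) 1 := fun t ht =>
    ⟨by linarith [ht.2], by linarith [ht.1]⟩
  have hH : ∀ t ∈ Set.Icc (0:ℝ) 1, Hc p (k t) (k (1 - t)) = 0 := by
    intro t ht
    have h1 := hmem t ht
    have h2 := hmem _ (hsy t ht)
    rw [Hc_zero_iff hp h1.1 (by linarith [h1.2]) h2.1 (by linarith [h2.2]), hr t ht, hr _ (hsy t ht)]
    ring
  have k0 : k 0 = 0 := by
    have := hl 0 (by norm_num); rwa [hf_zero hp] at this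
  have k1 : k 1 = 1/2 := by
    have := hl (1/2) (by norm_num); rwa [hf_half hp] at this
  refine ⟨k, hc, hm, hmem, hH, ?_, k0, k1, ?_⟩
  · intro a b hb hba ha h0
    rw [Hc_zero_iff hp (by linarith) (by linarith) hb (by linarith)] at h0
    have m1 : hf p b ≤ hf p a := (hf_strictMono hp).monotoneOn ⟨hb, by linarith⟩ ⟨by linarith, by linarith⟩ hba
    have m2 : hf p a ∈ Set.Icc (0:ℝ) 1 := by
      rw [← hf_image hp]; exact Set.mem_image_of_mem _ ⟨by linarith, ha⟩
    refine ⟨hf p a, ⟨by linarith, m2.2⟩, hl a ⟨by linarith, ha⟩, ?_⟩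
    rw [show 1 - hf p a = hf p b by linarith]
    exact hl b ⟨hb, by linarith⟩
  · intro t ht
    have ht' : t ∈ Set.Icc (0:ℝ) 1 := ⟨ht.1.le, ht.2.le⟩
    have h1 := hmem t ht'
    have h2 := hmem _ (hsy t ht')
    have p1 : 0 < k t := by rw [← k0]; exact hm (by norm_num) ht' ht.1
    have p2 : 0 < k (1 - t) := by rw [← k0]; exact hm (by norm_num) (hsy t ht') (by linarith [ht.2])
    have q1 : k t < 1 := by linarith [h1.2]
    have q2 : k (1 - t) < 1 := by linarith [h2.2]
    have e : HasDerivAt (fun x : ℝ => 1 - x) (-1) t := by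
      simpa using (hasDerivAt_id t).const_sub 1
    have d2 : HasDerivAt (fun s => k (1 - s)) (-(hfd p (k (1 - t)))⁻¹) t := by
      have := (hd (1 - t) ⟨by linarith [ht.2], by linarith [ht.1]⟩).comp t e
      simpa [Function.comp_def] using this
    have D := lnG_hasDerivAt (p := p) k (fun s => k (1 - s)) _ _ hp p1 q1 p2 q2 rfl rfl (hd t ht) d2
    rw [La_comb hp p1 q1 p2 q2 (hH t ht')] at D
    refine ⟨_, ?_, D⟩
    have hA := rpow_lt_one_aux hp p1.le q1
    have hB := rpow_lt_one_aux hp p2.le q2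
    have hA0 : 0 < (k t) ^ p := Real.rpow_pos_of_pos p1 _
    have hB0 : 0 < (k (1 - t)) ^ p := Real.rpow_pos_of_pos p2 _
    have hAB : (k t) ^ p * (k (1 - t)) ^ p < 1 := by nlinarith
    have hab : k t * k (1 - t) < 1 := by nlinarith
    have d1 := (hfd_pos hp p1.le q1)
    have d2 := (hfd_pos hp p2.le q2)
    have : 0 < 1 - (k t) ^ p := by linarith
    have : 0 < 1 - (k (1 - t)) ^ p := by linarith
    have : 0 < 1 - (k t) ^ p * (k (1 - t)) ^ p := by linarith
    have : 0 < 1 - k t * k (1 - t) := by linarith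
    have : 0 < p := by linarith
    positivity

theorem min_of_path {p : ℝ} (hp : 1 < p)
    (hE : ∀ a1 b1 a2 b2 : ℝ, 0 < b1 → b1 < b2 → b2 < a2 → a2 < a1 → a1 < 1/2 →
      Hc p a1 b1 = 0 → Hc p a2 b2 = 0 → En (p - 1) a1 b1 < 0 → En (p - 1) a2 b2 ≤ 0)
    {a b τ : ℝ} (hb : 0 ≤ b) (hba : b ≤ a) (ha : a ≤ 1/2) (hc : Hc p a b = 0)
    (hτ0 : 0 ≤ τ) (hτ : τ ≤ 1/2) (hτc : Hc p τ τ = 0) :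
    lnG p τ τ ≤ lnG p a b ∨ lnG p (1/2) 0 ≤ lnG p a b := by
  obtain ⟨k, hkc, hm, hmem, hH, hex, k0, k1, hd⟩ := exists_path hp
  obtain ⟨t, ht, rfl, rfl⟩ := hex a b hb hba ha hc
  obtain ⟨s, hs, hs1, hs2⟩ := hex τ τ hτ0 le_rfl hτ hτc
  have hsy : ∀ t ∈ Set.Icc (0:ℝ) 1, 1 - t ∈ Set.Icc (0:ℝ) 1 := fun t ht =>
    ⟨by linarith [ht.2], by linarith [ht.1]⟩
  have hsI : s ∈ Set.Icc (0:ℝ) 1 := ⟨by linarith [hs.1], hs.2⟩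
  have s_half : s = 1/2 := by
    have := hm.injOn hsI (hsy s hsI) (hs1.trans hs2.symm); linarith
  rw [s_half] at hs1 hs2
  have kc2 : ContinuousOn (fun s => k (1 - s)) (Set.Icc 0 1) :=
    hkc.comp (continuousOn_const.sub continuousOn_id) hsy
  have hcont : ContinuousOn (fun s => lnG p (k s) (k (1 - s))) (Set.Icc 0 1) :=
    lnG_cont hp _ _ _ hkc kc2 (fun s hs => ⟨(hmem s hs).1, by linarith [(hmem s hs).2]⟩)
      (fun s hs => ⟨(hmem _ (hsy s hs)).1, by linarith [(hmem _ (hsy s hs)).2]⟩)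
  set Φ : ℝ → ℝ := fun s => lnG p (k s) (k (1 - s)) with hΦ
  have e1 : lnG p τ τ = Φ (1/2) := by simp only [hΦ]; rw [hs2, hs1]
  have e2 : lnG p (1/2) 0 = Φ 1 := by simp only [hΦ]; rw [k1]; norm_num; rw [k0]
  rw [e1, e2]
  change Φ (1/2) ≤ Φ t ∨ Φ 1 ≤ Φ t
  by_contra hcon
  push Not at hcon
  obtain ⟨h1, h2⟩ := hcon
  have ht1 : 1/2 < t := lt_of_le_of_ne ht.1 (by rintro rfl; exact lt_irrefl _ h1)
  have ht2 : t < 1 := lt_of_le_of_ne ht.2 (by rintro rfl; exact lt_irrefl _ h2)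
  have dif : ∀ u ∈ Set.Ioo (0:ℝ) 1, DifferentiableAt ℝ Φ u := fun u hu => by
    obtain ⟨c, _, h⟩ := hd u hu; exact h.differentiableAt
  obtain ⟨u, hu, hu'⟩ := exists_deriv_eq_slope Φ ht1 (hcont.mono (Set.Icc_subset_Icc (by norm_num) ht2.le))
    (fun x hx => (dif x ⟨by linarith [hx.1], by linarith [hx.2]⟩).differentiableWithinAt)
  obtain ⟨v, hv, hv'⟩ := exists_deriv_eq_slope Φ ht2 (hcont.mono (Set.Icc_subset_Icc (by linarith) le_rfl))
    (fun x hx => (dif x ⟨by linarith [hx.1], by linarith [hx.2]⟩).differentiableWithinAt)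
  have huI : u ∈ Set.Icc (0:ℝ) 1 := ⟨by linarith [hu.1], by linarith [hu.2]⟩
  have hvI : v ∈ Set.Icc (0:ℝ) 1 := ⟨by linarith [hv.1], by linarith [hv.2]⟩
  obtain ⟨cu, cu0, hdu⟩ := hd u ⟨by linarith [hu.1], by linarith [hu.2]⟩
  obtain ⟨cv, cv0, hdv⟩ := hd v ⟨by linarith [hv.1], by linarith [hv.2]⟩
  change HasDerivAt Φ _ _ at hdu hdv
  rw [hdu.deriv] at hu'
  rw [hdv.deriv] at hv'
  have i1 : -cu * En (p - 1) (k u) (k (1 - u)) < 0 := by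
    rw [hu']; exact div_neg_of_neg_of_pos (by linarith) (by linarith)
  have i2 : 0 < -cv * En (p - 1) (k v) (k (1 - v)) := by
    rw [hv']; exact div_pos (by linarith) (by linarith)
  have j1 : 0 < En (p - 1) (k u) (k (1 - u)) := by
    by_contra h; push Not at h; nlinarith
  have j2 : En (p - 1) (k v) (k (1 - v)) < 0 := by
    by_contra h; push Not at h; nlinarith
  have := hE (k v) (k (1 - v)) (k u) (k (1 - u))
    (by rw [← k0]; exact hm (by norm_num) (hsy v hvI) (by linarith [hv.2]))
    (hm (hsy v hvI) (hsy u huI) (by linarith [hv.1, hu.2]))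
    (hm (hsy u huI) huI (by linarith [hu.1]))
    (hm huI hvI (by linarith [hv.1, hu.2]))
    (by rw [← k1]; exact hm hvI (by norm_num) hv.2)
    (hH v hvI) (hH u huI) j2
  linarith

theorem mid_of_path {p : ℝ} (hp : 1 < p)
    (hE : ∀ a b : ℝ, 0 < b → b < a → a < 1/2 → Hc p a b = 0 → En (p - 1) a b ≤ 0)
    {a b τ : ℝ} (hb : 0 ≤ b) (hba : b ≤ a) (ha : a ≤ 1/2) (hc : Hc p a b = 0)
    (hτ0 : 0 ≤ τ) (hτ : τ ≤ 1/2) (hτc : Hc p τ τ = 0) :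
    lnG p τ τ ≤ lnG p a b := by
  obtain ⟨k, hkc, hm, hmem, hH, hex, k0, k1, hd⟩ := exists_path hp
  obtain ⟨t, ht, rfl, rfl⟩ := hex a b hb hba ha hc
  obtain ⟨s, hs, hs1, hs2⟩ := hex τ τ hτ0 le_rfl hτ hτc
  have hsy : ∀ t ∈ Set.Icc (0:ℝ) 1, 1 - t ∈ Set.Icc (0:ℝ) 1 := fun t ht =>
    ⟨by linarith [ht.2], by linarith [ht.1]⟩
  have hsI : s ∈ Set.Icc (0:ℝ) 1 := ⟨by linarith [hs.1], hs.2⟩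
  have s_half : s = 1/2 := by
    have := hm.injOn hsI (hsy s hsI) (hs1.trans hs2.symm); linarith
  rw [s_half] at hs1 hs2
  have kc2 : ContinuousOn (fun s => k (1 - s)) (Set.Icc 0 1) :=
    hkc.comp (continuousOn_const.sub continuousOn_id) hsy
  have hcont : ContinuousOn (fun s => lnG p (k s) (k (1 - s))) (Set.Icc 0 1) :=
    lnG_cont hp _ _ _ hkc kc2 (fun s hs => ⟨(hmem s hs).1, by linarith [(hmem s hs).2]⟩)
      (fun s hs => ⟨(hmem _ (hsy s hs)).1, by linarith [(hmem _ (hsy s hs)).2]⟩)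
  set Φ : ℝ → ℝ := fun s => lnG p (k s) (k (1 - s)) with hΦ
  have e1 : lnG p τ τ = Φ (1/2) := by simp only [hΦ]; rw [hs2, hs1]
  rw [e1]
  change Φ (1/2) ≤ Φ t
  by_contra h1
  push Not at h1
  have ht1 : 1/2 < t := lt_of_le_of_ne ht.1 (by rintro rfl; exact lt_irrefl _ h1)
  have dif : ∀ u ∈ Set.Ioo (0:ℝ) 1, DifferentiableAt ℝ Φ u := fun u hu => by
    obtain ⟨c, _, h⟩ := hd u hu; exact h.differentiableAt
  obtain ⟨u, hu, hu'⟩ := exists_deriv_eq_slope Φ ht1 (hcont.mono (Set.Icc_subset_Icc (by norm_num) ht.2))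
    (fun x hx => (dif x ⟨by linarith [hx.1], by linarith [hx.2, ht.2]⟩).differentiableWithinAt)
  have huI : u ∈ Set.Icc (0:ℝ) 1 := ⟨by linarith [hu.1], by linarith [hu.2, ht.2]⟩
  obtain ⟨cu, cu0, hdu⟩ := hd u ⟨by linarith [hu.1], by linarith [hu.2, ht.2]⟩
  change HasDerivAt Φ _ _ at hdu
  rw [hdu.deriv] at hu'
  have i1 : -cu * En (p - 1) (k u) (k (1 - u)) < 0 := by
    rw [hu']; exact div_neg_of_neg_of_pos (by linarith) (by linarith)
  have j1 : 0 < En (p - 1) (k u) (k (1 - u)) := by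
    by_contra h; push Not at h; nlinarith
  have := hE (k u) (k (1 - u))
    (by rw [← k0]; exact hm (by norm_num) (hsy u huI) (by linarith [hu.2, ht.2]))
    (hm (hsy u huI) huI (by linarith [hu.1]))
    (by rw [← k1]; exact hm huI (by norm_num) (by linarith [hu.2, ht.2]))
    (hH u huI)
  linarith

open MeasureTheory in
theorem stieltjes {q : ℝ} (hq : q ∈ Set.Ioo (0:ℝ) 1) : ∃ C > 0, ∀ (k : ℕ) (c x : Fin k → ℝ),
    (∀ i, 0 ≤ x i) →
    IntegrableOn (fun t : ℝ => t ^ (q - 1) * ∑ i, c i * x i / (t + x i)) (Set.Ioi 0) ∧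
    ∑ i, c i * x i ^ q = C * ∫ t in Set.Ioi (0:ℝ), t ^ (q - 1) * ∑ i, c i * x i / (t + x i) := by
  refine ⟨(∫ (t : ℝ) in Set.Ioi 0, q.rpowIntegrand₀₁ t 1)⁻¹, ?_, ?_⟩
  · exact inv_pos.2 (Real.integral_rpowIntegrand₀₁_one_pos hq)
  intro k c x hx
  have hI : ∀ i, IntegrableOn (fun t => c i * q.rpowIntegrand₀₁ t (x i)) (Set.Ioi 0) := fun i =>
    (Real.integrableOn_rpowIntegrand₀₁_Ioi hq (hx i)).const_mul (c i)
  have hcongr : ∀ t ∈ Set.Ioi (0:ℝ), ∑ i, c i * q.rpowIntegrand₀₁ t (x i)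
      = t ^ (q - 1) * ∑ i, c i * x i / (t + x i) := by
    intro t ht
    rw [Finset.mul_sum]
    apply Finset.sum_congr rfl
    intro i _
    rw [Real.rpowIntegrand₀₁_eq_pow_div hq (le_of_lt ht) (hx i)]
    ring
  constructor
  · apply IntegrableOn.congr_fun _ hcongr measurableSet_Ioi
    exact integrable_finset_sum _ (fun i _ => hI i)
  · rw [← setIntegral_congr_fun measurableSet_Ioi hcongr, integral_finset_sum _ (fun i _ => hI i),
      Finset.mul_sum]
    apply Finset.sum_congr rfl
    intro i _
    rw [Real.rpow_eq_const_mul_integral hq (hx i), integral_const_mul]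
    ring

open MeasureTheory in
theorem stieltjes_nonneg {q : ℝ} (hq : q ∈ Set.Ioo (0:ℝ) 1) (k : ℕ) (c x : Fin k → ℝ)
    (hx : ∀ i, 0 ≤ x i) (h : ∀ t : ℝ, 0 < t → 0 ≤ ∑ i, c i * x i / (t + x i)) :
    0 ≤ ∑ i, c i * x i ^ q := by
  obtain ⟨C, hC, H⟩ := stieltjes hq
  rw [(H k c x hx).2]
  apply mul_nonneg hC.le
  apply setIntegral_nonneg measurableSet_Ioi
  intro t ht
  exact mul_nonneg (Real.rpow_nonneg (le_of_lt ht) _) (h t ht)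

open MeasureTheory in
theorem stieltjes_pos {q : ℝ} (hq : q ∈ Set.Ioo (0:ℝ) 1) (k : ℕ) (c x : Fin k → ℝ)
    (hx : ∀ i, 0 ≤ x i) (h : ∀ t : ℝ, 0 < t → 0 < ∑ i, c i * x i / (t + x i)) :
    0 < ∑ i, c i * x i ^ q := by
  obtain ⟨C, hC, H⟩ := stieltjes hq
  rw [(H k c x hx).2]
  apply mul_pos hC
  have hpos : ∀ t ∈ Set.Ioi (0:ℝ), 0 < t ^ (q - 1) * ∑ i, c i * x i / (t + x i) := fun t ht =>
    mul_pos (Real.rpow_pos_of_pos ht _) (h t ht)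
  rw [setIntegral_pos_iff_support_of_nonneg_ae _ (H k c x hx).1]
  · have : Function.support (fun t : ℝ => t ^ (q - 1) * ∑ i, c i * x i / (t + x i)) ∩ Set.Ioi 0
      = Set.Ioi 0 := by
      apply Set.inter_eq_right.2
      intro t ht
      exact (hpos t ht).ne'
    rw [this, Real.volume_Ioi]
    simp
  · apply ae_restrict_of_forall_mem measurableSet_Ioi
    intro t ht
    exact (hpos t ht).le

theorem hf_mono_p {p q a : ℝ} (hp : 1 < p) (hpq : p ≤ q) (h0 : 0 ≤ a) (h1 : a ≤ 1/2) :
    hf p a ≤ hf q a := by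
  have hq : 1 < q := by linarith
  have hp0 : 0 < p := by linarith
  set θ := q / p with hθ
  have hθ1 : 1 ≤ θ := by rw [hθ, le_div_iff₀ hp0]; linarith
  have hqe : q = p * θ := by rw [hθ]; field_simp
  have conv := convexOn_rpow hθ1
  have hA := rpow_lt_one_aux hp h0 (by linarith : a < 1)
  have hA' := rpow_lt_one_aux hq h0 (by linarith : a < 1)
  rcases eq_or_lt_of_le h0 with h | h0'
  · rw [← h, hf_zero hp, hf_zero hq]
  have hX := rpow_lt_one_aux hp (by linarith : 0 ≤ 1 - a) (by linarith)
  have hYX : a ^ p ≤ (1 - a) ^ p := Real.rpow_le_rpow h0 (by linarith) hp0.le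
  have S := conv.secant_mono (a := 1) (x := a ^ p) (y := (1 - a) ^ p) (by simp)
    (Real.rpow_nonneg h0 _) (Real.rpow_nonneg (by linarith) _) (by linarith) (by linarith) hYX
  simp only [Real.one_rpow] at S
  rw [← Real.rpow_mul h0, ← Real.rpow_mul (by linarith), ← hqe] at S
  unfold hf
  rw [div_le_div_iff₀ (by linarith) (by linarith)]
  rw [← neg_div_neg_eq, ← neg_div_neg_eq ((1 - a) ^ q - 1), div_le_div_iff₀ (by linarith) (by linarith)] at S
  nlinarith

theorem Hc_nonneg_of_le {p q a b : ℝ} (hp : 1 < p) (hpq : p ≤ q) (ha0 : 0 ≤ a) (ha : a ≤ 1/2)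
    (hb0 : 0 ≤ b) (hb : b ≤ 1/2) (hc : Hc p a b = 0) : 0 ≤ Hc q a b := by
  rw [Hc_zero_iff hp ha0 (by linarith) hb0 (by linarith)] at hc
  rw [Hc_eq (by linarith) ha0 (by linarith) hb0 (by linarith)]
  have := hf_mono_p hp hpq ha0 ha
  have := hf_mono_p hp hpq hb0 hb
  have hA := rpow_lt_one_aux (by linarith : 1 < q) ha0 (by linarith : a < 1)
  have hB := rpow_lt_one_aux (by linarith : 1 < q) hb0 (by linarith : b < 1)
  apply mul_nonneg (mul_nonneg (by linarith) (by linarith)) (by linarith)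

theorem Hc_nonpos_of_le {p q a b : ℝ} (hp : 1 < q) (hpq : q ≤ p) (ha0 : 0 ≤ a) (ha : a ≤ 1/2)
    (hb0 : 0 ≤ b) (hb : b ≤ 1/2) (hc : Hc p a b = 0) : Hc q a b ≤ 0 := by
  rw [Hc_zero_iff (by linarith) ha0 (by linarith) hb0 (by linarith)] at hc
  rw [Hc_eq (by linarith) ha0 (by linarith) hb0 (by linarith)]
  have := hf_mono_p hp hpq ha0 ha
  have := hf_mono_p hp hpq hb0 hb
  have hA := rpow_lt_one_aux (by linarith : 1 < q) ha0 (by linarith : a < 1)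
  have hB := rpow_lt_one_aux (by linarith : 1 < q) hb0 (by linarith : b < 1)
  apply mul_nonpos_of_nonneg_of_nonpos (mul_nonneg (by linarith) (by linarith)) (by linarith)

theorem Hc_two (a b : ℝ) : Hc 2 a b = (1 - a * b) * (2 * (a + b) - 1 - a * b) := by
  unfold Hc; simp only [Real.rpow_two]; ring

theorem Hc_three (a b : ℝ) : Hc 3 a b = 2 * (a + b) ^ 3 - 3 * (1 + a * b) * (a + b) ^ 2
    + 3 * (1 - a * b) ^ 2 * (a + b) - 1 + 6 * (a * b) + 6 * (a * b) ^ 2 - 3 * (a * b) ^ 3 := by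
  unfold Hc
  have h : ∀ z : ℝ, z ^ (3:ℝ) = z ^ 3 := fun z => by
    rw [← Real.rpow_natCast]; norm_num
  simp only [h]; ring

/-- coefficients and nodes -/
def cE (a b : ℝ) : Fin 8 → ℝ := ![b, -a, 1 - a - a * b, -(1 - b - a * b), -(1 + b - a * b),
  1 + a - a * b, a, -b]
def mE (a b : ℝ) : Fin 8 → ℝ := ![1 - b, 1 - a, a * (1 - b), b * (1 - a), a * b * (1 - b),
  a * b * (1 - a), a * (a * b * (1 - b)), b * (a * b * (1 - a))]

theorem En_sum (n a b : ℝ) : En n a b = ∑ i, cE a b i * mE a b i ^ n := by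
  simp [Fin.sum_univ_succ, cE, mE, En]; ring

theorem mE_pos {a b : ℝ} (ha0 : 0 < a) (ha : a < 1) (hb0 : 0 < b) (hb : b < 1) (i : Fin 8) :
    0 < mE a b i := by
  have h1 : 0 < 1 - a := by linarith
  have h2 : 0 < 1 - b := by linarith
  fin_cases i <;> simp [mE] <;> first | linarith | positivity

theorem sum_cm (a b : ℝ) : ∑ i, cE a b i * mE a b i = 0 := by
  simp [Fin.sum_univ_succ, cE, mE]; ring

/-- symmetric polynomials; `s = a + b`, `m = a b` -/
def PP (s m t : ℝ) : ℝ :=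
  (1 + m ^ 2 - 2 * s * (1 + m)) * t ^ 4
  + (1 - m) * ((1 + m) ^ 3 - 2 * s * (1 + 3 * m + m ^ 2)) * t ^ 3
  + m * (-2 * s - 4 * m + 8 * m * s - 2 * m * (s ^ 2 - 2 * m) - 12 * m ^ 2 + 8 * m ^ 2 * s - 4 * m ^ 3
      - 2 * m ^ 3 * s) * t ^ 2
  + m ^ 2 * (1 - m) * (-3 + 4 * s - 2 * (s ^ 2 - 2 * m) - 13 * m + 12 * m * s - 2 * m * (s ^ 2 - 2 * m)
      - 13 * m ^ 2 + 4 * m ^ 2 * s - 3 * m ^ 3) * t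
  + m ^ 3 * (1 - s + m) * (-1 + 3 * m - 2 * m * s + 3 * m ^ 2 - m ^ 3)

def QQ (s m t : ℝ) : ℝ :=
  (t ^ 2 + t * (2 - s) + (1 - s + m)) * (t ^ 2 + t * (s - 2 * m) + m * (1 - s + m))
  * (t ^ 2 + t * m * (2 - s) + m ^ 2 * (1 - s + m)) * (t ^ 2 + t * m * (s - 2 * m) + m ^ 3 * (1 - s + m))

theorem W_sym {s m t : ℝ} (h1 : t ^ 2 + t * (2 - s) + (1 - s + m) ≠ 0)
    (h2 : t ^ 2 + t * (s - 2 * m) + m * (1 - s + m) ≠ 0)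
    (h3 : t ^ 2 + t * m * (2 - s) + m ^ 2 * (1 - s + m) ≠ 0)
    (h4 : t ^ 2 + t * m * (s - 2 * m) + m ^ 3 * (1 - s + m) ≠ 0) :
    -((1 - s) * t + (1 - s + m)) / (t ^ 2 + t * (2 - s) + (1 - s + m))
    + (t * (1 - s) - m * (1 - s + m)) / (t ^ 2 + t * (s - 2 * m) + m * (1 - s + m))
    + (m * t * (m - s) + m ^ 2 * (1 - s + m)) / (t ^ 2 + t * m * (2 - s) + m ^ 2 * (1 - s + m))
    + (t * m * (s - m) + m ^ 3 * (1 - s + m)) / (t ^ 2 + t * m * (s - 2 * m) + m ^ 3 * (1 - s + m))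
    = (1 - s + m) * (1 - m) * t ^ 2 * PP s m t / QQ s m t := by
  unfold QQ PP
  rw [div_add_div _ _ h1 h2, div_add_div _ _ (mul_ne_zero h1 h2) h3,
    div_add_div _ _ (mul_ne_zero (mul_ne_zero h1 h2) h3) h4]
  congr 1
  ring

theorem W_eq {a b t : ℝ} (ha0 : 0 < a) (ha : a < 1) (hb0 : 0 < b) (hb : b < 1) (ht : 0 < t) :
    ∑ i, cE a b i * mE a b i / (t + mE a b i) =
      (a - b) * ((1 - (a + b) + a * b) * (1 - a * b) * t ^ 2 * PP (a + b) (a * b) t / QQ (a + b) (a * b) t) := by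
  have k1 : 0 < 1 - a := by linarith
  have k2 : 0 < 1 - b := by linarith
  have e1 : t ^ 2 + t * (2 - (a + b)) + (1 - (a + b) + a * b) = (t + (1 - b)) * (t + (1 - a)) := by ring
  have e2 : t ^ 2 + t * ((a + b) - 2 * (a * b)) + (a * b) * (1 - (a + b) + a * b)
    = (t + a * (1 - b)) * (t + b * (1 - a)) := by ring
  have e3 : t ^ 2 + t * (a * b) * (2 - (a + b)) + (a * b) ^ 2 * (1 - (a + b) + a * b)
    = (t + a * b * (1 - b)) * (t + a * b * (1 - a)) := by ring
  have e4 : t ^ 2 + t * (a * b) * ((a + b) - 2 * (a * b)) + (a * b) ^ 3 * (1 - (a + b) + a * b)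
    = (t + a * (a * b * (1 - b))) * (t + b * (a * b * (1 - a))) := by ring
  have d1 : t + (1 - b) ≠ 0 := by positivity
  have d2 : t + (1 - a) ≠ 0 := by positivity
  have d3 : t + a * (1 - b) ≠ 0 := by positivity
  have d4 : t + b * (1 - a) ≠ 0 := by positivity
  have d5 : t + a * b * (1 - b) ≠ 0 := by positivity
  have d6 : t + a * b * (1 - a) ≠ 0 := by positivity
  have d7 : t + a * (a * b * (1 - b)) ≠ 0 := by positivity
  have d8 : t + b * (a * b * (1 - a)) ≠ 0 := by positivity
  rw [← W_sym (by rw [e1]; exact mul_ne_zero d1 d2) (by rw [e2]; exact mul_ne_zero d3 d4)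
    (by rw [e3]; exact mul_ne_zero d5 d6) (by rw [e4]; exact mul_ne_zero d7 d8)]
  rw [e1, e2, e3, e4, mul_add, mul_add, mul_add]
  have p1 : (a - b) * (-((1 - (a + b)) * t + (1 - (a + b) + a * b)) / ((t + (1 - b)) * (t + (1 - a))))
    = b * (1 - b) / (t + (1 - b)) + -a * (1 - a) / (t + (1 - a)) := by
    rw [div_add_div _ _ d1 d2, ← mul_div_assoc]; congr 1; ring
  have p2 : (a - b) * ((t * (1 - (a + b)) - a * b * (1 - (a + b) + a * b)) / ((t + a * (1 - b)) * (t + b * (1 - a))))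
    = (1 - a - a * b) * (a * (1 - b)) / (t + a * (1 - b)) + -(1 - b - a * b) * (b * (1 - a)) / (t + b * (1 - a)) := by
    rw [div_add_div _ _ d3 d4, ← mul_div_assoc]; congr 1; ring
  have p3 : (a - b) * ((a * b * t * (a * b - (a + b)) + (a * b) ^ 2 * (1 - (a + b) + a * b)) / ((t + a * b * (1 - b)) * (t + a * b * (1 - a))))
    = -(1 + b - a * b) * (a * b * (1 - b)) / (t + a * b * (1 - b)) + (1 + a - a * b) * (a * b * (1 - a)) / (t + a * b * (1 - a)) := by
    rw [div_add_div _ _ d5 d6, ← mul_div_assoc]; congr 1; ring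
  have p4 : (a - b) * ((t * (a * b) * (a + b - a * b) + (a * b) ^ 3 * (1 - (a + b) + a * b)) / ((t + a * (a * b * (1 - b))) * (t + b * (a * b * (1 - a)))))
    = a * (a * (a * b * (1 - b))) / (t + a * (a * b * (1 - b))) + -b * (b * (a * b * (1 - a))) / (t + b * (a * b * (1 - a))) := by
    rw [div_add_div _ _ d7 d8, ← mul_div_assoc]; congr 1; ring
  rw [p1, p2, p3, p4]
  simp only [Fin.sum_univ_succ, cE, mE, Fin.sum_univ_zero]
  simp
  ring

theorem QQ_pos {a b t : ℝ} (ha0 : 0 < a) (ha : a < 1) (hb0 : 0 < b) (hb : b < 1) (ht : 0 < t) :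
    0 < QQ (a + b) (a * b) t := by
  have k1 : 0 < 1 - a := by linarith
  have k2 : 0 < 1 - b := by linarith
  have : QQ (a + b) (a * b) t = (t + (1 - b)) * (t + (1 - a)) * ((t + a * (1 - b)) * (t + b * (1 - a)))
   * ((t + a * b * (1 - b)) * (t + a * b * (1 - a))) * ((t + a * (a * b * (1 - b))) * (t + b * (a * b * (1 - a)))) := by
    unfold QQ; ring
  rw [this]; positivity

theorem PP_neg_low {s m t : ℝ} (hs : s ≤ 1) (hm0 : 0 ≤ m) (hm : m ≤ 1/4) (h : 1 + m ≤ 2 * s)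
   (ht : 0 < t) : PP s m t ≤ 0 := by
  have hs0 : 1/2 ≤ s := by linarith
  have q4 : (1 + m ^ 2 - 2 * s * (1 + m)) ≤ 0 := by nlinarith
  have q3 : ((1 + m) ^ 3 - 2 * s * (1 + 3 * m + m ^ 2)) ≤ 0 := by nlinarith [mul_nonneg hm0 hm0]
  have hms : m * s ≤ s / 4 := by nlinarith
  have hm2 : m ^ 2 ≤ m / 4 := by nlinarith
  have hm3 : 0 ≤ m ^ 3 := by positivity
  have hm2s : m ^ 2 * s ≤ m ^ 2 := by nlinarith [mul_nonneg hm0 hm0]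
  have hm2s0 : 0 ≤ m ^ 2 * s := by positivity
  have hm3s0 : 0 ≤ m ^ 3 * s := by positivity
  have hms2 : 0 ≤ m * s ^ 2 := by positivity
  have q2 : (-2 * s - 4 * m + 8 * m * s - 2 * m * (s ^ 2 - 2 * m) - 12 * m ^ 2 + 8 * m ^ 2 * s - 4 * m ^ 3
      - 2 * m ^ 3 * s) ≤ 0 := by nlinarith
  have q1 : (-3 + 4 * s - 2 * (s ^ 2 - 2 * m) - 13 * m + 12 * m * s - 2 * m * (s ^ 2 - 2 * m)
      - 13 * m ^ 2 + 4 * m ^ 2 * s - 3 * m ^ 3) ≤ 0 := by nlinarith [sq_nonneg (s - 1)]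
  have q0 : (-1 + 3 * m - 2 * m * s + 3 * m ^ 2 - m ^ 3) ≤ 0 := by nlinarith
  have m1 : 0 ≤ 1 - m := by linarith
  have e1 : 0 ≤ 1 - s + m := by linarith
  unfold PP
  have t1 := mul_nonneg (neg_nonneg.2 q4) (by positivity : 0 ≤ t ^ 4)
  have t2 := mul_nonneg (mul_nonneg m1 (neg_nonneg.2 q3)) (by positivity : 0 ≤ t ^ 3)
  have t3 := mul_nonneg (mul_nonneg hm0 (neg_nonneg.2 q2)) (by positivity : 0 ≤ t ^ 2)
  have t4 := mul_nonneg (mul_nonneg (mul_nonneg (by positivity : 0 ≤ m ^ 2) m1) (neg_nonneg.2 q1)) ht.le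
  have t5 := mul_nonneg (mul_nonneg hm3 e1) (neg_nonneg.2 q0)
  nlinarith

theorem En_low {p a b : ℝ} (hp : 1 < p) (hp2 : p < 2) (hb0 : 0 < b) (hba : b < a) (ha : a < 1/2)
    (hc : Hc p a b = 0) : En (p - 1) a b ≤ 0 := by
  have h2 := Hc_nonneg_of_le hp hp2.le (by linarith) ha.le hb0.le (by linarith) hc
  rw [Hc_two] at h2
  have hm : a * b ≤ 1/4 := by nlinarith
  have hm0 : 0 < a * b := by nlinarith
  have hs : 1 + a * b ≤ 2 * (a + b) := by
    by_contra h; push Not at h; nlinarith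
  have := stieltjes_nonneg (q := p - 1) ⟨by linarith, by linarith⟩ 8 (fun i => - cE a b i) (mE a b)
    (fun i => (mE_pos (by linarith) (by linarith) hb0 (by linarith) i).le) (by
      intro t ht
      have e : ∑ i, -cE a b i * mE a b i / (t + mE a b i) = - ∑ i, cE a b i * mE a b i / (t + mE a b i) := by
        rw [← Finset.sum_neg_distrib]; apply Finset.sum_congr rfl; intro i _; ring
      rw [e, W_eq (by linarith) (by linarith) hb0 (by linarith) ht]
      have hQ := QQ_pos (a := a) (b := b) (by linarith) (by linarith) hb0 (by linarith) ht
      have hP := PP_neg_low (s := a + b) (by linarith) hm0.le hm hs ht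
      have : (1 - (a + b) + a * b) * (1 - a * b) * t ^ 2 * PP (a + b) (a * b) t / QQ (a + b) (a * b) t ≤ 0 := by
        apply div_nonpos_of_nonpos_of_nonneg _ hQ.le
        apply mul_nonpos_of_nonneg_of_nonpos _ hP
        apply mul_nonneg (mul_nonneg (by linarith) (by linarith)) (by positivity)
      nlinarith)
  rw [En_sum]
  have e : ∑ i, -cE a b i * mE a b i ^ (p - 1) = - ∑ i, cE a b i * mE a b i ^ (p - 1) := by
    rw [← Finset.sum_neg_distrib]; apply Finset.sum_congr rfl; intro i _; ring
  rw [e] at this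
  linarith

theorem En_one (a b : ℝ) : En 1 a b = 0 := by
  unfold En; simp only [Real.rpow_one]; ring

theorem x_ge_three {s m : ℝ} (hm0 : 0 < m) (hm : m ≤ 1/4) (h2 : 2 * s ≤ 1 + m)
    (h3 : 2 * s ^ 3 - 3 * (1 + m) * s ^ 2 + 3 * (1 - m) ^ 2 * s - 1 + 6 * m + 6 * m ^ 2
      - 3 * m ^ 3 ≤ 0) : 2 * s ≤ 1 - 3 * m := by
  obtain ⟨x, hx⟩ : ∃ x : ℝ, x = (1 - 2 * s) / m := ⟨_, rfl⟩
  have hs : s = (1 - x * m) / 2 := by rw [hx]; field_simp; ring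
  subst hs
  have hx1 : -1 ≤ x := by nlinarith
  have hx3 : 3 ≤ x := by
    by_contra h
    push Not at h
    have e : 2 * ((1 - x * m) / 2) ^ 3 - 3 * (1 + m) * ((1 - x * m) / 2) ^ 2
      + 3 * (1 - m) ^ 2 * ((1 - x * m) / 2) - 1 + 6 * m + 6 * m ^ 2 - 3 * m ^ 3
      = m * ((3/4) * (3 - x) + m * ((9 * x / 2 + 15/2) - m * (x ^ 3 / 4 + 3 * x ^ 2 / 4 + 3 * x / 2 + 3))) := by
      ring
    rw [e] at h3
    have : 0 ≤ (9 * x / 2 + 15/2) - m * (x ^ 3 / 4 + 3 * x ^ 2 / 4 + 3 * x / 2 + 3) := by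
      have h0 : 0 ≤ x ^ 3 / 4 + 3 * x ^ 2 / 4 + 3 * x / 2 + 3 := by
        nlinarith [mul_nonneg (by linarith : 0 ≤ x + 1) (sq_nonneg (x)), sq_nonneg (x+1)]
      have h1 : x ^ 3 / 4 + 3 * x ^ 2 / 4 + 3 * x / 2 + 3 ≤ 4 * (9 * x / 2 + 15/2) := by
        nlinarith [mul_nonneg (mul_nonneg (by linarith : 0 ≤ x + 1) (by linarith : 0 ≤ x + 1)) (by linarith : 0 ≤ 3 - x), mul_nonneg (by linarith : 0 ≤ x + 1) (by linarith : 0 ≤ 3 - x)]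
      nlinarith
    nlinarith [mul_nonneg hm0.le this]
  nlinarith

theorem quad_prod_ge {t A1 A2 A3 A4 B1 B2 B3 B4 : ℝ} (ht : 0 < t) (a1 : 0 ≤ A1) (a2 : 0 ≤ A2)
    (a3 : 0 ≤ A3) (a4 : 0 ≤ A4) (b1 : 0 ≤ B1) (b2 : 0 ≤ B2) (b3 : 0 ≤ B3) (b4 : 0 ≤ B4) :
    t ^ 8 + (A1 + A2 + A3 + A4) * t ^ 7 ≤ (t ^ 2 + A1 * t + B1) * (t ^ 2 + A2 * t + B2) *
     (t ^ 2 + A3 * t + B3) * (t ^ 2 + A4 * t + B4) := by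
  have h : (t ^ 2 + A1 * t) * (t ^ 2 + A2 * t) * (t ^ 2 + A3 * t) * (t ^ 2 + A4 * t) ≤
     (t ^ 2 + A1 * t + B1) * (t ^ 2 + A2 * t + B2) * (t ^ 2 + A3 * t + B3) * (t ^ 2 + A4 * t + B4) := by
    refine mul_le_mul (mul_le_mul (mul_le_mul ?_ ?_ ?_ ?_) ?_ ?_ ?_) ?_ ?_ ?_ <;>
      first | linarith | positivity
  refine le_trans ?_ h
  have : (t ^ 2 + A1 * t) * (t ^ 2 + A2 * t) * (t ^ 2 + A3 * t) * (t ^ 2 + A4 * t) -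
    (t ^ 8 + (A1 + A2 + A3 + A4) * t ^ 7) = t ^ 6 * (A1 * A2 + A1 * A3 + A1 * A4 + A2 * A3 + A2 * A4 + A3 * A4)
     + t ^ 5 * (A1 * A2 * A3 + A1 * A2 * A4 + A1 * A3 * A4 + A2 * A3 * A4) + t ^ 4 * (A1 * A2 * A3 * A4) := by
    ring
  have h2 : 0 ≤ t ^ 6 * (A1 * A2 + A1 * A3 + A1 * A4 + A2 * A3 + A2 * A4 + A3 * A4)
     + t ^ 5 * (A1 * A2 * A3 + A1 * A2 * A4 + A1 * A3 * A4 + A2 * A3 * A4) + t ^ 4 * (A1 * A2 * A3 * A4) := by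
    positivity
  linarith

theorem N34_neg {s m t : ℝ} (hs0 : 0 < s) (hs2 : 2 * m ≤ s) (hm0 : 0 < m) (hm : m ≤ 1/4)
    (h : 2 * s ≤ 1 - 3 * m) (ht : 0 < t) :
    -(1 + m ^ 2 - 2 * s * (1 + m)) * QQ s m t + t ^ 4 * PP s m t ≤ 0 := by
  have hs : s ≤ 1/2 := by linarith
  have q4 : 0 ≤ (1 + m ^ 2 - 2 * s * (1 + m)) := by nlinarith
  have hms : m * s ≤ s / 4 := by nlinarith
  have hms' : m * s ≤ m / 2 := by nlinarith
  have hm2 : m ^ 2 ≤ m / 4 := by nlinarith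
  have hm3 : 0 ≤ m ^ 3 := by positivity
  have hm2s : m ^ 2 * s ≤ m ^ 2 := by nlinarith [mul_nonneg hm0.le hm0.le]
  have hm2s0 : 0 ≤ m ^ 2 * s := by positivity
  have hm3s0 : 0 ≤ m ^ 3 * s := by positivity
  have hms2 : 0 ≤ m * s ^ 2 := by positivity
  have q2 : (-2 * s - 4 * m + 8 * m * s - 2 * m * (s ^ 2 - 2 * m) - 12 * m ^ 2 + 8 * m ^ 2 * s - 4 * m ^ 3
      - 2 * m ^ 3 * s) ≤ 0 := by nlinarith
  have q1 : (-3 + 4 * s - 2 * (s ^ 2 - 2 * m) - 13 * m + 12 * m * s - 2 * m * (s ^ 2 - 2 * m)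
      - 13 * m ^ 2 + 4 * m ^ 2 * s - 3 * m ^ 3) ≤ 0 := by nlinarith [sq_nonneg (s - 1)]
  have q0 : (-1 + 3 * m - 2 * m * s + 3 * m ^ 2 - m ^ 3) ≤ 0 := by nlinarith
  have m1 : 0 ≤ 1 - m := by linarith
  have e1 : 0 ≤ 1 - s + m := by linarith
  have q7 : -(1 + m ^ 2 - 2 * s * (1 + m)) * (2 * (1 - m ^ 2)) + (1 - m) * ((1 + m) ^ 3 - 2 * s * (1 + 3 * m + m ^ 2)) ≤ 0 := by
    have : -(1 + m ^ 2 - 2 * s * (1 + m)) * (2 * (1 - m ^ 2)) + (1 - m) * ((1 + m) ^ 3 - 2 * s * (1 + 3 * m + m ^ 2))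
      = (1 - m) * ((1 + m) * ((1 + m) ^ 2 - 2 * (1 + m ^ 2)) + 2 * s * (1 + m + m ^ 2)) := by ring
    rw [this]
    apply mul_nonpos_of_nonneg_of_nonpos m1
    nlinarith
  have hQ := quad_prod_ge (t := t) (A1 := 2 - s) (A2 := s - 2 * m) (A3 := m * (2 - s)) (A4 := m * (s - 2 * m))
    (B1 := 1 - s + m) (B2 := m * (1 - s + m)) (B3 := m ^ 2 * (1 - s + m)) (B4 := m ^ 3 * (1 - s + m)) ht
    (by linarith) (by linarith) (mul_nonneg hm0.le (by linarith)) (mul_nonneg hm0.le (by linarith)) e1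
    (by positivity) (by positivity) (by positivity)
  have hQe : QQ s m t = (t ^ 2 + (2 - s) * t + (1 - s + m)) * (t ^ 2 + (s - 2 * m) * t + m * (1 - s + m)) *
     (t ^ 2 + (m * (2 - s)) * t + m ^ 2 * (1 - s + m)) * (t ^ 2 + (m * (s - 2 * m)) * t + m ^ 3 * (1 - s + m)) := by
    unfold QQ; ring
  rw [← hQe] at hQ
  have hQ2 : t ^ 8 + (2 * (1 - m ^ 2)) * t ^ 7 ≤ QQ s m t := by
    refine le_trans (le_of_eq ?_) hQ; ring
  have s1 := mul_nonneg q4 (sub_nonneg.2 hQ2)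
  have t2 := mul_nonneg (neg_nonneg.2 q7) (by positivity : 0 ≤ t ^ 7)
  have t3 := mul_nonneg (mul_nonneg hm0.le (neg_nonneg.2 q2)) (by positivity : 0 ≤ t ^ 6)
  have t4 := mul_nonneg (mul_nonneg (mul_nonneg (by positivity : 0 ≤ m ^ 2) m1) (neg_nonneg.2 q1)) (by positivity : 0 ≤ t ^ 5)
  have t5 := mul_nonneg (mul_nonneg (mul_nonneg hm3 e1) (neg_nonneg.2 q0)) (by positivity : 0 ≤ t ^ 4)
  unfold PP
  linarith only [s1, t2, t3, t4, t5]

theorem E2_eq (a b : ℝ) : ∑ i, cE a b i * mE a b i ^ 2 = (a - b) * ((1 - (a + b) + a * b) * (1 - a * b) *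
    (-(1 + (a * b) ^ 2 - 2 * (a + b) * (1 + a * b)))) := by
  simp [Fin.sum_univ_succ, cE, mE]; ring

theorem En_mid {p a b : ℝ} (hp : 3 ≤ p) (hp4 : p < 4) (hb0 : 0 < b) (hba : b < a) (ha : a < 1/2)
    (hc : Hc p a b = 0) : En (p - 1) a b ≤ 0 := by
  have h2 := Hc_nonpos_of_le (by norm_num : (1:ℝ) < 2) (by linarith) (by linarith) ha.le hb0.le (by linarith) hc
  have h3 := Hc_nonpos_of_le (by norm_num : (1:ℝ) < 3) hp (by linarith) ha.le hb0.le (by linarith) hc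
  rw [Hc_two] at h2
  rw [Hc_three] at h3
  have hm : a * b ≤ 1/4 := by nlinarith
  have hm0 : 0 < a * b := by nlinarith
  have hs : 2 * (a + b) ≤ 1 + a * b := by
    by_contra h; push Not at h; nlinarith
  have hx := x_ge_three hm0 hm hs h3
  have mp := mE_pos (a := a) (b := b) (by linarith) (by linarith) hb0 (by linarith)
  have he : 0 < (1 - (a + b) + a * b) * (1 - a * b) := mul_pos (by nlinarith) (by linarith)
  rw [En_sum]
  rcases eq_or_lt_of_le hp with h | hp3
  · have e : p - 1 = 2 := by linarith
    rw [e]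
    simp only [Real.rpow_two]
    rw [E2_eq]
    have : (-(1 + (a * b) ^ 2 - 2 * (a + b) * (1 + a * b))) ≤ 0 := by nlinarith
    have := mul_nonneg he.le (neg_nonneg.2 this)
    nlinarith
  have := stieltjes_nonneg (q := p - 3) ⟨by linarith, by linarith⟩ 8 (fun i => - (cE a b i * mE a b i ^ 2)) (mE a b)
    (fun i => (mp i).le) (by
      intro t ht
      have e : ∑ i, -(cE a b i * mE a b i ^ 2) * mE a b i / (t + mE a b i) =
        -(∑ i, cE a b i * mE a b i ^ 2) + t * (∑ i, cE a b i * mE a b i)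
          - t ^ 2 * ∑ i, cE a b i * mE a b i / (t + mE a b i) := by
        rw [← Finset.sum_neg_distrib, Finset.mul_sum, Finset.mul_sum, ← Finset.sum_add_distrib, ← Finset.sum_sub_distrib]
        apply Finset.sum_congr rfl; intro i _
        have := mp i
        field_simp
        ring
      rw [e, sum_cm, E2_eq, W_eq (by linarith) (by linarith) hb0 (by linarith) ht]
      have hQ := QQ_pos (a := a) (b := b) (by linarith) (by linarith) hb0 (by linarith) ht
      have hP := N34_neg (s := a + b) (by linarith) (by nlinarith) hm0 hm hx ht
      have e3 : -((a - b) * ((1 - (a + b) + a * b) * (1 - a * b) * (-(1 + (a * b) ^ 2 - 2 * (a + b) * (1 + a * b))))) + t * 0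
        - t ^ 2 * ((a - b) * ((1 - (a + b) + a * b) * (1 - a * b) * t ^ 2 * PP (a + b) (a * b) t / QQ (a + b) (a * b) t))
        = (a - b) * ((1 - (a + b) + a * b) * (1 - a * b)) *
         (-(-(1 + (a * b) ^ 2 - 2 * (a + b) * (1 + a * b)) * QQ (a + b) (a * b) t + t ^ 4 * PP (a + b) (a * b) t)) / QQ (a + b) (a * b) t := by
        field_simp
        ring
      rw [e3]
      apply div_nonneg _ hQ.le
      exact mul_nonneg (mul_nonneg (by linarith) he.le) (by linarith))
  have e : ∑ i, -(cE a b i * mE a b i ^ 2) * mE a b i ^ (p - 3) = - ∑ i, cE a b i * mE a b i ^ (p - 1) := by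
    rw [← Finset.sum_neg_distrib]; apply Finset.sum_congr rfl; intro i _
    have : mE a b i ^ (p - 1) = mE a b i ^ 2 * mE a b i ^ (p - 3) := by
      rw [← Real.rpow_two, ← Real.rpow_add (mp i)]; congr 1; ring
    rw [this]; ring
  rw [e] at this
  linarith

theorem Z_identity {f g r F G x1 y1 x y a b E : ℝ} (hf : 0 < f) (hg : 0 < g) (hr : 0 < r)
    (hD1 : 0 < 1 + r - r * (g * G)) (hD2 : 0 < r + 1 - f * F)
    (ha : a = f / (1 + f)) (hb : b = g / (1 + g))
    (hx1 : x1 = (1 + f) / (1 + r - r * (g * G))) (hy1 : y1 = (1 + g) * r / (r + 1 - f * F))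
    (hx : x = F * x1) (hy : y = G * y1)
    (hE : E = b * y1 - a * x1 + (1 - a - a * b) * (x * y1)
    - (1 - b - a * b) * (y * x1) - (1 + b - a * b) * (x * y * y1)
    + (1 + a - a * b) * (x * y * x1) + a * (x * (x * y * y1))
    - b * (y * (x * y * x1))) :
    E = - (((r+1)^2*(f-r*g)-(r+1)*F*(r+f*f+r*g*(1-f))+(r+1)*r*G*(1+f*(1-g)+r*g*g)
      +r*F*G*(1+f+g)*(r-1-2*f+2*r*g)) * (r + 1 - f * F - r * (g * G))
       / ((1 + r - r * (g * G)) ^ 2 * (r + 1 - f * F) ^ 2)) := by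
  have h1 : (1 + f) ≠ 0 := by positivity
  have h2 : (1 + g) ≠ 0 := by positivity
  subst hx hy hE hx1 hy1 ha hb
  generalize hd1 : 1 + r - r * (g * G) = D1 at *
  generalize hd2 : r + 1 - f * F = D2 at *
  have d1 := hD1.ne'
  have d2 := hD2.ne'
  field_simp
  subst hd1 hd2
  ring

theorem log_ge_pade {r : ℝ} (hr : 1 ≤ r) : 2 * (r - 1) / (r + 1) ≤ Real.log r := by
  have hm : MonotoneOn (fun x : ℝ => Real.log x - 2 * (x - 1) / (x + 1)) (Set.Ici 1) := by
    have hd : ∀ x : ℝ, 1 ≤ x → HasDerivAt (fun x : ℝ => Real.log x - 2 * (x - 1) / (x + 1))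
      (x⁻¹ - (2 * (x + 1) - 2 * (x - 1) * 1) / (x + 1) ^ 2) x := by
      intro x hx
      have h1 := Real.hasDerivAt_log (x := x) (by linarith)
      have h2 : HasDerivAt (fun x : ℝ => 2 * (x - 1)) 2 x := by
        simpa using ((hasDerivAt_id x).sub_const 1).const_mul 2
      have h3 : HasDerivAt (fun x : ℝ => x + 1) 1 x := (hasDerivAt_id x).add_const 1
      exact h1.sub (h2.div h3 (by linarith))
    apply monotoneOn_of_deriv_nonneg (convex_Ici 1)
    · exact fun x hx => (hd x hx).continuousAt.continuousWithinAt
    · intro x hx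
      rw [interior_Ici] at hx
      exact (hd x (le_of_lt hx)).differentiableAt.differentiableWithinAt
    · intro x hx
      rw [interior_Ici] at hx
      have hx' : 1 < x := hx
      rw [(hd x hx'.le).deriv]
      have : x⁻¹ - (2 * (x + 1) - 2 * (x - 1) * 1) / (x + 1) ^ 2 = (x - 1) ^ 2 / (x * (x + 1) ^ 2) := by
        field_simp; ring
      rw [this]; positivity
  have := hm (by simp) (by simpa using hr) hr
  simp at this
  linarith

/-- `k(r) ≥ q (r-1)/5` -/
theorem k_lower {q r : ℝ} (hq : 0 < q) (hq4 : q ≤ 1/4) (hr : 1 ≤ r) (hr2 : r ≤ 2) :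
    (r ^ (1 - q) - 1) * (1 + r) ^ q ≤ (r - 1) * (1 - q / 5) := by
  have hr0 : 0 < r := by linarith
  set u := (1 + 1 / r) ^ q with hu
  set y := r ^ q with hy
  have h1 : (1 + r) ^ q = y * u := by
    rw [hy, hu, ← Real.mul_rpow hr0.le (by positivity)]; congr 1; field_simp; ring
  have h2 : r ^ (1 - q) * y = r := by
    rw [hy, ← Real.rpow_add hr0]; simp
  have e : (r ^ (1 - q) - 1) * (1 + r) ^ q = u * (r - y) := by
    rw [h1]; linear_combination u * h2
  rw [e]
  have L2 : Real.log (1 + 1 / r) ≤ 2 / (r + 1) - 1/5 := by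
    have : (1 + 1 / r) = 2 * ((r + 1) / (2 * r)) := by field_simp
    rw [this, Real.log_mul (by norm_num) (by positivity)]
    have h3 := Real.log_le_sub_one_of_pos (x := (r + 1) / (2 * r)) (by positivity)
    have h4 := Real.log_two_lt_d9
    have h5 : 0.6931471808 + ((r + 1) / (2 * r) - 1) ≤ 2 / (r + 1) - 1/5 := by
      rw [← sub_nonneg]
      have : 2 / (r + 1) - 1/5 - (0.6931471808 + ((r + 1) / (2 * r) - 1)) =
        (4 * r - 2 * r * (r + 1) * (0.8931471808) + (r ^ 2 - 1)) / (2 * r * (r + 1)) := by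
        field_simp; ring
      rw [this]
      apply div_nonneg _ (by positivity)
      nlinarith
    linarith
  have hu_pos : 0 < u := Real.rpow_pos_of_pos (by positivity) _
  have L1 := log_ge_pade hr
  have hyl : 1 + q * (2 * (r - 1) / (r + 1)) ≤ y := by
    have : y = Real.exp (Real.log r * q) := by rw [hy, Real.rpow_def_of_pos hr0]
    rw [this]
    have := Real.add_one_le_exp (Real.log r * q)
    nlinarith
  have hul : u * (1 - q * (2 / (r + 1) - 1/5)) ≤ 1 := by
    have h5 : u = Real.exp (Real.log (1 + 1 / r) * q) := by rw [hu, Real.rpow_def_of_pos (by positivity)]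
    have h6 := Real.add_one_le_exp (-(Real.log (1 + 1 / r) * q))
    have h7 : u * Real.exp (-(Real.log (1 + 1 / r) * q)) = 1 := by
      rw [h5, ← Real.exp_add]; simp
    have h8 : u * (1 - q * (2 / (r + 1) - 1/5)) ≤ u * Real.exp (-(Real.log (1 + 1 / r) * q)) :=
      mul_le_mul_of_nonneg_left (by nlinarith) hu_pos.le
    linarith
  have hw : 2 / (r + 1) ≤ 1 := by rw [div_le_one (by linarith)]; linarith
  have hw0 : 0 ≤ 2 / (r + 1) := by positivity
  have e2 : 2 * (r - 1) / (r + 1) = (r - 1) * (2 / (r + 1)) := by ring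
  rw [e2] at hyl
  generalize 2 / (r + 1) = w at *
  -- r - y ≤ (r-1)(1 - q w)
  have h8 : u * (r - y) ≤ u * ((r - 1) * (1 - q * w)) := by
    apply mul_le_mul_of_nonneg_left _ hu_pos.le
    nlinarith
  refine h8.trans ?_
  have hw5 : 1/5 ≤ w := by
    have : 0 < Real.log (1 + 1 / r) := Real.log_pos (by simp [hr0])
    linarith
  have h9 : u * (1 - q * w) ≤ 1 - q / 5 := by
    -- (1 - q w) ≤ (1 - q/5) (1 - q (w - 1/5))
    have h10 : (1 - q * w) ≤ (1 - q / 5) * (1 - q * (w - 1/5)) := by nlinarith [mul_nonneg (mul_nonneg hq.le hq.le) (by linarith : 0 ≤ w - 1/5)]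
    have h11 : 0 ≤ 1 - q / 5 := by linarith
    calc u * (1 - q * w) ≤ u * ((1 - q / 5) * (1 - q * (w - 1/5))) := mul_le_mul_of_nonneg_left h10 hu_pos.le
      _ = (1 - q / 5) * (u * (1 - q * (w - 1/5))) := by ring
      _ ≤ (1 - q / 5) * 1 := mul_le_mul_of_nonneg_left hul h11
      _ = _ := by ring
  have : 0 ≤ r - 1 := by linarith
  nlinarith

set_option maxHeartbeats 1000000 in
theorem high_red {p a b : ℝ} (hp : 2 ≤ p) (hb : 0 < b) (hab : b < a) (ha : a < 1/2)
    (hc : Hc p a b = 0) : ∃ f g r : ℝ, 0 < g ∧ g < f ∧ f < 1 ∧ 1 ≤ r ∧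
      (1 + f) ^ p = 1 + r - r * (g * g ^ (p - 1)) ∧ r * (1 + g) ^ p = r + 1 - f * f ^ (p - 1) ∧
      (0 ≤ ((r+1)^2*(f-r*g)-(r+1)*f^(p-1)*(r+f*f+r*g*(1-f))+(r+1)*r*g^(p-1)*(1+f*(1-g)+r*g*g)
      +r*f^(p-1)*g^(p-1)*(1+f+g)*(r-1-2*f+2*r*g)) → En (p - 1) a b ≤ 0) := by
  have ha0 : 0 < a := hb.trans hab
  have pa : 0 < 1 - a := by linarith
  have pb : 0 < 1 - b := by linarith
  have hpw : ∀ z : ℝ, 0 < z → z ^ p = z * z ^ (p - 1) := by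
    intro z hz
    rw [← Real.rpow_one_add' hz.le (by linarith)]; congr 1; ring
  have hA := rpow_lt_one_aux (p := p) (by linarith) ha0.le (by linarith : a < 1)
  have hB := rpow_lt_one_aux (p := p) (by linarith) hb.le (by linarith : b < 1)
  have hB0 : 0 < b ^ p := Real.rpow_pos_of_pos hb _
  have hA0 : 0 < a ^ p := Real.rpow_pos_of_pos ha0 _
  have hX0 : 0 < (1 - a) ^ p := Real.rpow_pos_of_pos pa _
  have hY0 : 0 < (1 - b) ^ p := Real.rpow_pos_of_pos pb _
  set f := a / (1 - a) with hf
  set g := b / (1 - b) with hg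
  set r := (1 - b) ^ p * (1 - a ^ p) / ((1 - a) ^ p * (1 - b ^ p)) with hr
  have hf0 : 0 < f := by positivity
  have hg0 : 0 < g := by positivity
  have hfg : g < f := by rw [hf, hg, div_lt_div_iff₀ pb pa]; nlinarith
  have hf1 : f < 1 := by rw [hf, div_lt_one pa]; linarith
  have efp : f ^ p = a ^ p / (1 - a) ^ p := Real.div_rpow ha0.le pa.le _
  have egp : g ^ p = b ^ p / (1 - b) ^ p := Real.div_rpow hb.le pb.le _
  have e1f : 1 + f = 1 / (1 - a) := by rw [hf]; field_simp; ring
  have e1g : 1 + g = 1 / (1 - b) := by rw [hg]; field_simp; ring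
  have e1fp : (1 + f) ^ p = 1 / (1 - a) ^ p := by rw [e1f, Real.div_rpow (by norm_num) pa.le, Real.one_rpow]
  have e1gp : (1 + g) ^ p = 1 / (1 - b) ^ p := by rw [e1g, Real.div_rpow (by norm_num) pb.le, Real.one_rpow]
  have hcc := hc
  unfold Hc at hc
  rw [Real.mul_rpow (by positivity) (by positivity), Real.mul_rpow (by positivity) (by positivity), Real.mul_rpow (by positivity) (by positivity)] at hc
  have hr0 : 0 < r := by
    rw [hr]; have : 0 < 1 - a ^ p := by linarith
    have : 0 < 1 - b ^ p := by linarith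
    positivity
  have n1 : 1 - b ^ p ≠ 0 := by linarith
  have n2 : (1 - a) ^ p ≠ 0 := hX0.ne'
  have n3 : (1 - b) ^ p ≠ 0 := hY0.ne'
  have E1 : (1 + f) ^ p = 1 + r - r * (g * g ^ (p - 1)) := by
    rw [← hpw g hg0, e1fp, egp, hr]
    generalize (1 - a) ^ p = X at *
    generalize (1 - b) ^ p = Y at *
    generalize a ^ p = A at *
    generalize hBB : 1 - b ^ p = B at *
    have : b ^ p = 1 - B := by linarith
    rw [this] at hc ⊢
    field_simp
    linear_combination hc
  have E2 : r * (1 + g) ^ p = r + 1 - f * f ^ (p - 1) := by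
    rw [← hpw f hf0, e1gp, efp, hr]
    generalize (1 - a) ^ p = X at *
    generalize (1 - b) ^ p = Y at *
    generalize a ^ p = A at *
    generalize hBB : 1 - b ^ p = B at *
    have : b ^ p = 1 - B := by linarith
    rw [this] at hc
    field_simp
    linear_combination hc
  have hr1 : 1 ≤ r := by
    rw [hr, one_le_div (by have : 0 < 1 - b ^ p := by linarith
                           positivity)]
    set l := (1 - a) / (1 - b) with hl
    have hl0 : 0 < l := by positivity
    have hl1 : l < 1 := by rw [hl, div_lt_one pb]; linarith
    have h1 : l ^ p ≤ l := by
      have := Real.rpow_le_rpow_of_exponent_ge hl0 hl1.le (by linarith : (1:ℝ) ≤ p)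
      simpa using this
    have h2 : l ^ p = (1 - a) ^ p / (1 - b) ^ p := Real.div_rpow pa.le pb.le _
    have h3 := (convexOn_rpow (p := p) (by linarith)).2 (x := b) (y := 1) hb.le (by norm_num : (0:ℝ) ≤ 1) hl0.le (by linarith : 0 ≤ 1 - l) (by ring)
    simp only [smul_eq_mul, mul_one, Real.one_rpow] at h3
    have h4 : l * b + (1 - l) = a := by rw [hl]; field_simp; ring
    rw [h4] at h3
    have h5 : (1 - a) ^ p = l ^ p * (1 - b) ^ p := by rw [h2]; field_simp
    rw [h5]
    have h6 : l ^ p * (1 - b ^ p) ≤ l * (1 - b ^ p) := mul_le_mul_of_nonneg_right h1 (by linarith)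
    nlinarith
  refine ⟨f, g, r, hg0, hfg, hf1, hr1, E1, E2, ?_⟩
  intro hZ
  clear_value f g r
  have q1 : (a * (1 - b)) ^ (p - 1) = a ^ (p-1) * (1 - b) ^ (p-1) :=
    Real.mul_rpow (by positivity) (by positivity)
  have q2 : (b * (1 - a)) ^ (p - 1) = b ^ (p-1) * (1 - a) ^ (p-1) :=
    Real.mul_rpow (by positivity) (by positivity)
  have q3 : (a * b * (1 - b)) ^ (p - 1) = a ^ (p-1) * b ^ (p-1) * (1 - b) ^ (p-1) := by
    rw [Real.mul_rpow (by positivity) (by positivity), Real.mul_rpow (by positivity) (by positivity)]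
  have q4 : (a * b * (1 - a)) ^ (p - 1) = a ^ (p-1) * b ^ (p-1) * (1 - a) ^ (p-1) := by
    rw [Real.mul_rpow (by positivity) (by positivity), Real.mul_rpow (by positivity) (by positivity)]
  have q5 : (a * (a * b * (1 - b))) ^ (p - 1) = a ^ (p-1) * (a ^ (p-1) * b ^ (p-1) * (1 - b) ^ (p-1)) := by
    rw [Real.mul_rpow (by positivity) (by positivity), q3]
  have q6 : (b * (a * b * (1 - a))) ^ (p - 1) = b ^ (p-1) * (a ^ (p-1) * b ^ (p-1) * (1 - a) ^ (p-1)) := by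
    rw [Real.mul_rpow (by positivity) (by positivity), q4]
  have hD1 : 0 < 1 + r - r * (g * g ^ (p - 1)) := by rw [← E1]; positivity
  have hD2 : 0 < r + 1 - f * f ^ (p - 1) := by rw [← E2]; positivity
  have hFX : a ^ (p - 1) = f ^ (p - 1) * (1 - a) ^ (p - 1) := by
    rw [← Real.mul_rpow hf0.le pa.le, hf]; congr 1; field_simp
  have hGY : b ^ (p - 1) = g ^ (p - 1) * (1 - b) ^ (p - 1) := by
    rw [← Real.mul_rpow hg0.le pb.le, hg]; congr 1; field_simp
  have hx1 : (1 - a) ^ (p - 1) = (1 + f) / (1 + r - r * (g * g ^ (p - 1))) := by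
    rw [← E1, e1fp, e1f, hpw _ pa]; field_simp
  have hy1 : (1 - b) ^ (p - 1) = (1 + g) * r / (r + 1 - f * f ^ (p - 1)) := by
    rw [← E2, e1gp, e1g, hpw _ pb]; field_simp
  have K := Z_identity (E := En (p - 1) a b) hf0 hg0 hr0 hD1 hD2 (by rw [e1f, hf, div_div_div_cancel_right₀ pa.ne', div_one]) (by rw [e1g, hg, div_div_div_cancel_right₀ pb.ne', div_one]) hx1 hy1 hFX hGY
    (by unfold En; rw [q1, q2, q3, q4, q5, q6]; try ring)
  rw [K, neg_nonpos]
  have hFF : f * f ^ (p - 1) < 1 := by rw [← hpw _ hf0]; exact rpow_lt_one_aux (by linarith) hf0.le hf1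
  have hGG : g * g ^ (p - 1) < 1 := by rw [← hpw _ hg0]; exact rpow_lt_one_aux (by linarith) hg0.le (by linarith)
  have : 0 ≤ r + 1 - f * f ^ (p - 1) - r * (g * g ^ (p - 1)) := by nlinarith
  positivity

theorem phi_nonneg {p f : ℝ} (hp : 4 ≤ p) (hf : 1.09 ≤ p * f) (hf1 : f ≤ 1) :
    0 ≤ p * f - p * f ^ (p - 1) + f ^ p - 1 := by
  set φ : ℝ → ℝ := fun x => p * x - p * x ^ (p - 1) + x ^ p - 1 with hφ
  have hd : ∀ x : ℝ, HasDerivAt φ (p - p * ((p - 1) * x ^ (p - 1 - 1)) + p * x ^ (p - 1)) x := by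
    intro x
    have h1 : HasDerivAt (fun x : ℝ => p * x) p x := by simpa using (hasDerivAt_id x).const_mul p
    have h2 := (Real.hasDerivAt_rpow_const (x := x) (p := p - 1) (Or.inr (by linarith))).const_mul p
    have h3 := (Real.hasDerivAt_rpow_const (x := x) (p := p) (Or.inr (by linarith)))
    exact ((h1.sub h2).add h3).sub_const 1
  have hconc : ConcaveOn ℝ (Set.Icc 0 1) φ := by
    apply AntitoneOn.concaveOn_of_deriv (convex_Icc 0 1)
    · exact fun x hx => (hd x).continuousAt.continuousWithinAt
    · exact fun x hx => (hd x).differentiableAt.differentiableWithinAt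
    · rw [interior_Icc]
      intro x hx y hy hxy
      rw [(hd x).deriv, (hd y).deriv]
      have e : ∀ z : ℝ, 0 < z → (p - 1) * z ^ (p - 1 - 1) - z ^ (p - 1) = z ^ (p - 3) * (z * (p - 1 - z)) := by
        intro z hz
        have e1 : z ^ (p - 1 - 1) = z ^ (p - 3) * z := by
          rw [← Real.rpow_add_one hz.ne']; congr 1; ring
        have e2 : z ^ (p - 1) = z ^ (p - 3) * z * z := by
          rw [← Real.rpow_add_one hz.ne', ← Real.rpow_add_one hz.ne']; congr 1; ring
        rw [e1, e2]; ring
      have hh : x ^ (p - 3) * (x * (p - 1 - x)) ≤ y ^ (p - 3) * (y * (p - 1 - y)) := by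
        apply mul_le_mul
        · exact Real.rpow_le_rpow hx.1.le hxy (by linarith)
        · nlinarith [hx.1, hx.2, hy.1, hy.2]
        · nlinarith [hx.1, hx.2, hy.1, hy.2]
        · exact (Real.rpow_pos_of_pos hy.1 _).le
      rw [← e x hx.1, ← e y hy.1] at hh
      nlinarith
  have hp0 : 0 < p := by linarith
  have hk0 : 0 < 1.09 / p := by positivity
  have hk1 : 1.09 / p ≤ 1 := by rw [div_le_one hp0]; linarith
  have hfk : 1.09 / p ≤ f := by rw [div_le_iff₀ hp0]; linarith
  have h1 : φ 1 = 0 := by simp [hφ]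
  have h2 : 0 ≤ φ (1.09 / p) := by
    have hk4 : 1.09 / p ≤ 1.09 / 4 := div_le_div_of_nonneg_left (by norm_num) (by norm_num) hp
    have e1 : (1.09 / p) ^ (p - 1) = (1.09 / p) ^ (p - 2) * (1.09 / p) := by
      rw [← Real.rpow_add_one hk0.ne']; congr 1; ring
    have h3 : (1.09 / p) ^ (p - 2) ≤ (1.09 / p) ^ (2:ℝ) :=
      Real.rpow_le_rpow_of_exponent_ge hk0 hk1 (by linarith)
    rw [Real.rpow_two] at h3
    have h4 : (1.09 / p) ^ 2 ≤ (1.09 / 4) ^ 2 := pow_le_pow_left₀ hk0.le hk4 2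
    have h5 : 0 < (1.09 / p) ^ p := Real.rpow_pos_of_pos hk0 _
    simp only [hφ]
    rw [e1]
    have h6 : p * (1.09 / p) = 1.09 := by field_simp
    have h7 : p * ((1.09 / p) ^ (p - 2) * (1.09 / p)) = 1.09 * (1.09 / p) ^ (p - 2) := by
      calc _ = (p * (1.09 / p)) * (1.09 / p) ^ (p - 2) := by ring
        _ = _ := by rw [h6]
    rw [h6, h7]
    norm_num at h4 h3 ⊢
    linarith
  have hcc := hconc.2 (x := 1.09 / p) (y := 1) ⟨hk0.le, hk1⟩ ⟨by norm_num, le_refl _⟩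
  have hl : 0 < 1 - 1.09 / p := by rw [sub_pos, div_lt_one hp0]; linarith
  have := @hcc ((1 - f) / (1 - 1.09 / p)) ((f - 1.09 / p) / (1 - 1.09 / p))
    (div_nonneg (by linarith) hl.le) (div_nonneg (by linarith) hl.le) (by rw [← add_div, div_eq_one_iff_eq hl.ne']; ring)
  simp only [smul_eq_mul] at this
  have e : (1 - f) / (1 - 1.09 / p) * (1.09 / p) + (f - 1.09 / p) / (1 - 1.09 / p) * 1 = f := by
    generalize 1.09 / p = k at *
    field_simp
    ring
  rw [e, h1] at this
  have h9 : 0 ≤ (1 - f) / (1 - 1.09 / p) * φ (1.09 / p) := mul_nonneg (div_nonneg (by linarith) hl.le) h2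
  have : 0 ≤ φ f := by linarith
  exact this

theorem incr_conv {p s h : ℝ} (hp : 1 ≤ p) (hs : 1 ≤ s) (hh : 0 < h) :
    (1 + h) ^ p + s ^ p ≤ 1 + (s + h) ^ p := by
  have hc := (convexOn_rpow hp).2
  have hl : 0 < s + h - 1 := by linarith
  have h1 := hc (x := 1) (y := s + h) (by norm_num : (0:ℝ) ≤ 1) (by positivity : 0 ≤ s + h)
    (a := (s - 1) / (s + h - 1)) (b := h / (s + h - 1)) (div_nonneg (by linarith) hl.le) (by positivity)
    (by rw [← add_div, div_eq_one_iff_eq hl.ne']; ring)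
  have h2 := hc (x := 1) (y := s + h) (by norm_num : (0:ℝ) ≤ 1) (by positivity : 0 ≤ s + h)
    (a := h / (s + h - 1)) (b := (s - 1) / (s + h - 1)) (by positivity) (div_nonneg (by linarith) hl.le)
    (by rw [← add_div, div_eq_one_iff_eq hl.ne']; ring)
  simp only [smul_eq_mul, Real.one_rpow] at h1 h2
  have e1 : (s - 1) / (s + h - 1) * 1 + h / (s + h - 1) * (s + h) = 1 + h := by
    field_simp; ring
  have e2 : h / (s + h - 1) * 1 + (s - 1) / (s + h - 1) * (s + h) = s := by
    field_simp; ring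
  rw [e1] at h1
  rw [e2] at h2
  have e3 : (s - 1) / (s + h - 1) + h / (s + h - 1) = 1 := by
    rw [← add_div, div_eq_one_iff_eq hl.ne']; ring
  generalize (s - 1) / (s + h - 1) = A at *
  generalize h / (s + h - 1) = B at *
  have : B = 1 - A := by linarith
  subst this
  linarith

set_option maxHeartbeats 4000000 in
theorem Z_nonneg {p f g r : ℝ} (hp : 4 ≤ p) (hg : 0 < g) (hgf : g < f) (hf1 : f < 1) (hr : 1 ≤ r)
    (E1 : (1 + f) ^ p = 1 + r - r * (g * g ^ (p - 1))) (E2 : r * (1 + g) ^ p = r + 1 - f * f ^ (p - 1)) :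
    0 ≤ ((r+1)^2*(f-r*g)-(r+1)*f^(p-1)*(r+f*f+r*g*(1-f))+(r+1)*r*g^(p-1)*(1+f*(1-g)+r*g*g)
      +r*f^(p-1)*g^(p-1)*(1+f+g)*(r-1-2*f+2*r*g)) := by
  have hf : 0 < f := hg.trans hgf
  have hp0 : 0 < p := by linarith
  have hr0 : 0 < r := by linarith
  have hpw : ∀ z : ℝ, 0 < z → z ^ p = z * z ^ (p - 1) := by
    intro z hz
    rw [← Real.rpow_one_add' hz.le (by linarith)]; congr 1; ring
  have hF0 : 0 < f ^ (p - 1) := Real.rpow_pos_of_pos hf _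
  have hG0 : 0 < g ^ (p - 1) := Real.rpow_pos_of_pos hg _
  have hFG : g ^ (p - 1) < f ^ (p - 1) := Real.rpow_lt_rpow hg.le hgf (by linarith)
  have hF3 : f ^ (p - 1) ≤ f ^ 3 := by
    have := Real.rpow_le_rpow_of_exponent_ge hf hf1.le (by linarith : (3:ℝ) ≤ p - 1)
    exact_mod_cast this
  have hG3 : g ^ (p - 1) ≤ g ^ 3 := by
    have := Real.rpow_le_rpow_of_exponent_ge hg (by linarith) (by linarith : (3:ℝ) ≤ p - 1)
    exact_mod_cast this
  have hB : 1 + p * g ≤ (1 + g) ^ p := one_add_mul_self_le_rpow_one_add (by linarith) (by linarith)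
  have hrg : r * g * p ≤ 1 - f * f ^ (p - 1) := by nlinarith
  have hph : 1.09 ≤ p * f → 0 ≤ p * f - p * f ^ (p - 1) + f ^ p - 1 := fun h => phi_nonneg hp h hf1.le
  rw [hpw f hf] at hph
  have hr4 : 4 * f + 6 * f ^ 2 ≤ r := by
    have h1 : (1 + f) ^ (4:ℝ) ≤ (1 + f) ^ p := Real.rpow_le_rpow_of_exponent_le (by linarith) hp
    have h2 : (1 + f) ^ (4:ℝ) = (1 + f) ^ 4 := by exact_mod_cast Real.rpow_natCast (1 + f) 4
    rw [h2, E1] at h1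
    have : 0 < r * (g * g ^ (p - 1)) := by positivity
    nlinarith [pow_pos hf 3, pow_pos hf 4]
  by_cases hA : 1 - f * f ^ (p - 1) ≤ p * (f - f ^ (p - 1))
  · -- case A
    clear E1 E2 hB hph hpw
    generalize f ^ (p - 1) = F at *
    generalize g ^ (p - 1) = G at *
    have h1 : r * g ≤ f - F := by
      have : p * (r * g) ≤ p * (f - F) := by linarith
      exact le_of_mul_le_mul_left this hp0
    have h0 : 0 < r * g := by positivity
    have h2 : 0 ≤ (r+1)^2*(f-r*g)-(r+1)*F*(r+f*f+r*g*(1-f)) := by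
      have : f * f + r * g * (1 - f) ≤ 1 := by nlinarith
      have h3 : F * (r + f * f + r * g * (1 - f)) ≤ F * (r + 1) := mul_le_mul_of_nonneg_left (by linarith) hF0.le
      have h4 : F * (r + 1) ≤ (f - r * g) * (r + 1) := mul_le_mul_of_nonneg_right (by linarith) (by linarith)
      nlinarith
    have h3 : 0 ≤ (r+1)*(1+f*(1-g)+r*g*g) + F*(1+f+g)*(r-1-2*f+2*r*g) := by
      have a1 : 0 ≤ f * (1 - g) := mul_nonneg hf.le (by linarith)
      have a2 : 0 ≤ r * g * g := by positivity
      have a3 : 2 ≤ (r+1)*(1+f*(1-g)+r*g*g) := by nlinarith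
      by_cases h4 : 0 ≤ r - 1 - 2 * f
      · have : 0 ≤ r-1-2*f+2*r*g := by linarith
        have : 0 ≤ F*(1+f+g)*(r-1-2*f+2*r*g) := mul_nonneg (by positivity) this
        linarith
      · push Not at h4
        have h5 : f < 1/2 := by nlinarith
        have h6 : F ≤ 1/8 := by
          have : f ^ 3 ≤ (1/2:ℝ)^3 := pow_le_pow_left₀ hf.le h5.le 3
          norm_num at this ⊢; linarith
        have h7 : F * (1 + f + g) ≤ 1/4 := by nlinarith
        have h8 : 0 < F * (1 + f + g) := by positivity
        have h9 : -1 ≤ r-1-2*f+2*r*g := by linarith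
        have h10 := mul_le_mul_of_nonneg_left h9 h8.le
        linarith
    have h4 : 0 ≤ r * G * ((r+1)*(1+f*(1-g)+r*g*g) + F*(1+f+g)*(r-1-2*f+2*r*g)) := mul_nonneg (by positivity) h3
    linarith
  · -- case B
    have hpf : p * f < 1.09 := by
      by_contra h
      push Not at h
      have := hph h
      apply hA; linarith
    clear hph
    have hf4 : f < 0.2725 := by nlinarith
    have hrg4 : r * g * p ≤ 1 := by
      have : 0 < f * f ^ (p - 1) := by positivity
      linarith
    have hrg4' : r * g ≤ 1/4 := by
      have : 0 < r * g := by positivity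
      nlinarith
    have hg4 : g ≤ 1/4 := by nlinarith
    have hgG : g * g ^ (p - 1) ≤ 1/256 := by
      have : g ^ 3 ≤ (1/4:ℝ)^3 := pow_le_pow_left₀ hg.le hg4 3
      nlinarith
    have hr2 : r ≤ 2 := by
      have h1 : (1 + f) ^ p ≤ Real.exp 1.09 := by
        have h2 : (1 + f) ^ p ≤ (Real.exp f) ^ p := Real.rpow_le_rpow (by linarith) (by linarith [Real.add_one_le_exp f]) hp0.le
        rw [← Real.exp_mul] at h2
        exact h2.trans (Real.exp_le_exp.2 (by linarith))
      have h3 : Real.exp 1.09 ≤ 2.99 := by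
        have : (1.09:ℝ) = 1 + 0.09 := by norm_num
        rw [this, Real.exp_add]
        have h4 := Real.exp_one_lt_d9
        have h5 : Real.exp 0.09 ≤ 1.099 := by
          have := Real.exp_bound_div_one_sub_of_interval (x := 0.09) (by norm_num) (by norm_num)
          refine this.trans (by norm_num)
        have := Real.exp_pos 1
        have := Real.exp_pos 0.09
        nlinarith
      nlinarith
    have hq : 0 < 1 / p := by positivity
    have hq4 : 1 / p ≤ 1 / 4 := one_div_le_one_div_of_le (by norm_num) hp
    have hk := k_lower hq hq4 hr hr2
    -- f^p ≥ r g^p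
    have hs0 : 0 < r ^ (1 / p) := Real.rpow_pos_of_pos hr0 _
    have hs1 : 1 ≤ r ^ (1 / p) := Real.one_le_rpow hr hq.le
    have hsp : (r ^ (1 / p)) ^ p = r := by rw [← Real.rpow_mul hr0.le]; field_simp; simp
    have hfg : r * g ^ p ≤ f ^ p := by
      by_contra hcon
      push Not at hcon
      have h1 : f < r ^ (1 / p) * g := by
        by_contra h2
        push Not at h2
        have := Real.rpow_le_rpow (by positivity) h2 hp0.le
        rw [Real.mul_rpow hs0.le hg.le, hsp] at this
        linarith
      have h2 := incr_conv (p := p) (s := r ^ (1 / p)) (h := r ^ (1 / p) * g) (by linarith) hs1 (by positivity)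
      have h3 : (1 + f) ^ p ≤ (1 + r ^ (1 / p) * g) ^ p := Real.rpow_le_rpow (by linarith) (by linarith) hp0.le
      have h4 : (r ^ (1 / p) + r ^ (1 / p) * g) ^ p = r * (1 + g) ^ p := by
        rw [show r ^ (1 / p) + r ^ (1 / p) * g = r ^ (1 / p) * (1 + g) by ring, Real.mul_rpow hs0.le (by linarith), hsp]
      rw [h4, hsp, E2] at h2
      rw [E1] at h3
      rw [← hpw g hg] at h3
      rw [← hpw f hf] at h2
      have h5 : g ^ p < f ^ p := Real.rpow_lt_rpow hg.le hgf hp0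
      have h6 : g ^ p < 1 := rpow_lt_one_aux (by linarith) hg.le (by linarith)
      nlinarith
    have hδ : (r - 1) * (1 / p / 5) ≤ f - r * g := by
      have t1 : 1 + f = (1 + r - r * g ^ p) ^ (1 / p) := by
        rw [hpw g hg, ← E1, ← Real.rpow_mul (by linarith)]; field_simp; simp
      have t2 : r ^ (1 / p) * (1 + g) = (1 + r - f ^ p) ^ (1 / p) := by
        have : 1 + r - f ^ p = r * (1 + g) ^ p := by rw [E2, hpw f hf]; ring
        rw [this, Real.mul_rpow hr0.le (by positivity), ← Real.rpow_mul (by linarith) p]; field_simp; simp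
      have t3 : r ^ (1 - 1 / p) * r ^ (1 / p) = r := by rw [← Real.rpow_add hr0]; simp
      have hfp1 : f ^ p < 1 := rpow_lt_one_aux (by linarith) hf.le (by linarith)
      have t4 : (1 + r - f ^ p) ^ (1 / p) ≤ (1 + r - r * g ^ p) ^ (1 / p) :=
        Real.rpow_le_rpow (by linarith) (by linarith) hq.le
      have hgp : 0 < g ^ p := Real.rpow_pos_of_pos hg _
      have t5 : (1 + r - r * g ^ p) ^ (1 / p) ≤ (1 + r) ^ (1 / p) :=
        Real.rpow_le_rpow (by nlinarith) (by nlinarith) hq.le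
      have t6 : 1 ≤ r ^ (1 - 1 / p) := Real.one_le_rpow hr (by linarith)
      have t7 : r * (1 + g) = r ^ (1 - 1 / p) * (1 + r - f ^ p) ^ (1 / p) := by
        rw [← t2, ← mul_assoc, t3]
      rw [← t1] at t4 t5
      have t8 : r * (1 + g) ≤ r ^ (1 - 1 / p) * (1 + f) := by
        rw [t7]; exact mul_le_mul_of_nonneg_left t4 (by linarith)
      have t9 : (r ^ (1 - 1 / p) - 1) * (1 + f) ≤ (r ^ (1 - 1 / p) - 1) * (1 + r) ^ (1 / p) :=
        mul_le_mul_of_nonneg_left t5 (by linarith)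
      nlinarith
    have hFGd : f ^ (p - 1) - g ^ (p - 1) ≤ 0.223 * (f - g) := by
      have h1 := one_add_mul_self_le_rpow_one_add (s := g / f - 1) (p := p - 1) (by have : 0 < g / f := by positivity
                                                                                    linarith) (by linarith)
      rw [show 1 + (g / f - 1) = g / f by ring, Real.div_rpow hg.le hf.le, le_div_iff₀ hF0] at h1
      have h2 : (p - 1) * (1 - g / f) * f ^ (p - 1) ≤ (p - 1) * (1 - g / f) * f ^ 3 := by
        apply mul_le_mul_of_nonneg_left hF3
        apply mul_nonneg (by linarith)
        rw [sub_nonneg, div_le_one hf]; exact hgf.le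
      have h3 : (p - 1) * (1 - g / f) * f ^ 3 = (p - 1) * f ^ 2 * (f - g) := by field_simp
      have h4 : (p - 1) * f ^ 2 ≤ 0.223 := by
        have h5 : (p * f) ^ 2 ≤ 1.09 ^ 2 := pow_le_pow_left₀ (by positivity) hpf.le 2
        have h6 : (p - 1) ≤ 3 / 16 * p ^ 2 := by nlinarith
        have : (p - 1) * f ^ 2 ≤ 3 / 16 * p ^ 2 * f ^ 2 := mul_le_mul_of_nonneg_right h6 (by positivity)
        norm_num at h5 ⊢
        nlinarith
      have : (p - 1) * f ^ 2 * (f - g) ≤ 0.223 * (f - g) := mul_le_mul_of_nonneg_right h4 (by linarith)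
      nlinarith
    have hδ0 : 0 ≤ f - r * g := le_trans (by have : 0 ≤ r - 1 := by linarith
                                             positivity) hδ
    have hrgd : (r - 1) * g * r ≤ 5 * (f - r * g) := by
      have h1 : (r - 1) ≤ 5 * p * (f - r * g) := by
        have := mul_le_mul_of_nonneg_left hδ (by positivity : 0 ≤ 5 * p)
        have e : 5 * p * ((r - 1) * (1 / p / 5)) = r - 1 := by field_simp
        linarith
      calc (r - 1) * g * r = (r - 1) * (r * g) := by ring
        _ ≤ 5 * p * (f - r * g) * (r * g) := mul_le_mul_of_nonneg_right h1 (by positivity)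
        _ = 5 * (f - r * g) * (r * g * p) := by ring
        _ ≤ 5 * (f - r * g) * 1 := mul_le_mul_of_nonneg_left hrg4 (by linarith)
        _ = _ := by ring
    have hG64 : g ^ (p - 1) ≤ 1 / 64 := by
      have : g ^ 3 ≤ (1/4:ℝ)^3 := pow_le_pow_left₀ hg.le hg4 3
      norm_num at this ⊢; linarith
    have hF40 : f ^ (p - 1) ≤ 1 / 40 := by
      have : f ^ 3 ≤ (0.2725:ℝ)^3 := pow_le_pow_left₀ hf.le hf4.le 3
      norm_num at this ⊢; linarith
    clear hk hB hδ hfg hsp hs0 hs1 E1 E2 hpw hrg hA hr4 hF3 hG3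
    generalize f ^ (p - 1) = F at *
    generalize g ^ (p - 1) = G at *
    obtain ⟨d, hd⟩ : ∃ d, d = f - r * g := ⟨_, rfl⟩
    rw [← hd] at hδ0 hrgd
    have hrg0 : 0 < r * g := by positivity
    have s1 : (F - G) * (r+f*f+r*g*(1-f)) ≤ 1.9 * d := by
      have b1 : r+f*f+r*g*(1-f) ≤ r + 0.33 := by
        have k1 : f * f ≤ 0.2725 * 0.2725 := mul_le_mul hf4.le hf4.le hf.le (by norm_num)
        have k2 : r * g * (1 - f) ≤ r * g * 1 := mul_le_mul_of_nonneg_left (by linarith) hrg0.le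
        norm_num at k1 ⊢
        linarith
      have b2 : 0 ≤ r+f*f+r*g*(1-f) := by
        have : 0 ≤ 1 - f := by linarith
        positivity
      have b3 : (F - G) * (r+f*f+r*g*(1-f)) ≤ 0.223 * (f - g) * (r + 0.33) := by
        apply mul_le_mul hFGd b1 b2; linarith
      have b4 : (f - g) * (r + 0.33) = d * (r + 0.33) + (r - 1) * g * r + 0.33 * ((r - 1) * g) := by rw [hd]; ring
      have b5 : (r - 1) * g ≤ (r - 1) * g * r := by
        have : 0 ≤ (r - 1) * g := mul_nonneg (by linarith) hg.le
        exact le_mul_of_one_le_right this hr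
      have b6 : d * r ≤ d * 2 := mul_le_mul_of_nonneg_left hr2 hδ0
      -- d*(2.33)+6.65 d = 8.98 d ; *0.223 = 2.003
      have b7 : (f - g) * (r + 0.33) ≤ 8.2 * d := by
        -- use r: d(r+.33) + 5 d + 1.65 d / r
        have c1 : (r - 1) * g * r ≤ 5 * d := hrgd
        have c3 : r * ((r - 1) * g) ≤ 5 * d := by linarith
        have c4 : 0.33 * ((r - 1) * g) + d * r ≤ 2.825 * d := by
          have : r * (0.33 * ((r - 1) * g) + d * r) ≤ r * (2.825 * d) := by
            have k1 := mul_nonneg hδ0 (mul_nonneg (by linarith : 0 ≤ 2 - r) (by linarith : 0 ≤ r - 1))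
            have k2 := mul_nonneg hδ0 (by linarith : 0 ≤ 2 - r)
            have k3 := mul_nonneg hδ0 (by linarith : 0 ≤ r - 1)
            linarith
          exact le_of_mul_le_mul_left this hr0
        linarith
      linarith
    have s2 : G * (r * (1+f*(1-g)+r*g*g) - (r+f*f+r*g*(1-f))) ≥ - (0.01 * d) := by
      have : r * (1+f*(1-g)+r*g*g) - (r+f*f+r*g*(1-f)) = r * (f - g) - d * (f + r * g) := by rw [hd]; ring
      rw [this]
      have c1 : 0 ≤ G * (r * (f - g)) := mul_nonneg hG0.le (mul_nonneg hr0.le (by linarith))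
      have c2 : G * (f + r * g) ≤ 1/64 * 0.6 := mul_le_mul hG64 (by linarith) (by positivity) (by norm_num)
      have c3 := mul_le_mul_of_nonneg_right c2 hδ0
      linarith
    have s3 : r * F * G * (1+f+g) * (r-1-2*f+2*r*g) ≥ - ((r + 1) * (0.01 * d)) := by
      have e : r-1-2*f+2*r*g = (r - 1) - 2 * d := by rw [hd]; ring
      rw [e]
      have c1 : F * G ≤ 1/40 * (1/64) := mul_le_mul hF40 hG64 hG0.le (by norm_num)
      have c2 : F * G * (1 + f + g) ≤ 1/40 * (1/64) * 2 := mul_le_mul c1 (by linarith) (by positivity) (by norm_num)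
      norm_num at c2
      have c0 : 0 < F * G * (1 + f + g) := by positivity
      have c3 : 0 ≤ r * (F * G * (1 + f + g)) * (r - 1) := mul_nonneg (by positivity) (by linarith)
      have c4 : r * (F * G * (1 + f + g)) * (2 * d) ≤ (r + 1) * (0.01 * d) := by
        have k1 : (F * G * (1 + f + g)) * (2 * d) ≤ 1/1280 * (2 * d) := mul_le_mul_of_nonneg_right c2 (by linarith)
        have k2 := mul_le_mul_of_nonneg_left k1 hr0.le
        have k3 : 0 ≤ r * d := mul_nonneg hr0.le hδ0
        linarith
      linarith
    have e : (r+1)^2*(f-r*g)-(r+1)*F*(r+f*f+r*g*(1-f))+(r+1)*r*G*(1+f*(1-g)+r*g*g)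
      +r*F*G*(1+f+g)*(r-1-2*f+2*r*g) = (r + 1) * ((r + 1) * d - (F - G) * (r+f*f+r*g*(1-f)) +
       G * (r * (1+f*(1-g)+r*g*g) - (r+f*f+r*g*(1-f)))) + r * F * G * (1+f+g) * (r-1-2*f+2*r*g) := by
       rw [hd]; ring
    rw [e]
    have : 0.01 * d ≤ ((r + 1) * d - (F - G) * (r+f*f+r*g*(1-f)) +
       G * (r * (1+f*(1-g)+r*g*g) - (r+f*f+r*g*(1-f)))) := by
      have : 2 * d ≤ (r + 1) * d := mul_le_mul_of_nonneg_right (by linarith) hδ0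
      linarith
    have := mul_le_mul_of_nonneg_left this (by linarith : 0 ≤ r + 1)
    linarith

theorem En_high {p a b : ℝ} (hp : 4 ≤ p) (hb : 0 < b) (hab : b < a) (ha : a < 1/2)
    (hc : Hc p a b = 0) : En (p - 1) a b ≤ 0 := by
  obtain ⟨f, g, r, h1, h2, h3, h4, h5, h6, h7⟩ := high_red (by linarith) hb hab ha hc
  exact h7 (Z_nonneg hp h1 h2 h3 h4 h5 h6)

/-! Reflective engine for integer polynomials in `m`, `x`, `t` as nested coefficient lists. -/

def evL {α : Type} (φ : α → ℝ) (y : ℝ) : List α → ℝ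
  | [] => 0
  | a :: p => φ a + y * evL φ y p

def addL {α : Type} (f : α → α → α) : List α → List α → List α
  | [], q => q
  | a :: p, [] => a :: p
  | a :: p, b :: q => f a b :: addL f p q

def mulL {α : Type} (f g : α → α → α) (z : α) : List α → List α → List α
  | [], _ => []
  | a :: p, q => addL f (q.map (g a)) (z :: mulL f g z p q)

def derL {α : Type} (f : α → α → α) (z : α) : List α → List α
  | [] => []
  | _ :: p => addL f p (z :: derL f z p)

theorem evL_add {α : Type} {φ : α → ℝ} {f : α → α → α} (h : ∀ a b, φ (f a b) = φ a + φ b) (y : ℝ) :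
    ∀ p q, evL φ y (addL f p q) = evL φ y p + evL φ y q
  | [], q => by simp [addL, evL]
  | a :: p, [] => by simp [addL, evL]
  | a :: p, b :: q => by simp [addL, evL, h, evL_add h y p q]; ring

theorem evL_map {α β : Type} {φ : α → ℝ} {ψ : β → ℝ} {g : β → α} {k : ℝ}
    (h : ∀ a, φ (g a) = k * ψ a) (y : ℝ) :
    ∀ p, evL φ y (p.map g) = k * evL ψ y p
  | [] => by simp [evL]
  | a :: p => by simp [evL, h, evL_map h y p]; ring

theorem evL_mul {α : Type} {φ : α → ℝ} {f g : α → α → α} {z : α} (hz : φ z = 0)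
    (h : ∀ a b, φ (f a b) = φ a + φ b) (hg : ∀ a b, φ (g a b) = φ a * φ b) (y : ℝ) :
    ∀ p q, evL φ y (mulL f g z p q) = evL φ y p * evL φ y q
  | [], q => by simp [mulL, evL]
  | a :: p, q => by
      simp only [mulL, evL_add h, evL, evL_map (ψ := φ) (hg a), evL_mul hz h hg y p q, hz]; ring

theorem evL_der {α : Type} {φ : ℝ → α → ℝ} {φ' : α → ℝ} {f : α → α → α} {z : α} {μ : ℝ} {Y : ℝ → ℝ}
    {Y' : ℝ} (hz : φ μ z = 0) (h : ∀ a b, φ μ (f a b) = φ μ a + φ μ b)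
    (hd : ∀ a, HasDerivAt (fun r => φ r a) (φ' a) μ) (hY : HasDerivAt Y Y' μ) :
    ∀ p, HasDerivAt (fun r => evL (φ r) (Y r) p)
      (evL φ' (Y μ) p + Y' * evL (φ μ) (Y μ) (derL f z p)) μ
  | [] => by simpa [evL, derL] using hasDerivAt_const μ (0:ℝ)
  | a :: p => by
      have := (hd a).add (hY.mul (evL_der hz h hd hY p))
      refine this.congr_deriv ?_
      simp only [derL, evL, evL_add h, hz]
      ring

abbrev Q1 := List ℤ
abbrev Q2 := List Q1
abbrev Q3 := List Q2

noncomputable def ev1 (m : ℝ) (p : Q1) : ℝ := evL (fun z : ℤ => (z : ℝ)) m p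
noncomputable def ev2 (x m : ℝ) (p : Q2) : ℝ := evL (ev1 m) x p
noncomputable def ev3 (t x m : ℝ) (p : Q3) : ℝ := evL (ev2 x m) t p

def add1 : Q1 → Q1 → Q1 := addL Int.add
def add2 : Q2 → Q2 → Q2 := addL add1
def add3 : Q3 → Q3 → Q3 := addL add2
def mul1 : Q1 → Q1 → Q1 := mulL Int.add Int.mul 0
def mul2 : Q2 → Q2 → Q2 := mulL add1 mul1 []
def mul3 : Q3 → Q3 → Q3 := mulL add2 mul2 []
def sm1 (k : ℤ) (p : Q1) : Q1 := p.map (Int.mul k)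
def sm2 (k : ℤ) (p : Q2) : Q2 := p.map (sm1 k)
def sm3 (k : ℤ) (p : Q3) : Q3 := p.map (sm2 k)
def dx3 (p : Q3) : Q3 := p.map (derL add1 [])
def dm3 (p : Q3) : Q3 := p.map (List.map (derL Int.add 0))

theorem ev1_nil (m : ℝ) : ev1 m [] = 0 := rfl
theorem ev2_nil (x m : ℝ) : ev2 x m [] = 0 := rfl
theorem ev1_add (m : ℝ) (p q : Q1) : ev1 m (add1 p q) = ev1 m p + ev1 m q :=
  evL_add (fun a b => by show ((a + b : ℤ) : ℝ) = _; push_cast; rfl) _ _ _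
theorem ev2_add (x m : ℝ) (p q : Q2) : ev2 x m (add2 p q) = ev2 x m p + ev2 x m q :=
  evL_add (ev1_add m) _ _ _
theorem ev3_add (t x m : ℝ) (p q : Q3) : ev3 t x m (add3 p q) = ev3 t x m p + ev3 t x m q :=
  evL_add (ev2_add x m) _ _ _
theorem ev1_mul (m : ℝ) (p q : Q1) : ev1 m (mul1 p q) = ev1 m p * ev1 m q :=
  evL_mul (by simp) (fun a b => by show ((a + b : ℤ) : ℝ) = _; push_cast; rfl)
    (fun a b => by show ((a * b : ℤ) : ℝ) = _; push_cast; rfl) _ _ _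
theorem ev2_mul (x m : ℝ) (p q : Q2) : ev2 x m (mul2 p q) = ev2 x m p * ev2 x m q :=
  evL_mul (ev1_nil m) (ev1_add m) (ev1_mul m) _ _ _
theorem ev3_mul (t x m : ℝ) (p q : Q3) : ev3 t x m (mul3 p q) = ev3 t x m p * ev3 t x m q :=
  evL_mul (ev2_nil x m) (ev2_add x m) (ev2_mul x m) _ _ _
theorem ev1_sm (m : ℝ) (k : ℤ) (p : Q1) : ev1 m (sm1 k p) = k * ev1 m p :=
  evL_map (fun a => by show ((k * a : ℤ) : ℝ) = _; push_cast; rfl) _ _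
theorem ev2_sm (x m : ℝ) (k : ℤ) (p : Q2) : ev2 x m (sm2 k p) = k * ev2 x m p :=
  evL_map (ev1_sm m k) _ _
theorem ev3_sm (t x m : ℝ) (k : ℤ) (p : Q3) : ev3 t x m (sm3 k p) = k * ev3 t x m p :=
  evL_map (ev2_sm x m k) _ _

theorem evL_map' {α β : Type} {φ : α → ℝ} {g : β → α} (y : ℝ) :
    ∀ p, evL φ y (p.map g) = evL (fun a => φ (g a)) y p
  | [] => by simp [evL]
  | a :: p => by simp [evL, evL_map' y p]

theorem evL_addf {α : Type} {φ ψ : α → ℝ} (k y : ℝ) :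
    ∀ p, evL (fun a => φ a + k * ψ a) y p = evL φ y p + k * evL ψ y p
  | [] => by simp [evL]
  | a :: p => by simp [evL, evL_addf k y p]; ring

theorem evL_smulf {α : Type} {φ : α → ℝ} (k y : ℝ) :
    ∀ p, evL (fun a => k * φ a) y p = k * evL φ y p
  | [] => by simp [evL]
  | a :: p => by simp [evL, evL_smulf k y p]; ring

theorem ev3_der {t μ : ℝ} {Y Z : ℝ → ℝ} {Y' Z' : ℝ} (hY : HasDerivAt Y Y' μ)
    (hZ : HasDerivAt Z Z' μ) (p : Q3) :
    HasDerivAt (fun r => ev3 t (Y r) (Z r) p)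
      (Z' * ev3 t (Y μ) (Z μ) (dm3 p) + Y' * ev3 t (Y μ) (Z μ) (dx3 p)) μ := by
  have h1 : ∀ a : Q1, HasDerivAt (fun r => ev1 (Z r) a) (Z' * ev1 (Z μ) (derL Int.add 0 a)) μ := by
    intro a
    have := evL_der (φ := fun _ (z : ℤ) => (z : ℝ)) (φ' := fun _ => 0) (f := Int.add) (z := 0)
      (μ := μ) (Y := Z) (Y' := Z') (by simp)
      (fun a b => by show ((a + b : ℤ) : ℝ) = _; push_cast; rfl) (fun a => hasDerivAt_const _ _)
      hZ a
    refine this.congr_deriv ?_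
    have h0 : ∀ q : Q1, evL (fun _ : ℤ => (0:ℝ)) (Z μ) q = 0 := by
      intro q; induction q with
      | nil => rfl
      | cons a q ih => simp [evL, ih]
    rw [h0]; simp [ev1]
  have h2 : ∀ a : Q2, HasDerivAt (fun r => ev2 (Y r) (Z r) a)
      (Z' * ev2 (Y μ) (Z μ) (a.map (derL Int.add 0)) + Y' * ev2 (Y μ) (Z μ) (derL add1 [] a)) μ := by
    intro a
    have := evL_der (φ := fun r => ev1 (Z r)) (f := add1) (z := []) (ev1_nil _) (ev1_add _) h1 hY a
    refine this.congr_deriv ?_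
    rw [ev2, evL_map', evL_smulf]; rfl
  have := evL_der (φ := fun r => ev2 (Y r) (Z r)) (f := add2) (z := []) (ev2_nil _ _) (ev2_add _ _) h2
    (hasDerivAt_const μ t) p
  refine this.congr_deriv ?_
  rw [evL_addf, evL_smulf, ev3, ev3, dm3, dx3, evL_map', evL_map', zero_mul, add_zero]

/-! sign tests -/
def pwL (D : ℤ) : ℕ → Q1
  | 0 => [1]
  | n + 1 => mul1 [D, D] (pwL D n)

def mob1 (α β D : ℤ) : Q1 → Q1
  | [] => []
  | c :: cs => add1 (sm1 c (pwL D cs.length)) (mul1 [α, β] (mob1 α β D cs))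

def mob2 (α β D : ℤ) : Q2 → Q2
  | [] => []
  | c :: cs => add2 ((pwL D cs.length).map (fun k => sm1 k c)) (mul2 [[α], [β]] (mob2 α β D cs))

theorem ev_pw (D : ℤ) (u : ℝ) : ∀ n, ev1 u (pwL D n) = ((D : ℝ) * (1 + u)) ^ n
  | 0 => by simp [pwL, ev1, evL]
  | n + 1 => by
    rw [pwL, ev1_mul, ev_pw D u n]; simp [ev1, evL]; ring

theorem ev_mob1 {α β D : ℤ} {u y : ℝ} (h : (D : ℝ) * (1 + u) * y = α + β * u) :
    ∀ p, (D : ℝ) * (1 + u) * ev1 u (mob1 α β D p) = ((D : ℝ) * (1 + u)) ^ p.length * ev1 y p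
  | [] => by simp [mob1, ev1, evL]
  | c :: cs => by
    have ih := ev_mob1 h cs
    have e1 : ev1 u [α, β] = D * (1 + u) * y := by rw [h]; simp [ev1, evL]; ring
    have e2 : ev1 y (c :: cs) = c + y * ev1 y cs := rfl
    rw [mob1, ev1_add, ev1_sm, ev_pw, ev1_mul, e1, e2, List.length_cons, pow_succ]
    linear_combination (D : ℝ) * (1 + u) * y * ih

theorem ev_mob2 {α β D : ℤ} {u y m : ℝ} (h : (D : ℝ) * (1 + u) * y = α + β * u) :
    ∀ p, (D : ℝ) * (1 + u) * ev2 u m (mob2 α β D p) = ((D : ℝ) * (1 + u)) ^ p.length * ev2 y m p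
  | [] => by simp [mob2, ev2, evL]
  | c :: cs => by
    have ih := ev_mob2 h cs (m := m)
    have e1 : ev2 u m [[α], [β]] = D * (1 + u) * y := by rw [h]; simp [ev2, ev1, evL]; ring
    have e2 : ev2 y m (c :: cs) = ev1 m c + y * ev2 y m cs := rfl
    have e3 : ev2 u m ((pwL D cs.length).map (fun k => sm1 k c)) = ev1 m c * ev1 u (pwL D cs.length) :=
      evL_map (fun a => by rw [ev1_sm]; ring) _ _
    rw [mob2, ev2_add, e3, ev_pw, ev2_mul, e1, e2, List.length_cons, pow_succ]
    linear_combination (D : ℝ) * (1 + u) * y * ih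

def nonposZ : ℤ → Bool
  | .ofNat 0 => true
  | .ofNat (_ + 1) => false
  | .negSucc _ => true

theorem nonposZ_spec {z : ℤ} (h : nonposZ z = true) : (z : ℝ) ≤ 0 := by
  have : z ≤ 0 := by
    match z, h with
    | .ofNat 0, _ => simp
    | .negSucc n, _ => exact (Int.negSucc_lt_zero n).le
  exact_mod_cast this

theorem evL_nonpos' {α : Type} {φ : α → ℝ} {y : ℝ}
    (hy : 0 ≤ y) : ∀ p : List α, (∀ a ∈ p, φ a ≤ 0) → evL φ y p ≤ 0
  | [], _ => le_refl _
  | a :: p, hp => by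
    have h1 := hp a (by simp)
    have h2 := evL_nonpos' hy p (fun c hc => hp c (by simp [hc]))
    simp only [evL]
    nlinarith [mul_nonneg hy (neg_nonneg.2 h2)]

def isZ : ℤ → Bool
  | .ofNat 0 => true
  | .ofNat (_ + 1) => false
  | .negSucc _ => false

theorem isZ_spec {z : ℤ} (h : isZ z = true) : z = 0 := by
  match z, h with
  | .ofNat 0, _ => rfl

def ubZ (M : ℕ) : Q1 → ℤ
  | [] => 0
  | c :: cs => match ubZ M cs with
    | .ofNat 0 => c
    | .ofNat (n+1) => c + .ofNat (M * (n+1) / 1000 + 1)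
    | .negSucc _ => c

theorem ubZ_spec {M : ℕ} {m : ℝ} (h0 : 0 ≤ m) (h1 : 1000 * m ≤ M) : ∀ p : Q1, ev1 m p ≤ ubZ M p
  | [] => by simp [ev1, evL, ubZ]
  | c :: cs => by
    have ih := ubZ_spec h0 h1 cs
    have e : ev1 m (c :: cs) = c + m * ev1 m cs := rfl
    rw [e, ubZ]
    split
    · rename_i h
      rw [h] at ih; simp at ih
      nlinarith
    · rename_i n h
      rw [h] at ih
      have k : M * (n + 1) < 1000 * (M * (n + 1) / 1000 + 1) := by omega
      have k' : (M : ℝ) * (n + 1) < 1000 * (((M * (n + 1) / 1000 + 1 : ℕ)) : ℝ) := by exact_mod_cast k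
      have ih' : ev1 m cs ≤ (n : ℝ) + 1 := by
        have : ((Int.ofNat (n + 1) : ℤ) : ℝ) = n + 1 := by simp
        linarith
      have e2 : ((c + Int.ofNat (M * (n + 1) / 1000 + 1) : ℤ) : ℝ)
        = c + ((M * (n + 1) / 1000 + 1 : ℕ) : ℝ) := by
        rw [Int.cast_add]; rfl
      rw [e2]
      have : m * ev1 m cs ≤ m * (n + 1) := mul_le_mul_of_nonneg_left ih' h0
      nlinarith [mul_le_mul_of_nonneg_right h1 (by positivity : (0:ℝ) ≤ n + 1)]
    · rename_i n h
      rw [h] at ih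
      have : ((Int.negSucc n : ℤ) : ℝ) ≤ 0 := by exact_mod_cast (Int.negSucc_lt_zero n).le
      nlinarith

/-- `≤ 0` for `m ∈ [0, M/1000]` -/
def neg1 (M : ℕ) : Q1 → Bool
  | [] => true
  | c :: cs => (isZ c && neg1 M cs) || nonposZ (ubZ M (c :: cs))

theorem neg1_spec {M : ℕ} {m : ℝ} (h0 : 0 ≤ m) (h1 : 1000 * m ≤ M) : ∀ (p : Q1) (h : neg1 M p = true),
    ev1 m p ≤ 0
  | [], _ => le_refl _
  | c :: cs, h => by
    rw [neg1, Bool.or_eq_true, Bool.and_eq_true] at h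
    rcases h with ⟨hc, h⟩ | h
    · have hc' : c = 0 := isZ_spec hc
      have := neg1_spec h0 h1 cs h
      have e : ev1 m (c :: cs) = c + m * ev1 m cs := rfl
      rw [e, hc']; push_cast; nlinarith
    · exact (ubZ_spec h0 h1 _).trans (nonposZ_spec h)

/-! Kronecker packing in the variable `m` -/
def BB : ℤ := 2 ^ 240

def pk1 : Q1 → ℤ
  | [] => 0
  | c :: cs => c + BB * pk1 cs
def pk2 (p : Q2) : Q1 := p.map pk1
def pk3 (p : Q3) : Q2 := p.map pk2

theorem map_addL {α β : Type} {f : α → α → α} {f' : β → β → β} {h : α → β}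
    (hf : ∀ a b, h (f a b) = f' (h a) (h b)) : ∀ p q, (addL f p q).map h = addL f' (p.map h) (q.map h)
  | [], q => by simp [addL]
  | a :: p, [] => by simp [addL]
  | a :: p, b :: q => by simp [addL, hf, map_addL hf p q]

theorem map_mulL {α β : Type} {f g : α → α → α} {f' g' : β → β → β} {z : α} {z' : β} {h : α → β}
    (hz : h z = z')
    (hf : ∀ a b, h (f a b) = f' (h a) (h b)) (hg : ∀ a b, h (g a b) = g' (h a) (h b)) :
    ∀ p q, (mulL f g z p q).map h = mulL f' g' z' (p.map h) (q.map h)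
  | [], q => by simp [mulL]
  | a :: p, q => by
    have : (q.map (g a)).map h = (q.map h).map (g' (h a)) := by
      rw [List.map_map, List.map_map]; congr 1; funext b; exact hg a b
    simp [mulL, map_addL hf, map_mulL hz hf hg p q, this, hz]

theorem iadd (a b : ℤ) : Int.add a b = a + b := rfl
theorem imul (a b : ℤ) : Int.mul a b = a * b := rfl

theorem pk1_add : ∀ p q, pk1 (add1 p q) = Int.add (pk1 p) (pk1 q)
  | [], q => by simp [add1, addL, pk1, iadd]
  | a :: p, [] => by simp [add1, addL, pk1, iadd]
  | a :: p, b :: q => by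
    have : pk1 (addL Int.add p q) = pk1 p + pk1 q := pk1_add p q
    show a + b + BB * pk1 (addL Int.add p q) = (a + BB * pk1 p) + (b + BB * pk1 q)
    rw [this]; ring

theorem pk1_sm (k : ℤ) : ∀ p, pk1 (sm1 k p) = k * pk1 p
  | [] => by simp [sm1, pk1]
  | a :: p => by
    have : pk1 (p.map (Int.mul k)) = k * pk1 p := pk1_sm k p
    show k * a + BB * pk1 (p.map (Int.mul k)) = k * (a + BB * pk1 p)
    rw [this]; ring

theorem pk1_mul : ∀ p q, pk1 (mul1 p q) = Int.mul (pk1 p) (pk1 q)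
  | [], q => by simp [mul1, mulL, pk1, imul]
  | a :: p, q => by
    have h1 : pk1 (mulL Int.add Int.mul 0 p q) = pk1 p * pk1 q := pk1_mul p q
    show pk1 (add1 (sm1 a q) (0 :: mulL Int.add Int.mul 0 p q)) = (a + BB * pk1 p) * pk1 q
    rw [pk1_add, pk1_sm]
    show a * pk1 q + (0 + BB * pk1 (mulL Int.add Int.mul 0 p q)) = _
    rw [h1]; ring

theorem pk2_add (p q : Q2) : pk2 (add2 p q) = add1 (pk2 p) (pk2 q) := map_addL pk1_add p q
theorem pk2_mul (p q : Q2) : pk2 (mul2 p q) = mul1 (pk2 p) (pk2 q) := map_mulL rfl pk1_add pk1_mul p q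
theorem pk3_add (p q : Q3) : pk3 (add3 p q) = add2 (pk3 p) (pk3 q) := map_addL pk2_add p q
theorem pk3_mul (p q : Q3) : pk3 (mul3 p q) = mul2 (pk3 p) (pk3 q) := map_mulL rfl pk2_add pk2_mul p q
theorem pk2_sm (k : ℤ) (p : Q2) : pk2 (sm2 k p) = sm1 k (pk2 p) := by
  simp only [pk2, sm2, sm1, List.map_map]; congr 1; funext a; exact pk1_sm k a
theorem pk3_sm (k : ℤ) (p : Q3) : pk3 (sm3 k p) = sm2 k (pk3 p) := by
  simp only [pk3, sm3, sm2, List.map_map]; congr 1; funext a; exact pk2_sm k a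

theorem pk2_mob (α β D : ℤ) : ∀ p, pk2 (mob2 α β D p) = mob1 α β D (pk2 p)
  | [] => rfl
  | c :: cs => by
    have e : pk2 (c :: cs) = pk1 c :: pk2 cs := rfl
    rw [mob2, pk2_add, pk2_mul, pk2_mob α β D cs, e, mob1]
    have e2 : pk2 ((pwL D cs.length).map (fun k => sm1 k c)) = sm1 (pk1 c) (pwL D (pk2 cs).length) := by
      simp only [pk2, sm1, List.map_map, List.length_map]; congr 1; funext k
      show pk1 (sm1 k c) = pk1 c * k
      rw [pk1_sm, mul_comm]
    have e3 : pk2 [[α], [β]] = [α, β] := by simp [pk2, pk1]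
    rw [e2, e3]

/-! norms -/
def nrmL {α : Type} (ν : α → ℕ) : List α → ℕ
  | [] => 0
  | a :: p => ν a + nrmL ν p

theorem nrmL_add {α : Type} {ν : α → ℕ} {f : α → α → α} (h : ∀ a b, ν (f a b) ≤ ν a + ν b) :
    ∀ p q, nrmL ν (addL f p q) ≤ nrmL ν p + nrmL ν q
  | [], q => by simp [addL, nrmL]
  | a :: p, [] => by simp [addL, nrmL]
  | a :: p, b :: q => by
    have := nrmL_add h p q
    have := h a b
    simp only [addL, nrmL]; omega

theorem nrmL_map {α β : Type} {ν : α → ℕ} {ν' : β → ℕ} {g : β → α} {k : ℕ}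
    (h : ∀ a, ν (g a) ≤ k * ν' a) : ∀ p, nrmL ν (p.map g) ≤ k * nrmL ν' p
  | [] => by simp [nrmL]
  | a :: p => by
    have := nrmL_map h p
    have := h a
    simp only [List.map_cons, nrmL, mul_add]; omega

theorem nrmL_mul {α : Type} {ν : α → ℕ} {f g : α → α → α} {z : α} (hz : ν z = 0)
    (h : ∀ a b, ν (f a b) ≤ ν a + ν b) (hg : ∀ a b, ν (g a b) ≤ ν a * ν b) :
    ∀ p q, nrmL ν (mulL f g z p q) ≤ nrmL ν p * nrmL ν q
  | [], q => by simp [mulL, nrmL]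
  | a :: p, q => by
    have h1 := nrmL_mul hz h hg p q
    have h2 := nrmL_map (ν := ν) (ν' := ν) (g := g a) (k := ν a) (hg a) q
    have h3 := nrmL_add h (q.map (g a)) (z :: mulL f g z p q)
    simp only [mulL, nrmL, hz, add_mul] at *; omega

def nrm1 : Q1 → ℕ := nrmL Int.natAbs
def nrm2 : Q2 → ℕ := nrmL nrm1
def nrm3 : Q3 → ℕ := nrmL nrm2
theorem nrm1_add (p q : Q1) : nrm1 (add1 p q) ≤ nrm1 p + nrm1 q := nrmL_add Int.natAbs_add_le p q
theorem nrm2_add (p q : Q2) : nrm2 (add2 p q) ≤ nrm2 p + nrm2 q := nrmL_add nrm1_add p q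
theorem nrm3_add (p q : Q3) : nrm3 (add3 p q) ≤ nrm3 p + nrm3 q := nrmL_add nrm2_add p q
theorem nrm1_mul (p q : Q1) : nrm1 (mul1 p q) ≤ nrm1 p * nrm1 q :=
  nrmL_mul (ν := Int.natAbs) rfl Int.natAbs_add_le (fun a b => (Int.natAbs_mul a b).le) p q
theorem nrm2_mul (p q : Q2) : nrm2 (mul2 p q) ≤ nrm2 p * nrm2 q := nrmL_mul (ν := nrm1) rfl nrm1_add nrm1_mul p q
theorem nrm3_mul (p q : Q3) : nrm3 (mul3 p q) ≤ nrm3 p * nrm3 q := nrmL_mul (ν := nrm2) rfl nrm2_add nrm2_mul p q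
theorem nrm1_sm (k : ℤ) (p : Q1) : nrm1 (sm1 k p) ≤ k.natAbs * nrm1 p :=
  nrmL_map (fun a => (Int.natAbs_mul k a).le) p
theorem nrm2_sm (k : ℤ) (p : Q2) : nrm2 (sm2 k p) ≤ k.natAbs * nrm2 p := nrmL_map (nrm1_sm k) p
theorem nrm3_sm (k : ℤ) (p : Q3) : nrm3 (sm3 k p) ≤ k.natAbs * nrm3 p := nrmL_map (nrm2_sm k) p

theorem nrm_pw (D : ℤ) : ∀ n, nrm1 (pwL D n) ≤ (2 * D.natAbs) ^ n
  | 0 => by simp [pwL, nrm1, nrmL]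
  | n + 1 => by
    have h1 := nrm1_mul [D, D] (pwL D n)
    have h2 : nrm1 [D, D] = 2 * D.natAbs := by simp [nrm1, nrmL]; ring
    rw [h2] at h1
    rw [pwL, pow_succ, mul_comm]
    exact h1.trans (Nat.mul_le_mul_left _ (nrm_pw D n))

theorem nrm_mob {α β D : ℤ} {C : ℕ} (hC : 0 < C) (h1 : α.natAbs + β.natAbs ≤ C) (h2 : 2 * D.natAbs ≤ C) :
    ∀ p : Q2, nrm2 (mob2 α β D p) ≤ C ^ p.length * nrm2 p
  | [] => by simp [mob2, nrm2, nrmL]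
  | c :: cs => by
    have ih := nrm_mob hC h1 h2 cs
    have k1 := nrm2_add ((pwL D cs.length).map (fun k => sm1 k c)) (mul2 [[α], [β]] (mob2 α β D cs))
    have k2 := nrm2_mul [[α], [β]] (mob2 α β D cs)
    have k3 : nrm2 [[α], [β]] = α.natAbs + β.natAbs := by simp [nrm2, nrm1, nrmL]
    have k4 : nrm2 ((pwL D cs.length).map (fun k => sm1 k c)) ≤ nrm1 c * nrm1 (pwL D cs.length) :=
      nrmL_map (fun a => (nrm1_sm a c).trans (by rw [mul_comm])) _
    have k5 : nrm1 (pwL D cs.length) ≤ C ^ cs.length := (nrm_pw D _).trans (Nat.pow_le_pow_left h2 _)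
    rw [k3] at k2
    have e : nrm2 (c :: cs) = nrm1 c + nrm2 cs := rfl
    rw [mob2, e, List.length_cons]
    have k6 : nrm1 c * nrm1 (pwL D cs.length) ≤ C ^ (cs.length + 1) * nrm1 c := by
      rw [mul_comm]
      refine Nat.mul_le_mul_right _ (k5.trans (Nat.pow_le_pow_right hC (by omega)))
    have k7 : (α.natAbs + β.natAbs) * nrm2 (mob2 α β D cs) ≤ C ^ (cs.length + 1) * nrm2 cs := by
      refine (Nat.mul_le_mul h1 ih).trans (le_of_eq ?_)
      ring
    rw [mul_add]
    omega

/-- uniqueness of balanced digits -/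
theorem pk1_unique (m : ℝ) : ∀ p q : Q1, (∀ c ∈ p, 2 * c.natAbs < BB.natAbs) →
    (∀ c ∈ q, 2 * c.natAbs < BB.natAbs) → pk1 p = pk1 q → ev1 m p = ev1 m q := by
  have hB : BB = BB.natAbs := by decide +kernel
  have hB0 : 0 < BB := by decide +kernel
  have key : ∀ (a b x y : ℤ), 2 * a.natAbs < BB.natAbs → 2 * b.natAbs < BB.natAbs →
      a + BB * x = b + BB * y → a = b ∧ x = y := by
    intro a b x y ha hb h
    have h1 : a - b = BB * (y - x) := by linarith
    have h2 : |a - b| < BB := by rw [abs_lt]; constructor <;> omega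
    have h3 : y - x = 0 := by
      by_contra hne
      have : 1 ≤ |y - x| := Int.one_le_abs hne
      rw [h1, abs_mul, abs_of_pos hB0] at h2
      nlinarith
    constructor
    · rw [h3] at h1; linarith
    · linarith
  intro p
  induction p with
  | nil =>
    intro q
    induction q with
    | nil => intros; rfl
    | cons b q ih =>
      intro h1 h2 h
      have hb := h2 b (by simp)
      have := key 0 b 0 (pk1 q) (by simpa using hB0.ne') hb (by simpa [pk1] using h)
      have k := ih (by simp) (fun c hc => h2 c (by simp [hc])) this.2
      have e : ev1 m (b :: q) = b + m * ev1 m q := rfl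
      rw [e, ← k, ← this.1]; simp [ev1, evL]
  | cons a p ih =>
    intro q h1 h2 h
    have e : ev1 m (a :: p) = a + m * ev1 m p := rfl
    rcases q with _ | ⟨b, q⟩
    · have := key a 0 (pk1 p) 0 (h1 a (by simp)) (by simpa using hB0.ne') (by simpa [pk1] using h)
      have k := ih [] (fun c hc => h1 c (by simp [hc])) (by simp) this.2
      rw [e, k, this.1]; simp [ev1, evL]
    · have := key a b (pk1 p) (pk1 q) (h1 a (by simp)) (h2 b (by simp)) h
      have k := ih q (fun c hc => h1 c (by simp [hc])) (fun c hc => h2 c (by simp [hc])) this.2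
      have e2 : ev1 m (b :: q) = b + m * ev1 m q := rfl
      rw [e, e2, k, this.1]

theorem nrmL_mem {α : Type} {ν : α → ℕ} : ∀ (p : List α) a, a ∈ p → ν a ≤ nrmL ν p
  | b :: p, a, h => by
    rcases List.mem_cons.1 h with rfl | h
    · simp [nrmL]
    · have := nrmL_mem (ν := ν) p a h
      simp only [nrmL]; omega

/-- `2 ^ 239`, half the base -/
def HH : ℕ := 2 ^ 239
def offZ (n : ℕ) : ℤ := Nat.rec (0 : ℤ) (fun _ o => HH + BB * o) n
/-- positive part of the Horner upper bound, from the shifted packed integer -/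
def ubN (M n : ℕ) : ℕ → ℕ :=
  Nat.rec (fun _ => 0)
    (fun _ ih z => Nat.sub (Nat.add (Nat.mod z (2 ^ 240))
      (Nat.div (Nat.add (Nat.mul M (ih (Nat.div z (2 ^ 240)))) 999) 1000)) (2 ^ 239)) n
def ngN (M n : ℕ) : ℕ → Bool :=
  Nat.rec (fun _ => true)
    (fun k ih z => or (Nat.beq (ubN M (k + 1) z) 0)
      (and (Nat.beq (Nat.mod z (2 ^ 240)) (2 ^ 239)) (ih (Nat.div z (2 ^ 240))))) n

theorem HH_bounds {c : ℤ} (h : 2 * c.natAbs < BB.natAbs) : 0 ≤ c + HH ∧ c + HH < BB := by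
  have h1 : (BB : ℤ) = 2 * HH := by decide +kernel
  have h2 : BB.natAbs = 2 * HH := by decide +kernel
  omega

theorem zdec {z : ℕ} {e y : ℤ} (he : 0 ≤ e ∧ e < BB) (h : (z : ℤ) = e + BB * y) :
    ((Nat.mod z (2 ^ 240) : ℕ) : ℤ) = e ∧ ((Nat.div z (2 ^ 240) : ℕ) : ℤ) = y := by
  have hb : (BB : ℤ) = ((2 ^ 240 : ℕ) : ℤ) := by decide +kernel
  have k1 : ((Nat.mod z (2 ^ 240) : ℕ) : ℤ) = (z : ℤ) % BB := by
    rw [hb]; exact Int.natCast_mod z (2 ^ 240)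
  have k2 : ((Nat.div z (2 ^ 240) : ℕ) : ℤ) = (z : ℤ) / BB := by
    rw [hb]; exact Int.natCast_div z (2 ^ 240)
  have hB0 : 0 < BB := lt_of_le_of_lt he.1 he.2
  rw [k1, k2, h]
  constructor
  · rw [Int.add_mul_emod_self_left, Int.emod_eq_of_lt he.1 he.2]
  · rw [Int.add_mul_ediv_left _ _ hB0.ne', Int.ediv_eq_zero_of_lt he.1 he.2, zero_add]

theorem ub_step {M e n : ℕ} {m c r : ℝ} (h0 : 0 ≤ m) (h1 : 1000 * m ≤ M) (hr : r ≤ n)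
    (hc : (e : ℝ) = c + HH) :
    c + m * r ≤ ((Nat.sub (Nat.add e (Nat.div (Nat.add (Nat.mul M n) 999) 1000)) (2 ^ 239) : ℕ) : ℝ) := by
  have k : M * n ≤ 1000 * ((M * n + 999) / 1000) := by omega
  set d := (M * n + 999) / 1000 with hd
  have hH : (2 : ℕ) ^ 239 = HH := rfl
  have e1 : Nat.sub (Nat.add e (Nat.div (Nat.add (Nat.mul M n) 999) 1000)) (2 ^ 239) = e + d - HH := rfl
  rw [e1]
  have k2 : e + d ≤ (e + d - HH) + HH := by omega
  have k3 : (e : ℝ) + d ≤ ((e + d - HH : ℕ) : ℝ) + HH := by exact_mod_cast k2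
  have k4 : (M : ℝ) * n ≤ 1000 * d := by exact_mod_cast k
  have k5 : m * r ≤ m * n := mul_le_mul_of_nonneg_left hr h0
  have k6 : 1000 * m * n ≤ M * n := mul_le_mul_of_nonneg_right h1 (Nat.cast_nonneg n)
  clear e1 hH
  linarith

theorem digit_split (p : Q1) (hp : ∀ c ∈ p, 2 * c.natAbs < BB.natAbs) : ∃ (c : ℤ) (cs : Q1),
    (2 * c.natAbs < BB.natAbs) ∧ (∀ c ∈ cs, 2 * c.natAbs < BB.natAbs) ∧ pk1 p = c + BB * pk1 cs ∧
    ∀ m : ℝ, ev1 m p = c + m * ev1 m cs := by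
  rcases p with _ | ⟨c, cs⟩
  · exact ⟨0, [], by decide +kernel, by simp, by simp [pk1], by simp [ev1, evL]⟩
  · exact ⟨c, cs, hp c (by simp), fun d hd => hp d (by simp [hd]), rfl, fun _ => rfl⟩

theorem ubN_spec {M : ℕ} {m : ℝ} (h0 : 0 ≤ m) (h1 : 1000 * m ≤ M) : ∀ (n : ℕ) (p : Q1) (z : ℕ),
    (∀ c ∈ p, 2 * c.natAbs < BB.natAbs) → (z : ℤ) = pk1 p + offZ n → (z : ℤ) < BB ^ n →
    ev1 m p ≤ ubN M n z := by
  intro n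
  induction n with
  | zero =>
    intro p z hp hz hl
    have : z = 0 := by simpa using hl
    have h2 : pk1 p = pk1 [] := by rw [this] at hz; simpa [offZ, pk1] using hz.symm
    rw [pk1_unique m p [] hp (by simp) h2]
    simp [ev1, evL, ubN]
  | succ n ih =>
    intro p z hp hz hl
    obtain ⟨c, cs, hc, hcs, e1, e2⟩ := digit_split p hp
    have hoff : offZ (n + 1) = HH + BB * offZ n := rfl
    have hz' : (z : ℤ) = (c + HH) + BB * (pk1 cs + offZ n) := by rw [hz, e1, hoff]; ring
    have hd := zdec (HH_bounds hc) hz'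
    have hB0 : 0 < BB := by decide +kernel
    have hl' : ((Nat.div z (2 ^ 240) : ℕ) : ℤ) < BB ^ n := by
      rw [hd.2]
      have := (HH_bounds hc).1
      have h3 : BB * (pk1 cs + offZ n) < BB * BB ^ n := by rw [pow_succ] at hl; linarith
      exact lt_of_mul_lt_mul_left h3 hB0.le
    have k := ih cs _ hcs hd.2 hl'
    rw [e2]
    refine ub_step h0 h1 k ?_
    have := congrArg (fun z : ℤ => (z : ℝ)) hd.1
    push_cast at this
    exact this

theorem ngN_spec {M : ℕ} {m : ℝ} (h0 : 0 ≤ m) (h1 : 1000 * m ≤ M) : ∀ (n : ℕ) (p : Q1) (z : ℕ),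
    (∀ c ∈ p, 2 * c.natAbs < BB.natAbs) → (z : ℤ) = pk1 p + offZ n → (z : ℤ) < BB ^ n →
    ngN M n z = true → ev1 m p ≤ 0 := by
  intro n
  induction n with
  | zero =>
    intro p z hp hz hl _
    have := ubN_spec h0 h1 0 p z hp hz hl
    simpa [ubN] using this
  | succ n ih =>
    intro p z hp hz hl h
    have h' : or (Nat.beq (ubN M (n + 1) z) 0)
      (and (Nat.beq (Nat.mod z (2 ^ 240)) (2 ^ 239)) (ngN M n (Nat.div z (2 ^ 240)))) = true := h
    rw [Bool.or_eq_true, Bool.and_eq_true] at h'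
    rcases h' with h' | ⟨g1, g2⟩
    · have := ubN_spec h0 h1 (n + 1) p z hp hz hl
      rwa [Nat.eq_of_beq_eq_true h', Nat.cast_zero] at this
    obtain ⟨c, cs, hc, hcs, e1, e2⟩ := digit_split p hp
    have hoff : offZ (n + 1) = HH + BB * offZ n := rfl
    have hz' : (z : ℤ) = (c + HH) + BB * (pk1 cs + offZ n) := by rw [hz, e1, hoff]; ring
    have hd := zdec (HH_bounds hc) hz'
    have hB0 : 0 < BB := by decide +kernel
    have hl' : ((Nat.div z (2 ^ 240) : ℕ) : ℤ) < BB ^ n := by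
      rw [hd.2]
      have := (HH_bounds hc).1
      have h3 : BB * (pk1 cs + offZ n) < BB * BB ^ n := by rw [pow_succ] at hl; linarith
      exact lt_of_mul_lt_mul_left h3 hB0.le
    have k := ih cs _ hcs hd.2 hl' g2
    have k2 : Nat.mod z (2 ^ 240) = HH := Nat.eq_of_beq_eq_true g1
    have k3 := hd.1
    rw [k2] at k3
    have hc0 : c = 0 := by linarith
    rw [e2, hc0, Int.cast_zero, zero_add]
    exact mul_nonpos_of_nonneg_of_nonpos h0 k

def negZ (M : ℕ) (z : ℤ) : Bool :=
  match Int.add z (offZ 26) with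
  | .ofNat w => and (Nat.blt w (Nat.pow (2 ^ 240) 26)) (ngN M 26 w)
  | .negSucc _ => false

theorem negZ_spec {M : ℕ} {m : ℝ} (h0 : 0 ≤ m) (h1 : 1000 * m ≤ M) (p : Q1)
    (hp : 2 * nrm1 p < BB.natAbs) (h : negZ M (pk1 p) = true) : ev1 m p ≤ 0 := by
  have hp' : ∀ c ∈ p, 2 * c.natAbs < BB.natAbs := by
    intro c hc
    have := nrmL_mem (ν := Int.natAbs) p c hc
    have e : nrm1 p = nrmL Int.natAbs p := rfl
    omega
  rw [negZ] at h
  split at h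
  · rename_i w hw
    rw [Bool.and_eq_true] at h
    refine ngN_spec h0 h1 26 p w hp' hw.symm ?_ h.2
    have h3 : w < (2 ^ 240) ^ 26 := by simpa [Nat.blt_eq] using h.1
    have h4 : (BB : ℤ) = ((2 ^ 240 : ℕ) : ℤ) := by decide +kernel
    rw [h4]
    exact_mod_cast h3
  · simp at h

structure FP where
  P : Q2
  b : ℕ

def neg3 (x0 x1 : ℤ) (M : ℕ) (F : FP) : Bool :=
  Nat.ble (x0.natAbs + x1.natAbs) 1000 && Nat.blt (2 * (1000 ^ 12 * F.b)) BB.natAbs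
  && F.P.all (fun r => Nat.ble r.length 12 && (mob1 x0 x1 100 r).all (negZ M))

def InvP (F : FP) (p : Q3) : Prop := pk3 p = F.P ∧ nrm3 p ≤ F.b

theorem neg3_spec {x0 x1 : ℤ} {M : ℕ} {t x m : ℝ} (ht : 0 ≤ t) (h0 : 0 ≤ m) (h1 : 1000 * m ≤ M)
    (hx0 : x0 ≤ 100 * x) (hx1 : 100 * x < x1) {F : FP} {p : Q3} (hF : InvP F p)
    (h : neg3 x0 x1 M F = true) : ev3 t x m p ≤ 0 := by
  simp only [neg3, Bool.and_eq_true] at h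
  obtain ⟨⟨g1, g2⟩, g3⟩ := h
  have g1' := Nat.le_of_ble_eq_true g1
  have g2' : 2 * (1000 ^ 12 * F.b) < BB.natAbs := by simpa [Nat.blt_eq] using g2
  set u := (100 * x - x0) / (x1 - 100 * x) with hu
  have hM : 0 < (x1 : ℝ) - 100 * x := by linarith
  have hM' : 0 ≤ 100 * x - (x0 : ℝ) := by linarith
  have hu0 : 0 ≤ u := by positivity
  have huu : ((100 : ℤ) : ℝ) * (1 + u) * x = x0 + x1 * u := by
    rw [hu]; push_cast; field_simp; ring
  have k3 : 0 < (100 : ℝ) * (1 + u) := by positivity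
  have main : ∀ q ∈ p, ev2 x m q ≤ 0 := by
    intro q hq
    have hq' : pk2 q ∈ F.P := by rw [← hF.1]; exact List.mem_map_of_mem hq
    have k := List.all_eq_true.1 g3 _ hq'
    rw [Bool.and_eq_true] at k
    obtain ⟨kl, ka⟩ := k
    have kl' : q.length ≤ 12 := by
      have := Nat.le_of_ble_eq_true kl
      simpa [pk2] using this
    rw [← pk2_mob] at ka
    have n1 := nrm_mob (by norm_num : 0 < 1000) g1' (by norm_num : 2 * (100:ℤ).natAbs ≤ 1000) q
    have n2 : nrm2 q ≤ F.b := (nrmL_mem (ν := nrm2) p q hq).trans hF.2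
    have n3 : nrm2 (mob2 x0 x1 100 q) ≤ 1000 ^ 12 * F.b :=
      n1.trans (Nat.mul_le_mul (Nat.pow_le_pow_right (by norm_num) kl') n2)
    have k2 : ev2 u m (mob2 x0 x1 100 q) ≤ 0 := by
      have : ∀ r ∈ mob2 x0 x1 100 q, ev1 m r ≤ 0 := by
        intro r hr
        refine negZ_spec h0 h1 r ?_ (List.all_eq_true.1 ka _ (List.mem_map_of_mem hr))
        have := nrmL_mem (ν := nrm1) _ r hr
        have e : nrm2 (mob2 x0 x1 100 q) = nrmL nrm1 (mob2 x0 x1 100 q) := rfl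
        omega
      exact evL_nonpos' hu0 _ this
    have k := ev_mob2 (m := m) huu q
    push_cast at k
    have k4 := pow_pos k3 q.length
    by_contra hc
    push Not at hc
    have := mul_pos k4 hc
    nlinarith [mul_nonneg k3.le (neg_nonneg.2 k2)]
  exact evL_nonpos' ht _ main

section

def R3 : Type := Q3
noncomputable def evR (t x m : ℝ) (p : R3) : ℝ := ev3 t x m p
instance R3_add : Add R3 := ⟨add3⟩
instance R3_mul : Mul R3 := ⟨mul3⟩
instance R3_neg : Neg R3 := ⟨sm3 (-1)⟩
instance R3_sub : Sub R3 := ⟨fun a b => add3 a (sm3 (-1) b)⟩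
def R3.c (k : ℤ) : R3 := [[[k]]]
def R3.t : R3 := [[], [[1]]]
def R3.x : R3 := [[[], [1]]]
def R3.m : R3 := [[[0, 1]]]

theorem evR_add (t x m : ℝ) (p q : R3) : evR t x m (p + q) = evR t x m p + evR t x m q := ev3_add ..
theorem evR_mul (t x m : ℝ) (p q : R3) : evR t x m (p * q) = evR t x m p * evR t x m q := ev3_mul ..
theorem evR_neg (t x m : ℝ) (p : R3) : evR t x m (-p) = - evR t x m p := by
  have := ev3_sm t x m (-1) p
  push_cast at this
  rw [neg_one_mul] at this
  exact this
theorem evR_sub (t x m : ℝ) (p q : R3) : evR t x m (p - q) = evR t x m p - evR t x m q := by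
  have := evR_neg t x m q
  have h2 := evR_add t x m p (-q)
  rw [this] at h2
  rw [sub_eq_add_neg, ← h2]; rfl
theorem evR_c (t x m : ℝ) (k : ℤ) : evR t x m (R3.c k) = k := by
  simp [evR, R3.c, ev3, ev2, ev1, evL]
theorem evR_t (t x m : ℝ) : evR t x m R3.t = t := by simp [evR, R3.t, ev3, ev2, ev1, evL]
theorem evR_x (t x m : ℝ) : evR t x m R3.x = x := by simp [evR, R3.x, ev3, ev2, ev1, evL]
theorem evR_m (t x m : ℝ) : evR t x m R3.m = m := by simp [evR, R3.m, ev3, ev2, ev1, evL]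

open R3

/-- `S = 2 (a + b) = 1 - x m` -/
def rS : R3 := c 1 - x * m
/-- `2 (1 - a) (1 - b)` -/
def rE : R3 := c 2 - rS + c 2 * m
def rD1 : R3 := c 2 * (t * t) + t * (c 4 - rS) + rE
def rD2 : R3 := c 2 * (t * t) + t * (rS - c 4 * m) + m * rE
def rD3 : R3 := c 2 * (t * t) + t * m * (c 4 - rS) + m * m * rE
def rD4 : R3 := c 2 * (t * t) + t * m * (rS - c 4 * m) + m * m * m * rE

def rP : R3 :=
  c 2 * (c 1 + m * m - rS * (c 1 + m)) * (t * t * t * t)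
  + c 2 * (c 1 - m) * ((c 1 + m) * (c 1 + m) * (c 1 + m) - rS * (c 1 + c 3 * m + m * m)) * (t * t * t)
  + m * (c (-2) * rS - c 8 * m + c 8 * m * rS - m * rS * rS - c 16 * m * m + c 8 * m * m * rS
     - c 8 * m * m * m - c 2 * m * m * m * rS) * (t * t)
  + m * m * (c 1 - m) * (c (-6) + c 4 * rS - rS * rS - c 18 * m + c 12 * m * rS - m * rS * rS
     - c 18 * m * m + c 4 * m * m * rS - c 6 * m * m * m) * t
  + m * m * m * rE * (c (-1) + c 3 * m - m * rS + c 3 * m * m - m * m * m)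

/-- pair(S/2, Q/2) numerators, times 4 -/
def rPair (S Q : R3) : R3 := t * (S * S * S - c 6 * S * Q) + Q * (S * S - c 4 * Q)
/-- numerator of `4 V`, over `(t + 1) (t + m) D1 D2` -/
def rNH : R3 := c 4 * ((t + m) * (rD1 * rD2))
   - (t + c 1) * (t + m) * (rPair (c 4 - rS) rE * rD2)
   + (t + c 1) * (t + m) * (rPair (rS - c 4 * m) (m * rE) * rD1)
   - c 4 * (m * m * m * (t + c 1) * (rD1 * rD2))

def rdx (p : R3) : R3 := dx3 p
def rdm (p : R3) : R3 := dm3 p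
/-- a derivation `A ∂_m + B ∂_x` -/
def Lop (A B p : R3) : R3 := A * rdm p + B * rdx p
def stepN (A B D : R3) (q : R3 × R3) : R3 × R3 := (D * q.1 - Lop A B D * q.2, D * q.2)
def fracN (A B l N : R3) : List R3 → R3 × R3
  | [] => (Lop A B N + l * N, N)
  | D :: Ds => stepN A B D (fracN A B l N Ds)

/-! fast packed version -/
def fof (p : R3) : FP := ⟨pk3 p, nrm3 p⟩
def fadd (F G : FP) : FP := ⟨add2 F.P G.P, F.b + G.b⟩
def fmul (F G : FP) : FP := ⟨mul2 F.P G.P, F.b * G.b⟩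
def fneg (F : FP) : FP := ⟨sm2 (-1) F.P, F.b⟩
def fsub (F G : FP) : FP := ⟨add2 F.P (sm2 (-1) G.P), F.b + G.b⟩

theorem inv_of (p : R3) : InvP (fof p) p := ⟨rfl, le_refl _⟩
theorem invp_add {F G : FP} {p q : R3} (hF : InvP F p) (hG : InvP G q) : InvP (fadd F G) (p + q) := by
  constructor
  · rw [fadd, ← hF.1, ← hG.1]; exact pk3_add p q
  · exact (nrm3_add p q).trans (Nat.add_le_add hF.2 hG.2)
theorem invp_mul {F G : FP} {p q : R3} (hF : InvP F p) (hG : InvP G q) : InvP (fmul F G) (p * q) := by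
  constructor
  · rw [fmul, ← hF.1, ← hG.1]; exact pk3_mul p q
  · exact (nrm3_mul p q).trans (Nat.mul_le_mul hF.2 hG.2)
theorem invp_neg {F : FP} {p : R3} (hF : InvP F p) : InvP (fneg F) (-p) := by
  constructor
  · rw [fneg, ← hF.1]; exact pk3_sm (-1) p
  · exact (nrm3_sm (-1) p).trans (by simpa [fneg] using hF.2)
theorem invp_sub {F G : FP} {p q : R3} (hF : InvP F p) (hG : InvP G q) : InvP (fsub F G) (p - q) := by
  constructor
  · have e : ∀ p' q' : Q3, pk3 p' = F.P → pk3 q' = G.P →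
        pk3 (add3 p' (sm3 (-1) q')) = add2 F.P (sm2 (-1) G.P) := by
      intro p' q' h1 h2
      rw [pk3_add, pk3_sm, h1, h2]
    exact e p q hF.1 hG.1
  · exact (nrm3_add p _).trans (Nat.add_le_add hF.2 ((nrm3_sm (-1) q).trans (by simpa using hG.2)))

def fstep (A B D : R3) (q : FP × FP) : FP × FP :=
  (fsub (fmul (fof D) q.1) (fmul (fof (Lop A B D)) q.2), fmul (fof D) q.2)
def ffrac (A B l N : R3) (F : FP) : List R3 → FP × FP
  | [] => (fadd (fof (Lop A B N)) (fmul (fof l) F), F)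
  | D :: Ds => fstep A B D (ffrac A B l N F Ds)

theorem inv_frac (A B l N : R3) {F : FP} (hF : InvP F N) : ∀ Ds, InvP (ffrac A B l N F Ds).1 (fracN A B l N Ds).1 ∧
    InvP (ffrac A B l N F Ds).2 (fracN A B l N Ds).2
  | [] => ⟨invp_add (inv_of _) (invp_mul (inv_of _) hF), hF⟩
  | D :: Ds => by
    have ih := inv_frac A B l N hF Ds
    exact ⟨invp_sub (invp_mul (inv_of _) ih.1) (invp_mul (inv_of _) ih.2), invp_mul (inv_of _) ih.2⟩

/-! the polynomials to be tested -/
def kap : R3 := c 1300 * x * x + c 2080 * x + c 832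
def lE : R3 := (c (-4000) - c 1000 * x) * m - c 1000
def lH : R3 := (c (-1500) - c 1000 * x) * m - c 1000
def DsE : List R3 := [rD1, rD2, rD3, rD4]
def DsH : List R3 := [t + c 1, t + m, rD1, rD2]
def Am : R3 := c 1000 * m
def Bm : R3 := m * kap
def FE : R3 := (fracN Am Bm lE (-rP) DsE).1
def FEx : R3 := (fracN (c 0) (c 1) (c 0) (-rP) DsE).1
def FH : R3 := (fracN Am Bm lH rNH DsH).1
def FHx : R3 := (fracN (c 0) (c 1) (c 0) rNH DsH).1

def rT5 : R3 := t * t * t * t * t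
def r7 (p : R3) : R3 := [List.getD p 7 []]
def f7 (F : FP) : FP := ⟨[F.P.getD 7 []], F.b⟩
theorem inv_7 {F : FP} {p : Q3} (hF : InvP F p) : InvP (f7 F) [p.getD 7 []] := by
  constructor
  · rw [f7, ← hF.1]
    show [pk2 (List.getD p 7 [])] = [List.getD (List.map pk2 p) 7 (pk2 [])]
    rw [List.getD_map]
  · refine le_trans ?_ hF.2
    show nrm2 (List.getD p 7 []) + 0 ≤ nrmL nrm2 p
    by_cases h : 7 < List.length p
    · rw [List.getD_eq_getElem _ _ h, add_zero]
      exact nrmL_mem _ _ (List.getElem_mem h)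
    · rw [List.getD_eq_default _ _ (by omega)]; simp [nrm2, nrmL]

def rBq : R3 := rT5 * (c 20 + c 100 * t - c 1000 * t * t + c 625 * t * t * t + c 3125 * t * t * t * t)
def FEA : R3 := FE - r7 FE * (rT5 * t * t)
def FEB : R3 := c 1000 * FE + rBq * r7 FE
def fFE : FP := (ffrac Am Bm lE (-rP) (fof (-rP)) DsE).1
def fFEA : FP := fsub fFE (fmul (f7 fFE) (fof (rT5 * t * t)))
def fFEB : FP := fadd (fmul (fof (c 1000)) fFE) (fmul (fof rBq) (f7 fFE))
def CHx : R3 := FHx + rT5 * t * m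
def fCHx : FP := fadd (ffrac (c 0) (c 1) (c 0) rNH (fof rNH) DsH).1 (fof (rT5 * t * m))

/-- test on the staircase region -/
def stair (x0 : ℤ) (p : FP) : Bool :=
  neg3 x0 100 73 p && neg3 100 250 57 p && neg3 250 350 49 p && neg3 350 471 45 p

def Reg (x m : ℝ) : Prop := 0 < m ∧ x < 4.71 ∧ m < 0.073 ∧ (1 ≤ x → m < 0.057) ∧
  (2.5 ≤ x → m < 0.049) ∧ (3.5 ≤ x → m < 0.045)

theorem stair_spec {x0 : ℤ} {t x m : ℝ} (ht : 0 ≤ t) (h : Reg x m) (hx0 : x0 ≤ 100 * x) {F : FP} {p : R3}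
    (hF : InvP F p) (hs : stair x0 F = true) : evR t x m p ≤ 0 := by
  obtain ⟨h0, h1, h2, h3, h4, h5⟩ := h
  simp only [stair, Bool.and_eq_true] at hs
  obtain ⟨⟨⟨s1, s2⟩, s3⟩, s4⟩ := hs
  rcases lt_or_ge x 1 with k1 | k1
  · exact neg3_spec ht h0.le (by push_cast; linarith) hx0 (by push_cast; linarith) hF s1
  rcases lt_or_ge x 2.5 with k2 | k2
  · exact neg3_spec ht h0.le (by push_cast; linarith [h3 k1]) (by push_cast; linarith) (by push_cast; linarith) hF s2
  rcases lt_or_ge x 3.5 with k3 | k3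
  · exact neg3_spec ht h0.le (by push_cast; linarith [h4 k2]) (by push_cast; linarith) (by push_cast; linarith) hF s3
  · exact neg3_spec ht h0.le (by push_cast; linarith [h5 k3]) (by push_cast; linarith) (by push_cast; linarith) hF s4

end

section

open R3

set_option maxRecDepth 100000 in
theorem ck_P : neg3 (-101) (-13) 73 (fof rP) = true := by decide +kernel
set_option maxRecDepth 100000 in
theorem ck_Hx : neg3 (-101) 471 73 fCHx = true := by decide +kernel
set_option maxRecDepth 100000 in
theorem ck_Ex : stair (-17) (ffrac (c 0) (c 1) (c 0) (-rP) (fof (-rP)) DsE).1 = true := by decide +kernel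
set_option maxRecDepth 100000 in
theorem ck_H : stair (-60) (fneg (ffrac Am Bm lH rNH (fof rNH) DsH).1) = true := by decide +kernel
set_option maxRecDepth 100000 in
theorem ck_E : (stair (-17) fFEA && stair (-17) fFEB) = true := by decide +kernel

end

section

open R3

noncomputable def dpr (t x m : ℝ) : List R3 → ℝ
  | [] => 1
  | D :: Ds => evR t x m D * dpr t x m Ds

theorem evR_Lop {t μ α : ℝ} {Y Z : ℝ → ℝ} {Y' Z' : ℝ} (hY : HasDerivAt Y Y' μ)
    (hZ : HasDerivAt Z Z' μ) {A B : R3} (hA : evR t (Y μ) (Z μ) A = α * Z')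
    (hB : evR t (Y μ) (Z μ) B = α * Y') (p : R3) :
    ∃ d, HasDerivAt (fun r => evR t (Y r) (Z r) p) d μ ∧ evR t (Y μ) (Z μ) (Lop A B p) = α * d := by
  refine ⟨_, ev3_der (t := t) hY hZ p, ?_⟩
  rw [Lop, evR_add, evR_mul, evR_mul, hA, hB]
  show α * Z' * ev3 t (Y μ) (Z μ) (dm3 p) + α * Y' * ev3 t (Y μ) (Z μ) (dx3 p) = _
  ring

theorem frac_deriv {t μ α : ℝ} {Y Z : ℝ → ℝ} {Y' Z' : ℝ} (hY : HasDerivAt Y Y' μ)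
    (hZ : HasDerivAt Z Z' μ) {A B : R3} (hA : evR t (Y μ) (Z μ) A = α * Z')
    (hB : evR t (Y μ) (Z μ) B = α * Y') (l N : R3) :
    ∀ Ds : List R3, (∀ D ∈ Ds, evR t (Y μ) (Z μ) D ≠ 0) →
    dpr t (Y μ) (Z μ) Ds ≠ 0 ∧
    evR t (Y μ) (Z μ) (fracN A B l N Ds).2 = evR t (Y μ) (Z μ) N * dpr t (Y μ) (Z μ) Ds ∧
    ∃ v, HasDerivAt (fun r => evR t (Y r) (Z r) N / dpr t (Y r) (Z r) Ds) v μ ∧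
      α * v + evR t (Y μ) (Z μ) l * (evR t (Y μ) (Z μ) N / dpr t (Y μ) (Z μ) Ds)
        = evR t (Y μ) (Z μ) (fracN A B l N Ds).1 / (dpr t (Y μ) (Z μ) Ds) ^ 2
  | [], _ => by
    obtain ⟨d, hd, he⟩ := evR_Lop hY hZ hA hB N
    refine ⟨by simp [dpr], by simp [dpr, fracN], d, by simpa [dpr] using hd, ?_⟩
    simp only [fracN, evR_add, evR_mul, he, dpr]; ring
  | D :: Ds, h => by
    obtain ⟨h0, h1, v, hv, he⟩ := frac_deriv hY hZ hA hB l N Ds (fun E hE => h E (by simp [hE]))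
    obtain ⟨d, hd, hL⟩ := evR_Lop hY hZ hA hB D
    have hD := h D (by simp)
    have e1 : dpr t (Y μ) (Z μ) (D :: Ds) = evR t (Y μ) (Z μ) D * dpr t (Y μ) (Z μ) Ds := rfl
    refine ⟨by rw [e1]; exact mul_ne_zero hD h0, ?_, ?_⟩
    · show evR t (Y μ) (Z μ) (D * (fracN A B l N Ds).2) = _
      rw [evR_mul, h1, e1]; ring
    refine ⟨_, (hv.div hd hD).congr_of_eventuallyEq (Filter.Eventually.of_forall fun r => ?_), ?_⟩
    · show evR t (Y r) (Z r) N / (evR t (Y r) (Z r) D * dpr t (Y r) (Z r) Ds) = _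
      rw [mul_comm, ← div_div]; rfl
    · show _ = evR t (Y μ) (Z μ) (D * (fracN A B l N Ds).1 - Lop A B D * (fracN A B l N Ds).2) / _
      rw [evR_sub, evR_mul, evR_mul, hL, h1, e1]
      have he' : evR t (Y μ) (Z μ) (fracN A B l N Ds).1 = (α * v + evR t (Y μ) (Z μ) l *
        (evR t (Y μ) (Z μ) N / dpr t (Y μ) (Z μ) Ds)) * (dpr t (Y μ) (Z μ) Ds) ^ 2 := by
        rw [he]; field_simp
      rw [he']
      field_simp
      ring

noncomputable def vE (t x m : ℝ) : ℝ := evR t x m (-rP) / dpr t x m DsE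
noncomputable def vH (t x m : ℝ) : ℝ := evR t x m rNH / dpr t x m DsH

theorem ev_rS (t x m : ℝ) : evR t x m rS = 1 - x * m := by
  simp only [rS, evR_sub, evR_c, evR_mul, evR_x, evR_m]; push_cast; ring
theorem ev_rE (t x m : ℝ) : evR t x m rE = 1 + x * m + 2 * m := by
  simp only [rE, evR_add, evR_sub, evR_c, evR_mul, evR_m, ev_rS]; push_cast; ring

theorem ev_D1 (t x m : ℝ) : evR t x m rD1 = 2 * t ^ 2 + t * (3 + x * m) + (1 + x * m + 2 * m) := by
  simp only [rD1, evR_add, evR_sub, evR_c, evR_mul, evR_m, evR_t, ev_rS, ev_rE]; push_cast; ring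
theorem ev_D2 (t x m : ℝ) : evR t x m rD2 = 2 * t ^ 2 + t * (1 - x * m - 4 * m) + m * (1 + x * m + 2 * m) := by
  simp only [rD2, evR_add, evR_sub, evR_c, evR_mul, evR_m, evR_t, ev_rS, ev_rE]; push_cast; ring
theorem ev_D3 (t x m : ℝ) : evR t x m rD3 = 2 * t ^ 2 + t * m * (3 + x * m) + m ^ 2 * (1 + x * m + 2 * m) := by
  simp only [rD3, evR_add, evR_sub, evR_c, evR_mul, evR_m, evR_t, ev_rS, ev_rE]; push_cast; ring
theorem ev_D4 (t x m : ℝ) : evR t x m rD4 = 2 * t ^ 2 + t * m * (1 - x * m - 4 * m) + m ^ 3 * (1 + x * m + 2 * m) := by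
  simp only [rD4, evR_add, evR_sub, evR_c, evR_mul, evR_m, evR_t, ev_rS, ev_rE]; push_cast; ring

theorem box_bounds {x m : ℝ} (hm0 : 0 < m) (hm : m < 0.073) (hx0 : -1.01 ≤ x) (hx : x < 4.71) :
    0 < 3 + x * m ∧ 0 < 1 + x * m + 2 * m ∧ 0 < 1 - x * m - 4 * m := by
  refine ⟨?_, ?_, ?_⟩ <;> nlinarith

theorem DsE_pos {t x m : ℝ} (ht : 0 < t) (hm0 : 0 < m) (hm : m < 0.073) (hx0 : -1.01 ≤ x) (hx : x < 4.71) :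
    ∀ D ∈ DsE, 0 < evR t x m D := by
  obtain ⟨h1, h2, h3⟩ := box_bounds hm0 hm hx0 hx
  intro D hD
  simp only [DsE, List.mem_cons, List.not_mem_nil, or_false] at hD
  rcases hD with rfl | rfl | rfl | rfl
  · rw [ev_D1]; positivity
  · rw [ev_D2]; positivity
  · rw [ev_D3]; positivity
  · rw [ev_D4]; positivity

theorem DsH_pos {t x m : ℝ} (ht : 0 < t) (hm0 : 0 < m) (hm : m < 0.073) (hx0 : -1.01 ≤ x) (hx : x < 4.71) :
    ∀ D ∈ DsH, 0 < evR t x m D := by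
  obtain ⟨h1, h2, h3⟩ := box_bounds hm0 hm hx0 hx
  intro D hD
  simp only [DsH, List.mem_cons, List.not_mem_nil, or_false] at hD
  rcases hD with rfl | rfl | rfl | rfl
  · rw [evR_add, evR_t, evR_c]; push_cast; positivity
  · rw [evR_add, evR_t, evR_m]; positivity
  · rw [ev_D1]; positivity
  · rw [ev_D2]; positivity

theorem dpr_pos {t x m : ℝ} : ∀ Ds : List R3, (∀ D ∈ Ds, 0 < evR t x m D) → 0 < dpr t x m Ds
  | [], _ => by simp [dpr]
  | D :: Ds, h => mul_pos (h D (by simp)) (dpr_pos Ds fun E hE => h E (by simp [hE]))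

/-- derivative in the direction of `x` -/
theorem dx_deriv {t x m : ℝ} (N : R3) (Ds : List R3) (h : ∀ D ∈ Ds, 0 < evR t x m D) :
    HasDerivAt (fun r => evR t r m N / dpr t r m Ds)
      (evR t x m (fracN (c 0) (c 1) (c 0) N Ds).1 / (dpr t x m Ds) ^ 2) x := by
  obtain ⟨-, -, v, hv, he⟩ := frac_deriv (t := t) (α := 1) (hasDerivAt_id x) (hasDerivAt_const x m)
    (A := c 0) (B := c 1) (by rw [evR_c]; simp) (by rw [evR_c]; simp) (c 0) N Ds (fun D hD => (h D hD).ne')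
  rw [evR_c] at he
  simp only [Int.cast_zero, zero_mul, add_zero, one_mul, id] at he hv
  rw [← he]; exact hv

theorem FHx_neg {t x m : ℝ} (ht : 0 < t) (hm0 : 0 < m) (hm : m < 0.073) (hx0 : -1.01 ≤ x) (hx : x < 4.71) :
    evR t x m FHx < 0 := by
  have hi : InvP fCHx CHx := by
    refine invp_add (inv_frac _ _ _ _ (inv_of _) _).1 (inv_of _)
  have := neg3_spec (t := t) (x := x) (m := m) ht.le hm0.le (M := 73) (by push_cast; linarith)
    (by push_cast; linarith) (by push_cast; linarith) hi ck_Hx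
  have h2 : evR t x m CHx ≤ 0 := this
  rw [CHx, evR_add] at h2
  have h3 : evR t x m (rT5 * R3.t * R3.m) = t ^ 6 * m := by
    simp only [rT5, evR_mul, evR_t, evR_m]; ring
  rw [h3] at h2
  have : 0 < t ^ 6 * m := by positivity
  linarith

theorem vH_anti {t x y m : ℝ} (ht : 0 < t) (hm0 : 0 < m) (hm : m < 0.073) (hx0 : -1.01 ≤ x) (hxy : x < y)
    (hy : y < 4.71) : vH t y m < vH t x m := by
  have hd : ∀ r ∈ Set.Icc x y, HasDerivAt (fun r => vH t r m) (evR t r m FHx / (dpr t r m DsH) ^ 2) r := by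
    intro r hr
    exact dx_deriv rNH DsH (DsH_pos ht hm0 hm (by linarith [hr.1]) (by linarith [hr.2]))
  have := strictAntiOn_of_deriv_neg (convex_Icc x y) (f := fun r => vH t r m)
    (fun r hr => (hd r hr).continuousAt.continuousWithinAt) (fun r hr => by
      rw [interior_Icc] at hr
      have hr' : r ∈ Set.Icc x y := ⟨hr.1.le, hr.2.le⟩
      rw [(hd r hr').deriv]
      exact div_neg_of_neg_of_pos (FHx_neg ht hm0 hm (by linarith [hr.1]) (by linarith [hr.2]))
        (pow_pos (dpr_pos _ (DsH_pos ht hm0 hm (by linarith [hr.1]) (by linarith [hr.2]))) 2))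
  exact this ⟨le_refl _, hxy.le⟩ ⟨hxy.le, le_refl _⟩ hxy

theorem Reg.mono {x y m n : ℝ} (h : Reg y n) (hm : 0 < m) (hmn : m ≤ n) (hxy : x ≤ y) : Reg x m := by
  obtain ⟨h0, h1, h2, h3, h4, h5⟩ := h
  exact ⟨hm, by linarith, by linarith, fun h => by linarith [h3 (by linarith)],
    fun h => by linarith [h4 (by linarith)], fun h => by linarith [h5 (by linarith)]⟩

theorem vE_anti {t x y m : ℝ} (ht : 0 < t) (hR : Reg y m) (hx0 : -0.17 ≤ x) (hxy : x ≤ y) :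
    vE t y m ≤ vE t x m := by
  have hRr : ∀ r ≤ y, Reg r m := fun r hr => hR.mono hR.1 le_rfl hr
  have hp : ∀ r ∈ Set.Icc x y, ∀ D ∈ DsE, 0 < evR t r m D := by
    intro r hr
    obtain ⟨h0, h1, h2, -⟩ := hRr r hr.2
    exact DsE_pos ht h0 h2 (by linarith [hr.1]) h1
  have hd : ∀ r ∈ Set.Icc x y, HasDerivAt (fun r => vE t r m) (evR t r m FEx / (dpr t r m DsE) ^ 2) r :=
    fun r hr => dx_deriv (-rP) DsE (hp r hr)
  have := antitoneOn_of_deriv_nonpos (convex_Icc x y) (f := fun r => vE t r m)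
    (fun r hr => (hd r hr).continuousAt.continuousWithinAt)
    (fun r hr => (hd r (interior_subset hr)).differentiableAt.differentiableWithinAt) (fun r hr => by
      have hr' := interior_subset hr
      rw [(hd r hr').deriv]
      refine div_nonpos_of_nonpos_of_nonneg ?_ (sq_nonneg _)
      exact stair_spec ht.le (hRr r hr'.2) (by push_cast; linarith [hr'.1])
        (inv_frac (c 0) (c 1) (c 0) (-rP) (inv_of (-rP)) DsE).1 ck_Ex)
  exact this ⟨le_refl _, hxy⟩ ⟨hxy, le_refl _⟩ hxy

theorem FH_nonneg {t x m : ℝ} (ht : 0 < t) (hR : Reg x m) (hx0 : -0.6 ≤ x) : 0 ≤ evR t x m FH := by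
  have := stair_spec ht.le hR (by push_cast; linarith)
        (invp_neg (inv_frac Am Bm lH rNH (inv_of rNH) DsH).1) ck_H
  rw [evR_neg] at this
  have : - evR t x m FH ≤ 0 := this
  linarith

theorem quart_pos {u : ℝ} (hu0 : 0 < u) : 0 ≤ u ^ 4 + u ^ 3 - 8 * u ^ 2 + 4 * u + 4 := by
  have e : u ^ 4 + u ^ 3 - 8 * u ^ 2 + 4 * u + 4 = (u ^ 2 + u / 2 - 27/10) ^ 2
    + (-285/100 * u ^ 2 + 67/10 * u - 329/100) := by ring
  nlinarith [sq_nonneg (u^2 + u/2 - 4), sq_nonneg (u - 1.6), mul_nonneg hu0.le (sq_nonneg (u-1.6)), sq_nonneg (u^2 - 1.6 ^ 2),sq_nonneg (u^2 - 1.6 * u)]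

theorem BqT {t T : ℝ} (ht : 0 < t) (hT : 0 ≤ T) :
    0 ≤ t ^ 5 * (20 + 100 * t - 1000 * t ^ 2 + 625 * t ^ 3 + 3125 * t ^ 4) * T := by
  have hq : 0 ≤ 20 + 100 * t - 1000 * t ^ 2 + 625 * t ^ 3 + 3125 * t ^ 4 := by
    have := quart_pos (u := 5 * t) (by linarith)
    have e : 20 + 100 * t - 1000 * t ^ 2 + 625 * t ^ 3 + 3125 * t ^ 4
        = 5 * ((5*t) ^ 4 + (5*t) ^ 3 - 8 * (5*t) ^ 2 + 4 * (5*t) + 4) := by ring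
    linarith
  positivity

theorem FE_nonpos {t x m : ℝ} (ht : 0 < t) (hR : Reg x m) (hx0 : -0.17 ≤ x) : evR t x m FE ≤ 0 := by
  have hi : InvP fFE FE := (inv_frac Am Bm lE (-rP) (inv_of (-rP)) DsE).1
  have h7 : InvP (f7 fFE) (r7 FE) := inv_7 hi
  have iA : InvP fFEA FEA := invp_sub hi (invp_mul h7 (inv_of _))
  have iB : InvP fFEB FEB := invp_add (invp_mul (inv_of _) hi) (invp_mul (inv_of _) h7)
  have hck := ck_E
  rw [Bool.and_eq_true] at hck
  have hA := stair_spec ht.le hR (by push_cast; linarith) iA hck.1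
  have hB := stair_spec ht.le hR (by push_cast; linarith) iB hck.2
  have e7 : evR t x m (rT5 * R3.t * R3.t) = t ^ 7 := by
    simp only [rT5, evR_mul, evR_t]; ring
  have eq : evR t x m rBq = t ^ 5 * (20 + 100 * t - 1000 * t ^ 2 + 625 * t ^ 3 + 3125 * t ^ 4) := by
    simp only [rBq, rT5, evR_mul, evR_t, evR_add, evR_sub, evR_c]; push_cast; ring
  rw [FEA, evR_sub, evR_mul, e7] at hA
  rw [FEB, evR_add, evR_mul, evR_mul, evR_c, eq] at hB
  push_cast at hB
  generalize evR t x m (r7 FE) = T at hA hB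
  generalize evR t x m FE = F at hA hB ⊢
  rcases le_total T 0 with h | h
  · have : T * t ^ 7 ≤ 0 := mul_nonpos_of_nonpos_of_nonneg h (by positivity)
    linarith
  · have := BqT ht h
    linarith

end

section

open R3

noncomputable def flX (K μ : ℝ) : ℝ := 1 / (K - 1.3 * μ) - 0.8
noncomputable def flW (β K μ : ℝ) : ℝ := Real.exp (-β * μ + Real.log (K - 1.3 * μ) / 1.3) / μ

theorem flW_pos (β K : ℝ) {μ : ℝ} (h : 0 < μ) : 0 < flW β K μ := div_pos (Real.exp_pos _) h

theorem flow_deriv {t β K μ : ℝ} (hμ : 0 < μ) (hK : 0 < K - 1.3 * μ) (l N : R3) (Ds : List R3)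
    (hl : evR t (flX K μ) μ l = 1000 * μ * (-β - 1 / (K - 1.3 * μ)) - 1000)
    (h : ∀ D ∈ Ds, 0 < evR t (flX K μ) μ D) :
    HasDerivAt (fun r => flW β K r * (evR t (flX K r) r N / dpr t (flX K r) r Ds))
      (flW β K μ / (1000 * μ) * (evR t (flX K μ) μ (fracN Am Bm l N Ds).1 / (dpr t (flX K μ) μ Ds) ^ 2)) μ := by
  have hk : HasDerivAt (fun r => K - 1.3 * r) (-1.3) μ := by
    have := ((hasDerivAt_id μ).const_mul (1.3:ℝ)).const_sub K
    simpa using this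
  have hX : HasDerivAt (flX K) (1.3 * (flX K μ + 0.8) ^ 2) μ := by
    have := (hk.inv hK.ne').sub_const (0.8:ℝ)
    have e : flX K = fun r => (K - 1.3 * r)⁻¹ - 0.8 := by funext r; rw [flX, one_div]
    rw [e]
    refine this.congr_deriv ?_
    field_simp; norm_num
  obtain ⟨-, -, v, hv, he⟩ := frac_deriv (t := t) (α := 1000 * μ) hX (hasDerivAt_id μ)
    (A := Am) (B := Bm) (by simp only [Am, evR_mul, evR_c, evR_m, id]; push_cast; ring)
    (by simp only [Bm, kap, evR_mul, evR_add, evR_c, evR_m, evR_x, id]; push_cast; ring) l N Ds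
      (fun D hD => (h D hD).ne')
  simp only [id] at hv he
  have hW : HasDerivAt (flW β K) (flW β K μ * (-β - 1 / (K - 1.3 * μ) - 1 / μ)) μ := by
    have h1 := (((hasDerivAt_id μ).const_mul (-β)).add ((hk.log hK.ne').div_const 1.3)).exp
    have := h1.div (hasDerivAt_id μ) hμ.ne'
    refine this.congr_deriv ?_
    simp only [flW, id, Pi.add_apply]
    field_simp
    ring
  refine (hW.mul hv).congr_deriv ?_
  rw [← he, hl]
  generalize evR t (flX K μ) μ N / dpr t (flX K μ) μ Ds = V
  field_simp
  ring

theorem lE_val (t K μ : ℝ) : evR t (flX K μ) μ lE = 1000 * μ * (-3.2 - 1 / (K - 1.3 * μ)) - 1000 := by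
  simp only [lE, evR_sub, evR_mul, evR_c, evR_x, evR_m, flX]; push_cast; ring
theorem lH_val (t K μ : ℝ) : evR t (flX K μ) μ lH = 1000 * μ * (-0.7 - 1 / (K - 1.3 * μ)) - 1000 := by
  simp only [lH, evR_sub, evR_mul, evR_c, evR_x, evR_m, flX]; push_cast; ring

theorem flX_mono {K μ ν : ℝ} (h : μ ≤ ν) (hK : 0 < K - 1.3 * ν) : flX K μ ≤ flX K ν := by
  have : 1 / (K - 1.3 * μ) ≤ 1 / (K - 1.3 * ν) := one_div_le_one_div_of_le hK (by linarith)
  unfold flX; linarith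

theorem flow_E {t K m1 m2 : ℝ} (ht : 0 < t) (h1 : 0 < m1) (h12 : m1 ≤ m2) (hK : 0 < K - 1.3 * m2)
    (hR : Reg (flX K m2) m2) (hx : -0.17 ≤ flX K m1) :
    flW 3.2 K m2 * vE t (flX K m2) m2 ≤ flW 3.2 K m1 * vE t (flX K m1) m1 := by
  have hr : ∀ r ∈ Set.Icc m1 m2, 0 < r ∧ 0 < K - 1.3 * r ∧ Reg (flX K r) r ∧ -0.17 ≤ flX K r := by
    intro r hr
    have k0 : 0 < r := by linarith [hr.1]
    have k1 : 0 < K - 1.3 * r := by linarith [hr.2]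
    exact ⟨k0, k1, hR.mono k0 hr.2 (flX_mono hr.2 hK), hx.trans (flX_mono hr.1 k1)⟩
  have hp : ∀ r ∈ Set.Icc m1 m2, ∀ D ∈ DsE, 0 < evR t (flX K r) r D := by
    intro r hr'
    obtain ⟨-, -, ⟨g0, g1, g2, -⟩, g3⟩ := hr r hr'
    exact DsE_pos ht g0 g2 (by linarith) g1
  have hd := fun r (h : r ∈ Set.Icc m1 m2) => flow_deriv (t := t) (β := 3.2) (hr r h).1 (hr r h).2.1 lE (-rP) DsE
    (lE_val t K r) (hp r h)
  have := antitoneOn_of_deriv_nonpos (convex_Icc m1 m2)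
    (f := fun r => flW 3.2 K r * (evR t (flX K r) r (-rP) / dpr t (flX K r) r DsE))
    (fun r hr => (hd r hr).continuousAt.continuousWithinAt)
    (fun r hr => (hd r (interior_subset hr)).differentiableAt.differentiableWithinAt) (fun r hr' => by
      have hr'' := interior_subset hr'
      rw [(hd r hr'').deriv]
      obtain ⟨g0, g1, g2, g3⟩ := hr r hr''
      refine mul_nonpos_of_nonneg_of_nonpos (div_nonneg (flW_pos _ _ g0).le (by positivity)) ?_
      exact div_nonpos_of_nonpos_of_nonneg (FE_nonpos ht g2 g3) (sq_nonneg _))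
  exact this ⟨le_refl _, h12⟩ ⟨h12, le_refl _⟩ h12

theorem flow_H {t K m1 m2 : ℝ} (ht : 0 < t) (h1 : 0 < m1) (h12 : m1 ≤ m2) (hK : 0 < K - 1.3 * m2)
    (hR : Reg (flX K m2) m2) (hx : -0.6 ≤ flX K m1) :
    flW 0.7 K m1 * vH t (flX K m1) m1 ≤ flW 0.7 K m2 * vH t (flX K m2) m2 := by
  have hr : ∀ r ∈ Set.Icc m1 m2, 0 < r ∧ 0 < K - 1.3 * r ∧ Reg (flX K r) r ∧ -0.6 ≤ flX K r := by
    intro r hr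
    have k0 : 0 < r := by linarith [hr.1]
    have k1 : 0 < K - 1.3 * r := by linarith [hr.2]
    exact ⟨k0, k1, hR.mono k0 hr.2 (flX_mono hr.2 hK), hx.trans (flX_mono hr.1 k1)⟩
  have hp : ∀ r ∈ Set.Icc m1 m2, ∀ D ∈ DsH, 0 < evR t (flX K r) r D := by
    intro r hr'
    obtain ⟨-, -, ⟨g0, g1, g2, -⟩, g3⟩ := hr r hr'
    exact DsH_pos ht g0 g2 (by linarith) g1
  have hd := fun r (h : r ∈ Set.Icc m1 m2) => flow_deriv (t := t) (β := 0.7) (hr r h).1 (hr r h).2.1 lH rNH DsH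
    (lH_val t K r) (hp r h)
  have := monotoneOn_of_deriv_nonneg (convex_Icc m1 m2)
    (f := fun r => flW 0.7 K r * (evR t (flX K r) r rNH / dpr t (flX K r) r DsH))
    (fun r hr => (hd r hr).continuousAt.continuousWithinAt)
    (fun r hr => (hd r (interior_subset hr)).differentiableAt.differentiableWithinAt) (fun r hr' => by
      have hr'' := interior_subset hr'
      rw [(hd r hr'').deriv]
      obtain ⟨g0, g1, g2, g3⟩ := hr r hr''
      refine mul_nonneg (div_nonneg (flW_pos _ _ g0).le (by positivity)) ?_
      exact div_nonneg (FH_nonneg ht g2 g3) (sq_nonneg _))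
  exact this ⟨le_refl _, h12⟩ ⟨h12, le_refl _⟩ h12

end

section

open R3

theorem stieltjes_cmp {q : ℝ} (hq : q ∈ Set.Ioo (0:ℝ) 1) {k l : ℕ} (c x : Fin k → ℝ) (d y : Fin l → ℝ)
    (hx : ∀ i, 0 ≤ x i) (hy : ∀ i, 0 ≤ y i) (A B : ℝ)
    (h : ∀ t : ℝ, 0 < t → A * ∑ i, c i * x i / (t + x i) ≤ B * ∑ i, d i * y i / (t + y i)) :
    A * ∑ i, c i * x i ^ q ≤ B * ∑ i, d i * y i ^ q := by
  have := stieltjes_nonneg hq (l + k) (Fin.append (fun i => B * d i) (fun i => -A * c i)) (Fin.append y x)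
    (fun i => by
      refine Fin.addCases (fun i => ?_) (fun i => ?_) i
      · rw [Fin.append_left]; exact hy i
      · rw [Fin.append_right]; exact hx i) (fun t ht => by
      rw [Fin.sum_univ_add]
      simp only [Fin.append_left, Fin.append_right]
      have := h t ht
      rw [Finset.mul_sum, Finset.mul_sum] at this
      have e1 : ∑ i, B * d i * y i / (t + y i) = ∑ i, B * (d i * y i / (t + y i)) :=
        Finset.sum_congr rfl fun i _ => by ring
      have e2 : ∑ i, -A * c i * x i / (t + x i) = -∑ i, A * (c i * x i / (t + x i)) := by
        rw [← Finset.sum_neg_distrib]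
        exact Finset.sum_congr rfl fun i _ => by ring
      rw [e1, e2]; linarith)
  rw [Fin.sum_univ_add] at this
  simp only [Fin.append_left, Fin.append_right] at this
  rw [Finset.mul_sum, Finset.mul_sum]
  have e1 : ∑ i, B * d i * y i ^ q = ∑ i, B * (d i * y i ^ q) :=
    Finset.sum_congr rfl fun i _ => by ring
  have e2 : ∑ i, -A * c i * x i ^ q = -∑ i, A * (c i * x i ^ q) := by
    rw [← Finset.sum_neg_distrib]
    exact Finset.sum_congr rfl fun i _ => by ring
  rw [e1, e2] at this; linarith

theorem stieltjes_cmp_lt {q : ℝ} (hq : q ∈ Set.Ioo (0:ℝ) 1) {k l : ℕ} (c x : Fin k → ℝ) (d y : Fin l → ℝ)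
    (hx : ∀ i, 0 ≤ x i) (hy : ∀ i, 0 ≤ y i) (A B : ℝ)
    (h : ∀ t : ℝ, 0 < t → A * ∑ i, c i * x i / (t + x i) < B * ∑ i, d i * y i / (t + y i)) :
    A * ∑ i, c i * x i ^ q < B * ∑ i, d i * y i ^ q := by
  have := stieltjes_pos hq (l + k) (Fin.append (fun i => B * d i) (fun i => -A * c i)) (Fin.append y x)
    (fun i => by
      refine Fin.addCases (fun i => ?_) (fun i => ?_) i
      · rw [Fin.append_left]; exact hy i
      · rw [Fin.append_right]; exact hx i) (fun t ht => by
      rw [Fin.sum_univ_add]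
      simp only [Fin.append_left, Fin.append_right]
      have := h t ht
      rw [Finset.mul_sum, Finset.mul_sum] at this
      have e1 : ∑ i, B * d i * y i / (t + y i) = ∑ i, B * (d i * y i / (t + y i)) :=
        Finset.sum_congr rfl fun i _ => by ring
      have e2 : ∑ i, -A * c i * x i / (t + x i) = -∑ i, A * (c i * x i / (t + x i)) := by
        rw [← Finset.sum_neg_distrib]
        exact Finset.sum_congr rfl fun i _ => by ring
      rw [e1, e2]; linarith)
  rw [Fin.sum_univ_add] at this
  simp only [Fin.append_left, Fin.append_right] at this
  rw [Finset.mul_sum, Finset.mul_sum]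
  have e1 : ∑ i, B * d i * y i ^ q = ∑ i, B * (d i * y i ^ q) :=
    Finset.sum_congr rfl fun i _ => by ring
  have e2 : ∑ i, -A * c i * x i ^ q = -∑ i, A * (c i * x i ^ q) := by
    rw [← Finset.sum_neg_distrib]
    exact Finset.sum_congr rfl fun i _ => by ring
  rw [e1, e2] at this; linarith

theorem ev_P (t x m : ℝ) : evR t x m (-rP) = -2 * PP ((1 - x * m) / 2) m t := by
  simp only [rP, evR_neg, evR_sub, evR_add, evR_mul, evR_c, evR_t, evR_x, evR_m, ev_rS, ev_rE, PP]
  push_cast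
  ring

theorem ev_QE (t x m : ℝ) : dpr t x m DsE = 16 * QQ ((1 - x * m) / 2) m t := by
  simp only [DsE, dpr, ev_D1, ev_D2, ev_D3, ev_D4, QQ]; ring

noncomputable def xx (a b : ℝ) : ℝ := (1 - 2 * (a + b)) / (a * b)
theorem xx_mul {a b : ℝ} (ha : 0 < a) (hb : 0 < b) : (1 - xx a b * (a * b)) / 2 = a + b := by
  unfold xx; field_simp; ring

theorem E_rep {a b t : ℝ} (ha0 : 0 < a) (ha : a < 1) (hb0 : 0 < b) (hb : b < 1) (ht : 0 < t) :
    ∑ i, (cE a b i * mE a b i) * mE a b i / (t + mE a b i) =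
      (8 * (a - b) * (1 - (a + b) + a * b) * (1 - a * b)) * (t ^ 3 * vE t (xx a b) (a * b)) := by
  have hW := W_eq ha0 ha hb0 hb ht
  have h1 : ∑ i, (cE a b i * mE a b i) * mE a b i / (t + mE a b i) =
      ∑ i, cE a b i * mE a b i - t * ∑ i, cE a b i * mE a b i / (t + mE a b i) := by
    rw [Finset.mul_sum, ← Finset.sum_sub_distrib]
    refine Finset.sum_congr rfl fun i _ => ?_
    have := mE_pos ha0 ha hb0 hb i
    field_simp
    ring
  rw [h1, hW, sum_cm, vE, ev_P, ev_QE, xx_mul ha0 hb0]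
  have := QQ_pos ha0 ha hb0 hb ht
  field_simp
  ring

def cH (a b : ℝ) : Fin 6 → ℝ := ![1, -1, -1, -1, 1, 1]
def mH (a b : ℝ) : Fin 6 → ℝ := ![1, a * b, 1 - a, 1 - b, b * (1 - a), a * (1 - b)]

theorem mH_pos {a b : ℝ} (ha0 : 0 < a) (ha : a < 1) (hb0 : 0 < b) (hb : b < 1) (i : Fin 6) :
    0 < mH a b i := by
  have h1 : 0 < 1 - a := by linarith
  have h2 : 0 < 1 - b := by linarith
  fin_cases i <;> simp [mH] <;> first | linarith | positivity

theorem Hc_sum {a b p : ℝ} (ha0 : 0 < a) (ha : a < 1) (hb0 : 0 < b) (hb : b < 1) :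
    Hc p a b = ∑ i, (cH a b i * mH a b i ^ 2) * mH a b i ^ (p - 2) := by
  have h : ∀ i, (cH a b i * mH a b i ^ 2) * mH a b i ^ (p - 2) = cH a b i * mH a b i ^ p := by
    intro i
    rw [mul_assoc, ← Real.rpow_natCast, ← Real.rpow_add (mH_pos ha0 ha hb0 hb i)]
    congr 2; push_cast; ring
  simp only [h]
  simp [Fin.sum_univ_succ, cH, mH, Hc]
  ring

theorem ev_NH (t x m : ℝ) : evR t x m rNH =
    4 * (t + m) * evR t x m rD1 * evR t x m rD2
    - (t + 1) * (t + m) * (t * ((3 + x*m) ^ 3 - 6 * (3 + x*m) * (1 + x * m + 2 * m)) + (1 + x * m + 2 * m) * ((3 + x*m)^2 - 4 * (1 + x * m + 2 * m))) * evR t x m rD2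
    + (t + 1) * (t + m) * (t * ((1 - x*m - 4 * m) ^ 3 - 6 * (1 - x*m - 4 * m) * (m * (1 + x * m + 2 * m))) + (m * (1 + x * m + 2 * m)) * ((1 - x*m - 4 * m)^2 - 4 * (m * (1 + x * m + 2 * m)))) * evR t x m rD1
    - 4 * m ^ 3 * (t + 1) * evR t x m rD1 * evR t x m rD2 := by
  simp only [rNH, rPair, evR_neg, evR_sub, evR_add, evR_mul, evR_c, evR_t, evR_x, evR_m, ev_rS, ev_rE]
  push_cast
  ring

theorem H_rep {a b t : ℝ} (ha0 : 0 < a) (ha : a < 1) (hb0 : 0 < b) (hb : b < 1) (ht : 0 < t) :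
    ∑ i, (cH a b i * mH a b i ^ 2) * mH a b i / (t + mH a b i) = 1/4 * vH t (xx a b) (a * b) := by
  have h1 : 0 < 1 - a := by linarith
  have h2 : 0 < 1 - b := by linarith
  have hx : xx a b * (a * b) = 1 - 2 * (a + b) := by have := xx_mul ha0 hb0; linarith
  have d1 : evR t (xx a b) (a * b) rD1 = 2 * ((t + (1 - a)) * (t + (1 - b))) := by
    rw [ev_D1, hx]; ring
  have d2 : evR t (xx a b) (a * b) rD2 = 2 * ((t + b * (1 - a)) * (t + a * (1 - b))) := by
    rw [ev_D2, hx]; ring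
  have e : dpr t (xx a b) (a * b) DsH = (t + 1) * ((t + a * b) * (evR t (xx a b) (a * b) rD1 * (evR t (xx a b) (a * b) rD2 * 1))) := by
    simp only [DsH, dpr, evR_add, evR_t, evR_c, evR_m]; push_cast; ring
  have p1 : ∀ y z w : ℝ, 0 < y → 0 < z → y ^ 2 * y / (t + y) + z ^ 2 * z / (t + z) =
     (t * ((y + z) ^ 3 - 3 * (y + z) * (y * z)) + y * z * ((y+z) ^ 2 - 2 * (y * z))) / ((t + y) * (t + z)) := by
    intro y z w hy hz
    field_simp
    ring
  have e2 : ∑ i, (cH a b i * mH a b i ^ 2) * mH a b i / (t + mH a b i) = 1 / (t + 1) - (a * b) ^ 3 / (t + a * b)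
    - ((1 - a) ^ 2 * (1 - a) / (t + (1 - a)) + (1 - b) ^ 2 * (1 - b) / (t + (1 - b)))
    + ((b * (1 - a)) ^ 2 * (b * (1 - a)) / (t + (b * (1 - a))) + (a * (1 - b)) ^ 2 * (a * (1 - b)) / (t + (a * (1 - b)))) := by
    simp [Fin.sum_univ_succ, cH, mH]
    ring
  rw [e2, p1 _ _ 0 h1 h2, p1 _ _ 0 (by positivity) (by positivity), vH, e, ev_NH, d1, d2, hx]
  have q1 : 0 < (t + (1 - a)) * (t + (1 - b)) := by positivity
  have q2 : 0 < (t + b * (1 - a)) * (t + a * (1 - b)) := by positivity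
  generalize (t + (1 - a)) * (t + (1 - b)) = D1 at *
  generalize (t + b * (1 - a)) * (t + a * (1 - b)) = D2 at *
  have q3 : 0 < t + a * b := by positivity
  field_simp
  ring

end

section

open R3

theorem m_bound {x m c M : ℝ} (hm0 : 0 < m) (hm : m ≤ 1/4) (hs0 : 0 < 1 - x * m)
    (hsq : 16 * m ≤ (1 - x * m) ^ 2) (hc : c ≤ x) (h1 : (1 - c * M) ^ 2 < 16 * M)
    (h2 : (1 - c / 4) ^ 2 < 4) : m < M := by
  by_contra h'
  push Not at h'
  have k1 : 1 - x * m ≤ 1 - c * m := by nlinarith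
  have k2 : (1 - x * m) ^ 2 ≤ (1 - c * m) ^ 2 := pow_le_pow_left₀ hs0.le k1 2
  have hM : M ≤ 1/4 := by linarith
  rcases eq_or_lt_of_le hM with e | e
  · have : m = M := by linarith
    subst this; linarith
  have hh : (1/4 - M) * ((1 - c * m)^2 - 16 * m) = (1/4 - m) * ((1 - c * M)^2 - 16 * M)
     + (m - M) * ((1 - c/4)^2 - 4) - c^2 * (m - M) * (1/4 - m) * (1/4 - M) := by ring
  have g1 : (1/4 - m) * ((1 - c * M)^2 - 16 * M) ≤ 0 := mul_nonpos_of_nonneg_of_nonpos (by linarith) (by linarith)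
  have g2 : (m - M) * ((1 - c/4)^2 - 4) ≤ 0 := mul_nonpos_of_nonneg_of_nonpos (by linarith) (by linarith)
  have g3 : 0 ≤ c^2 * (m - M) * (1/4 - m) * (1/4 - M) :=
    mul_nonneg (mul_nonneg (mul_nonneg (sq_nonneg c) (by linarith)) (by linarith)) (by linarith)
  have g4 : 0 ≤ (1/4 - M) * ((1 - c * m)^2 - 16 * m) := mul_nonneg (by linarith) (by linarith)
  rcases eq_or_lt_of_le hm with e2 | e2
  · subst e2
    nlinarith
  · have : (1/4 - m) * ((1 - c * M)^2 - 16 * M) < 0 := mul_neg_of_pos_of_neg (by linarith) (by linarith)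
    linarith

set_option maxHeartbeats 1000000 in
theorem curve_reg {p a b : ℝ} (hp : 2 < p) (hp3 : p < 3) (hb0 : 0 < b) (hba : b ≤ a) (ha : a ≤ 1/2)
    (hc : Hc p a b = 0) : -1 ≤ xx a b ∧ Reg (xx a b) (a * b) := by
  have ha0 : 0 < a := by linarith
  have h2 := Hc_nonpos_of_le (q := 2) (by norm_num) hp.le ha0.le ha hb0.le (by linarith) hc
  have h3 := Hc_nonneg_of_le (by linarith) hp3.le ha0.le ha hb0.le (by linarith) hc
  have hm0 : 0 < a * b := by positivity
  have hm : a * b ≤ 1/4 := by nlinarith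
  have hsq : 16 * (a * b) ≤ (2 * (a + b)) ^ 2 := by nlinarith [sq_nonneg (a - b)]
  have hx : 2 * (a + b) = 1 - xx a b * (a * b) := by have := xx_mul ha0 hb0; linarith
  have hs0 : 0 < 2 * (a + b) := by positivity
  rw [Hc_two] at h2
  rw [Hc_three] at h3
  have hs : a + b = (1 - xx a b * (a * b)) / 2 := by linarith
  rw [hs] at h3
  have hx1 : -1 ≤ xx a b := by
    have h4 : 2 * (a + b) - 1 - a * b ≤ 0 := by
      by_contra h
      push Not at h
      nlinarith [mul_pos (by linarith : 0 < 1 - a * b) h]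
    by_contra h
    push Not at h
    nlinarith
  rw [hx] at hsq hs0
  clear hs h2 hc
  generalize xx a b = x at *
  generalize a * b = m at *
  refine ⟨hx1, hm0, ?_, ?_, ?_, ?_, ?_⟩
  · by_contra h
    push Not at h
    have e : 2 * ((1 - x * m) / 2) ^ 3 - 3 * (1 + m) * ((1 - x * m) / 2) ^ 2
      + 3 * (1 - m) ^ 2 * ((1 - x * m) / 2) - 1 + 6 * m + 6 * m ^ 2 - 3 * m ^ 3
      = m * ((3/4) * (3 - x) + m * (9 * x / 2 + 15/2) - m ^ 2 * (x ^ 3 / 4 + 3 * x ^ 2 / 4 + 3 * x / 2 + 3)) := by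
      ring
    rw [e] at h3
    have hm1 : m ≤ 0.041 := (m_bound (c := 4.71) hm0 hm hs0 hsq h (by norm_num) (by norm_num)).le
    have k1 : m * (9 * x / 2 + 15/2) ≤ 0.041 * (9 * x / 2 + 15/2) :=
      mul_le_mul_of_nonneg_right hm1 (by linarith)
    have k2 : 0 ≤ m ^ 2 * (x ^ 3 / 4 + 3 * x ^ 2 / 4 + 3 * x / 2 + 3) := by
      have : 0 < x := by linarith
      positivity
    have k3 : (3/4) * (3 - x) + m * (9 * x / 2 + 15/2) - m ^ 2 * (x ^ 3 / 4 + 3 * x ^ 2 / 4 + 3 * x / 2 + 3) < 0 := by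
      linarith
    have := mul_neg_of_pos_of_neg hm0 k3
    linarith
  · exact m_bound (c := -1) hm0 hm hs0 hsq hx1 (by norm_num) (by norm_num)
  · exact fun hx => (m_bound (c := 1) hm0 hm hs0 hsq hx (by norm_num) (by norm_num))
  · exact fun hx => (m_bound (c := 2.5) hm0 hm hs0 hsq hx (by norm_num) (by norm_num))
  · exact fun hx => (m_bound (c := 3.5) hm0 hm hs0 hsq hx (by norm_num) (by norm_num))

theorem En_sum' {p a b : ℝ} (ha0 : 0 < a) (ha : a < 1) (hb0 : 0 < b) (hb : b < 1) :
    En (p - 1) a b = ∑ i, (cE a b i * mE a b i) * mE a b i ^ (p - 2) := by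
  rw [En_sum]
  refine Finset.sum_congr rfl fun i _ => ?_
  rw [mul_assoc]; congr 1
  have h := mE_pos ha0 ha hb0 hb i
  nth_rewrite 2 [← Real.rpow_one (mE a b i)]
  rw [← Real.rpow_add h]; congr 1; ring

/-- sign of `En` for `x < -0.13` -/
theorem En_nonneg_left {p a b : ℝ} (hp : 2 < p) (hp3 : p < 3) (hb0 : 0 < b) (hba : b < a) (ha : a < 1/2)
    (hc : Hc p a b = 0) (hx : xx a b < -0.13) : 0 ≤ En (p - 1) a b := by
  obtain ⟨h1, hR⟩ := curve_reg hp hp3 hb0 hba.le ha.le hc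
  have ha0 : 0 < a := by linarith
  rw [En_sum' ha0 (by linarith) hb0 (by linarith)]
  refine stieltjes_nonneg ⟨by linarith, by linarith⟩ 8 _ _
    (fun i => (mE_pos ha0 (by linarith) hb0 (by linarith) i).le) ?_
  intro t ht
  rw [E_rep ha0 (by linarith) hb0 (by linarith) ht]
  have k : 0 ≤ vE t (xx a b) (a * b) := by
    refine div_nonneg ?_ (dpr_pos _ (DsE_pos ht hR.1 hR.2.2.1 (by linarith) hR.2.1)).le
    rw [evR_neg]
    have : evR t (xx a b) (a * b) rP ≤ 0 :=
      neg3_spec ht.le hR.1.le (M := 73) (by push_cast; linarith [hR.2.2.1]) (by push_cast; linarith)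
        (by push_cast; linarith) (inv_of rP) ck_P
    linarith
  have h2 : 0 < 1 - a * b := by nlinarith
  have h3 : 0 < 1 - (a + b) + a * b := by nlinarith
  have h4 : 0 < a - b := by linarith
  positivity

theorem Hc_lt {p a1 b1 a2 b2 A B : ℝ} (hp : 2 < p) (hp3 : p < 3) (hb1 : 0 < b1) (ha1 : 0 < a1)
   (ha1' : a1 < 1) (hb1' : b1 < 1) (hb2 : 0 < b2) (ha2 : 0 < a2)
   (ha2' : a2 < 1) (hb2' : b2 < 1)
   (h : ∀ t : ℝ, 0 < t → A * vH t (xx a1 b1) (a1 * b1) < B * vH t (xx a2 b2) (a2 * b2)) :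
   A * Hc p a1 b1 < B * Hc p a2 b2 := by
  rw [Hc_sum ha1 ha1' hb1 hb1', Hc_sum ha2 ha2' hb2 hb2']
  refine stieltjes_cmp_lt ⟨by linarith, by linarith⟩ _ _ _ _
    (fun i => (mH_pos ha1 ha1' hb1 hb1' i).le) (fun i => (mH_pos ha2 ha2' hb2 hb2' i).le) A B ?_
  intro t ht
  rw [H_rep ha1 ha1' hb1 hb1' ht, H_rep ha2 ha2' hb2 hb2' ht]
  linarith [h t ht]

theorem xx_le_of_same {p a1 b1 a2 b2 : ℝ} (hp : 2 < p) (hp3 : p < 3) (hb1 : 0 < b1) (hba1 : b1 ≤ a1)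
    (ha1 : a1 ≤ 1/2) (hc1 : Hc p a1 b1 = 0) (hb2 : 0 < b2) (hba2 : b2 ≤ a2)
    (ha2 : a2 ≤ 1/2) (hc2 : Hc p a2 b2 = 0) (hm : a1 * b1 = a2 * b2) : xx a1 b1 ≤ xx a2 b2 := by
  by_contra hlt
  push Not at hlt
  obtain ⟨x1, R1⟩ := curve_reg hp hp3 hb1 hba1 ha1 hc1
  obtain ⟨x2, R2⟩ := curve_reg hp hp3 hb2 hba2 ha2 hc2
  have := Hc_lt (p := p) (a1 := a1) (b1 := b1) (a2 := a2) (b2 := b2) (A := 1) (B := 1) hp hp3 hb1 (by linarith) (by linarith) (by linarith) hb2 (by linarith)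
    (by linarith) (by linarith) (fun t ht => by
      rw [one_mul, one_mul, hm]
      rw [hm] at R1
      exact vH_anti ht R2.1 R2.2.2.1 (by linarith) hlt R1.2.1)
  rw [hc1, hc2] at this
  linarith

theorem m_lt {p a1 b1 a2 b2 : ℝ} (hp : 2 < p) (hp3 : p < 3) (h0 : 0 < b1) (hb : b1 < b2) (hba : b2 < a2)
    (ha : a2 < a1) (ha1 : a1 < 1/2) (hc1 : Hc p a1 b1 = 0) (hc2 : Hc p a2 b2 = 0) :
    a1 * b1 < a2 * b2 := by
  obtain ⟨k, hkc, hm, hmem, hH, hex, k0, k1, hd⟩ := exists_path (p := p) (by linarith)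
  have hsy : ∀ t ∈ Set.Icc (0:ℝ) 1, 1 - t ∈ Set.Icc (0:ℝ) 1 := fun t ht =>
    ⟨by linarith [ht.2], by linarith [ht.1]⟩
  have hsub : Set.Icc (1/2:ℝ) 1 ⊆ Set.Icc 0 1 := Set.Icc_subset_Icc (by norm_num) le_rfl
  have hcont : ContinuousOn (fun t => k t * k (1 - t)) (Set.Icc (1/2:ℝ) 1) := by
    refine ContinuousOn.mul (hkc.mono hsub) ?_
    exact hkc.comp (by fun_prop) (fun t ht => hsy t (hsub ht))
  have hpos : ∀ t ∈ Set.Ico (1/2:ℝ) 1, 0 < k (1 - t) := by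
    intro t ht
    rw [← k0]
    exact hm (by norm_num) (hsy t (hsub ⟨ht.1, ht.2.le⟩)) (by linarith [ht.2])
  have hle : ∀ t ∈ Set.Icc (1/2:ℝ) 1, k (1 - t) ≤ k t := by
    intro t ht
    exact hm.monotoneOn (hsy t (hsub ht)) (hsub ht) (by linarith [ht.1])
  have hinj : Set.InjOn (fun t => k t * k (1 - t)) (Set.Icc (1/2:ℝ) 1) := by
    intro t ht s hs hts
    simp only at hts
    rcases eq_or_lt_of_le ht.2 with e | e
    · rcases eq_or_lt_of_le hs.2 with e' | e'
      · rw [e, e']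
      · have := hpos s ⟨hs.1, e'⟩
        have := hle s hs
        rw [e, sub_self, k0, mul_zero] at hts
        nlinarith
    · rcases eq_or_lt_of_le hs.2 with e' | e'
      · have := hpos t ⟨ht.1, e⟩
        have := hle t ht
        rw [e', sub_self, k0, mul_zero] at hts
        nlinarith
      · have q1 := hpos t ⟨ht.1, e⟩
        have q2 := hpos s ⟨hs.1, e'⟩
        have q3 := hle t ht
        have q4 := hle s hs
        have g1 := xx_le_of_same hp hp3 q1 q3 (hmem t (hsub ht)).2 (hH t (hsub ht)) q2 q4
          (hmem s (hsub hs)).2 (hH s (hsub hs)) hts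
        have g2 := xx_le_of_same hp hp3 q2 q4 (hmem s (hsub hs)).2 (hH s (hsub hs)) q1 q3
          (hmem t (hsub ht)).2 (hH t (hsub ht)) hts.symm
        have g := le_antisymm g1 g2
        have w1 := xx_mul (a := k t) (b := k (1 - t)) (by linarith) q1
        have w2 := xx_mul (a := k s) (b := k (1 - s)) (by linarith) q2
        rw [g, hts] at w1
        have w3 : k t + k (1 - t) = k s + k (1 - s) := by rw [← w1, ← w2]
        have w4 : k t = k s := by
          have : (k t - k s) * (k t - k (1 - s)) = 0 := by
            have : k (1 - t) = k s + k (1 - s) - k t := by linarith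
            rw [this] at hts
            linear_combination -hts
          rcases mul_eq_zero.1 this with h | h
          · linarith
          · have : k (1 - t) = k s := by linarith
            linarith
        exact hm.injOn (hsub ht) (hsub hs) w4
  have hanti := ContinuousOn.strictMonoOn_of_injOn_Icc' (by norm_num) hcont hinj
  obtain ⟨t, ht, rfl, rfl⟩ := hex a1 b1 h0.le (by linarith) ha1.le hc1
  obtain ⟨s, hs, rfl, rfl⟩ := hex a2 b2 (by linarith) hba.le (by linarith) hc2
  have hst : s < t := (hm.lt_iff_lt (hsub hs) (hsub ht)).1 ha
  rcases hanti with hmono | hanti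
  · have := hmono (⟨le_refl _, by norm_num⟩ : (1/2:ℝ) ∈ Set.Icc (1/2:ℝ) 1)
      (⟨by norm_num, le_refl _⟩ : (1:ℝ) ∈ Set.Icc (1/2:ℝ) 1) (by norm_num)
    simp only [sub_self, k0, mul_zero] at this
    have h5 := hpos (1/2) ⟨le_refl _, by norm_num⟩
    have h6 := hle (1/2) ⟨le_refl _, by norm_num⟩
    nlinarith
  · exact hanti hs ht hst

theorem En_23 {p a1 b1 a2 b2 : ℝ} (hp : 2 < p) (hp3 : p < 3) (h0 : 0 < b1) (hb : b1 < b2) (hba : b2 < a2)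
    (ha : a2 < a1) (ha1 : a1 < 1/2) (hc1 : Hc p a1 b1 = 0) (hc2 : Hc p a2 b2 = 0)
    (hE : En (p - 1) a1 b1 < 0) : En (p - 1) a2 b2 ≤ 0 := by
  have hmm := m_lt hp hp3 h0 hb hba ha ha1 hc1 hc2
  obtain ⟨x1, R1⟩ := curve_reg hp hp3 h0 (by linarith) ha1.le hc1
  obtain ⟨x2, R2⟩ := curve_reg hp hp3 (by linarith) hba.le (by linarith) hc2
  have hx1 : -0.13 ≤ xx a1 b1 := by
    by_contra h
    push Not at h
    have := En_nonneg_left hp hp3 h0 (by linarith) ha1 hc1 h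
    linarith
  set X3 := max (xx a2 b2) (-0.5) with hX3
  have hX3a : xx a2 b2 ≤ X3 := le_max_left _ _
  have hX3b : -0.5 ≤ X3 := le_max_right _ _
  have hR3 : Reg X3 (a2 * b2) := by
    rcases max_choice (xx a2 b2) (-0.5) with h | h
    · rw [hX3, h]; exact R2
    · rw [hX3, h]
      obtain ⟨g0, g1, g2, -⟩ := R2
      exact ⟨g0, by norm_num, g2, fun h => by norm_num at h, fun h => by norm_num at h, fun h => by norm_num at h⟩
  set m1 := a1 * b1 with hm1
  set m2 := a2 * b2 with hm2
  have hm1p : 0 < m1 := R1.1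
  have hm2b : m2 < 0.073 := R2.2.2.1
  set K := 1 / (X3 + 0.8) + 1.3 * m2 with hK
  have hd3 : 0 < X3 + 0.8 := by linarith
  have hK2 : K - 1.3 * m2 = 1 / (X3 + 0.8) := by rw [hK]; ring
  have hKp : 0 < K - 1.3 * m2 := by rw [hK2]; positivity
  have hfl : flX K m2 = X3 := by rw [flX, hK2, one_div_one_div]; ring
  have hflm : flX K m1 ≤ X3 := by rw [← hfl]; exact flX_mono hmm.le hKp
  have hflb : -0.6 ≤ flX K m1 := by
    have h1 : K - 1.3 * m1 ≤ 5 := by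
      have : 1 / (X3 + 0.8) ≤ 1 / 0.3 := one_div_le_one_div_of_le (by norm_num) (by linarith)
      norm_num at this
      rw [hK]; norm_num; linarith
    have : 1 / 5 ≤ 1 / (K - 1.3 * m1) := one_div_le_one_div_of_le (by linarith) h1
    unfold flX; linarith
  have ha2p : 0 < a2 := by linarith
  have hb2p : 0 < b2 := by linarith
  have ha1p : 0 < a1 := by linarith
  have hxo : xx a1 b1 ≤ flX K m1 := by
    by_contra hlt
    push Not at hlt
    have := Hc_lt (p := p) (a1 := a1) (b1 := b1) (a2 := a2) (b2 := b2) (A := flW 0.7 K m1) (B := flW 0.7 K m2) hp hp3 h0 ha1p (by linarith) (by linarith) hb2p ha2p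
      (by linarith) (by linarith) (fun t ht => by
        have s1 : vH t (xx a1 b1) m1 < vH t (flX K m1) m1 :=
          vH_anti ht hm1p R1.2.2.1 (by linarith) hlt R1.2.1
        have s2 := flow_H (t := t) ht hm1p hmm.le hKp (by rw [hfl]; exact hR3) hflb
        rw [hfl] at s2
        have s3 : vH t X3 m2 ≤ vH t (xx a2 b2) m2 := by
          rcases eq_or_lt_of_le hX3a with h | h
          · rw [← h]
          · exact (vH_anti ht R2.1 hm2b (by linarith) h hR3.2.1).le
        have w1 := flW_pos 0.7 K hm1p
        have w2 := flW_pos 0.7 K R2.1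
        calc _ < flW 0.7 K m1 * vH t (flX K m1) m1 := mul_lt_mul_of_pos_left s1 w1
          _ ≤ _ := s2
          _ ≤ _ := mul_le_mul_of_nonneg_left s3 w2.le)
    rw [hc1, hc2] at this
    linarith
  have hX2 : X3 = xx a2 b2 := by
    rcases max_choice (xx a2 b2) (-0.5) with h | h
    · exact h
    · exfalso
      have : X3 = -0.5 := h
      linarith
  rw [hX2] at hfl hR3 hflm
  set c1 := 8 * (a1 - b1) * (1 - (a1 + b1) + m1) * (1 - m1) with hc1'
  set c2 := 8 * (a2 - b2) * (1 - (a2 + b2) + m2) * (1 - m2) with hc2'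
  have c1p : 0 < c1 := by
    have h2 : 0 < 1 - m1 := by linarith [R1.2.2.1]
    have h3 : 0 < 1 - (a1 + b1) + m1 := by linarith
    have h4 : 0 < a1 - b1 := by linarith
    positivity
  have c2p : 0 < c2 := by
    have h2 : 0 < 1 - m2 := by linarith
    have h3 : 0 < 1 - (a2 + b2) + m2 := by linarith [R2.1]
    have h4 : 0 < a2 - b2 := by linarith
    positivity
  have w1 := flW_pos 3.2 K hm1p
  have w2 := flW_pos 3.2 K R2.1
  have hfin : (flW 3.2 K m2 / c2) * En (p - 1) a2 b2 ≤ (flW 3.2 K m1 / c1) * En (p - 1) a1 b1 := by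
    rw [En_sum' ha2p (by linarith) hb2p (by linarith), En_sum' ha1p (by linarith) h0 (by linarith)]
    refine stieltjes_cmp ⟨by linarith, by linarith⟩ _ _ _ _
      (fun i => (mE_pos ha2p (by linarith) hb2p (by linarith) i).le)
      (fun i => (mE_pos ha1p (by linarith) h0 (by linarith) i).le) _ _ ?_
    intro t ht
    rw [E_rep ha2p (by linarith) hb2p (by linarith) ht, E_rep ha1p (by linarith) h0 (by linarith) ht]
    rw [← hm1, ← hm2, ← hc1', ← hc2']
    have s2 := flow_E (t := t) ht hm1p hmm.le hKp (by rw [hfl]; exact hR3) (by linarith)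
    rw [hfl] at s2
    have s1 : vE t (flX K m1) m1 ≤ vE t (xx a1 b1) m1 :=
      vE_anti ht (hR3.mono hm1p hmm.le hflm) (by linarith) hxo
    have s3 := s2.trans (mul_le_mul_of_nonneg_left s1 w1.le)
    have e1 : flW 3.2 K m2 / c2 * (c2 * (t ^ 3 * vE t (xx a2 b2) m2)) = t ^ 3 * (flW 3.2 K m2 * vE t (xx a2 b2) m2) := by
      field_simp
    have e2 : flW 3.2 K m1 / c1 * (c1 * (t ^ 3 * vE t (xx a1 b1) m1)) = t ^ 3 * (flW 3.2 K m1 * vE t (xx a1 b1) m1) := by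
      field_simp
    rw [e1, e2]
    exact mul_le_mul_of_nonneg_left s3 (by positivity)
  have h1 : (flW 3.2 K m1 / c1) * En (p - 1) a1 b1 < 0 := mul_neg_of_pos_of_neg (div_pos w1 c1p) hE
  by_contra h
  push Not at h
  have := mul_pos (div_pos w2 c2p) h
  linarith

end

noncomputable def G8 (p c : ℝ) : ℝ := (1 + c) ^ p + (c - 1) ^ p - (2 * c) ^ p / 2 - 2

noncomputable def k8 (c p : ℝ) : ℝ := Real.log (1 + c) + Real.log (c - 1) * ((c - 1) / (1 + c)) ^ p
  - Real.log (2 * c) / 2 * (2 * c / (1 + c)) ^ p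

theorem G8_two (c : ℝ) : G8 2 c = 0 := by
  unfold G8
  norm_num [Real.rpow_two]
  ring

theorem G8_one (c : ℝ) : G8 1 c = c - 2 := by
  unfold G8
  simp only [Real.rpow_one]
  ring

theorem G8_deriv {c : ℝ} (hc : 1 < c) (p : ℝ) :
    HasDerivAt (fun p => G8 p c) ((1 + c) ^ p * k8 c p) p := by
  have h1 : 0 < 1 + c := by linarith
  have h2 : 0 < c - 1 := by linarith
  have h3 : 0 < 2 * c := by linarith
  have d1 := (hasDerivAt_id p).const_rpow h1
  have d2 := (hasDerivAt_id p).const_rpow h2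
  have d3 := (hasDerivAt_id p).const_rpow h3
  have d := ((d1.add d2).sub (d3.div_const 2)).sub_const 2
  refine d.congr_deriv ?_
  unfold k8
  rw [Real.div_rpow h2.le h1.le, Real.div_rpow h3.le h1.le]
  have : (1 + c) ^ p ≠ 0 := (Real.rpow_pos_of_pos h1 p).ne'
  simp only [id]
  field_simp

theorem k8_concave {c : ℝ} (hc : 1 < c) (hc2 : c < 2) : ConcaveOn ℝ Set.univ (k8 c) := by
  have h1 : 0 < 1 + c := by linarith
  have h2 : 0 < c - 1 := by linarith
  have h3 : 0 < 2 * c := by linarith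
  have l1 : Real.log (c - 1) ≤ 0 := Real.log_nonpos h2.le (by linarith)
  have l2 : 0 ≤ Real.log (2 * c) := Real.log_nonneg (by linarith)
  have e1 := (convexOn_rpow_left (div_pos h2 h1)).smul (neg_nonneg.2 l1)
  have e2 := (convexOn_rpow_left (div_pos h3 h1)).smul (by positivity : 0 ≤ Real.log (2 * c) / 2)
  have e3 := ((e1.add e2).neg.add_const (Real.log (1 + c)))
  refine e3.congr ?_
  intro p _
  simp only [k8, Pi.neg_apply, Pi.add_apply, smul_eq_mul]
  ring

theorem k8_neg {c ξ ξ' y : ℝ} (hc : 1 < c) (hc2 : c < 2) (h0 : 0 ≤ k8 c ξ) (h1 : k8 c ξ' < 0)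
    (h : ξ ≤ ξ') (hy : ξ' ≤ y) : k8 c y < 0 := by
  have := (k8_concave hc hc2).min_le_of_mem_Icc (Set.mem_univ ξ) (Set.mem_univ y) ⟨h, hy⟩
  by_contra h'
  push Not at h'
  have := le_min h0 h'
  linarith

theorem exists_k8 {c : ℝ} (hc : 1 < c) (hc2 : c < 2) {x y : ℝ} (h : x < y) :
    ∃ ξ ∈ Set.Ioo x y, (1 + c) ^ ξ * k8 c ξ = (G8 y c - G8 x c) / (y - x) :=
  exists_hasDerivAt_eq_slope (fun p => G8 p c) _ h
    (fun z _ => (G8_deriv hc z).continuousAt.continuousWithinAt) (fun z _ => G8_deriv hc z)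

theorem k8_pos0 {c : ℝ} (hc : 1 < c) (hc2 : c < 2) : ∃ ξ ∈ Set.Ioo (1:ℝ) 2, 0 < k8 c ξ := by
  obtain ⟨ξ, h, e⟩ := exists_k8 hc hc2 (show (1:ℝ) < 2 by norm_num)
  refine ⟨ξ, h, ?_⟩
  rw [G8_two, G8_one] at e
  have : 0 < (1 + c) ^ ξ * k8 c ξ := by rw [e]; norm_num; linarith
  exact (pos_iff_pos_of_mul_pos this).1 (Real.rpow_pos_of_pos (by linarith) _)

theorem G8_dec {c q : ℝ} (hc : 1 < c) (hc2 : c < 2) (hq : ∀ y, q ≤ y → k8 c y < 0) {y : ℝ} (hy : q < y) :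
    G8 y c < G8 q c := by
  obtain ⟨ξ, h, e⟩ := exists_k8 hc hc2 hy
  have : (1 + c) ^ ξ * k8 c ξ < 0 :=
    mul_neg_of_pos_of_neg (Real.rpow_pos_of_pos (by linarith) _) (hq ξ h.1.le)
  rw [e, div_lt_iff₀ (by linarith)] at this
  linarith

theorem G8_up2 {c : ℝ} (hc : 1 < c) (hc2 : c < 2) (hk : k8 c 2 < 0) {p : ℝ} (hp : 2 < p) : G8 p c < 0 := by
  obtain ⟨ξ, h, e⟩ := k8_pos0 hc hc2
  have := G8_dec hc hc2 (fun y hy => k8_neg hc hc2 e.le hk h.2.le hy) hp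
  rwa [G8_two] at this

theorem G8_up {c p1 p : ℝ} (hc : 1 < c) (hc2 : c < 2) (h2 : 2 < p1) (hp : p1 ≤ p) (hG : G8 p1 c < 0) :
    G8 p c < 0 := by
  rcases eq_or_lt_of_le hp with rfl | hp
  · exact hG
  obtain ⟨ξ, h, e⟩ := k8_pos0 hc hc2
  obtain ⟨ξ', h', e'⟩ := exists_k8 hc hc2 h2
  rw [G8_two] at e'
  have : (1 + c) ^ ξ' * k8 c ξ' < 0 := by
    rw [e']; exact div_neg_of_neg_of_pos (by linarith) (by linarith)
  have hk : k8 c ξ' < 0 := by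
    by_contra h
    push Not at h
    have := mul_nonneg (Real.rpow_nonneg (by linarith : 0 ≤ 1 + c) ξ') h
    linarith
  have := G8_dec hc hc2 (fun y hy => k8_neg hc hc2 e.le hk (by linarith [h.2, h'.1]) (by linarith [h'.2])) hp
  linarith

theorem G8_anti {p c d : ℝ} (hp : 2 ≤ p) (hc : 1 ≤ c) (hd : c ≤ d) : G8 p d ≤ G8 p c := by
  have hD : ∀ x : ℝ, 1 < x → HasDerivAt (G8 p) (p * ((1 + x) ^ (p - 1) + (x - 1) ^ (p - 1) - (2 * x) ^ (p - 1))) x := by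
    intro x hx
    have d1 := ((hasDerivAt_id x).const_add 1).rpow_const (p := p) (Or.inr (by linarith))
    have d2 := ((hasDerivAt_id x).sub_const 1).rpow_const (p := p) (Or.inr (by linarith))
    have d3 := ((hasDerivAt_id x).const_mul 2).rpow_const (p := p) (Or.inr (by linarith))
    have d := ((d1.add d2).sub (d3.div_const 2)).sub_const 2
    refine d.congr_deriv ?_
    simp only [id]
    ring
  have hA : AntitoneOn (G8 p) (Set.Ici 1) := by
    apply antitoneOn_of_deriv_nonpos (convex_Ici 1)
    · intro x hx
      have hx : (1:ℝ) ≤ x := hx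
      have : Continuous (G8 p) := by
        unfold G8
        have h0 : 0 ≤ p := by linarith
        refine ((Continuous.add ?_ ?_).sub ?_).sub continuous_const
        · exact (continuous_const.add continuous_id).rpow_const (fun _ => Or.inr h0)
        · exact (continuous_id.sub continuous_const).rpow_const (fun _ => Or.inr h0)
        · exact ((continuous_const.mul continuous_id).rpow_const (fun _ => Or.inr h0)).div_const 2
      exact this.continuousWithinAt
    · intro x hx
      rw [interior_Ici] at hx
      exact (hD x hx).differentiableAt.differentiableWithinAt
    · intro x hx
      rw [interior_Ici] at hx
      have hx : (1:ℝ) < x := hx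
      rw [(hD x hx).deriv]
      have := Real.add_rpow_le_rpow_add (p := p - 1) (a := 1 + x) (b := x - 1) (by linarith) (by linarith) (by linarith)
      rw [show 1 + x + (x - 1) = 2 * x by ring] at this
      exact mul_nonpos_of_nonneg_of_nonpos (by linarith) (by linarith)
  exact hA hc (hc.trans hd) hd

noncomputable def cc8 (p : ℝ) : ℝ := (4 - 4 * 2 ^ (-p)) ^ (1 / p)

noncomputable def X8 (p : ℝ) : ℝ := ((1 + cc8 p) / 2) ^ p + ((cc8 p - 1) / 2) ^ p - 2

theorem two_negp {p : ℝ} (hp : 2 ≤ p) : 0 < (2:ℝ) ^ (-p) ∧ (2:ℝ) ^ (-p) ≤ 1 / 4 := by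
  refine ⟨by positivity, ?_⟩
  calc (2:ℝ) ^ (-p) ≤ 2 ^ (-2:ℝ) := Real.rpow_le_rpow_of_exponent_le (by norm_num) (by linarith)
    _ = 1 / 4 := by rw [Real.rpow_neg (by norm_num)]; norm_num

theorem cc8_pow {p : ℝ} (hp : 2 ≤ p) : cc8 p ^ p = 4 - 4 * 2 ^ (-p) := by
  unfold cc8
  rw [← Real.rpow_mul (by linarith [(two_negp hp).2]), one_div_mul_cancel (by linarith), Real.rpow_one]

theorem cc8_pos {p : ℝ} (hp : 2 ≤ p) : 0 < cc8 p :=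
  Real.rpow_pos_of_pos (by linarith [(two_negp hp).2]) _

theorem cc8_gt {p : ℝ} (hp : 2 ≤ p) : 1 < cc8 p :=
  Real.one_lt_rpow (by linarith [(two_negp hp).2]) (by positivity)

theorem le_cc8 {p c : ℝ} (hp : 2 ≤ p) (hc : 0 ≤ c) (h : c ^ p + 4 * 2 ^ (-p) ≤ 4) : c ≤ cc8 p := by
  rw [← Real.rpow_le_rpow_iff hc (cc8_pos hp).le (by linarith : 0 < p), cc8_pow hp]; linarith

theorem cc8_le {p c : ℝ} (hp : 2 ≤ p) (hc : 0 ≤ c) (h : 4 ≤ c ^ p + 4 * 2 ^ (-p)) : cc8 p ≤ c := by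
  rw [← Real.rpow_le_rpow_iff (cc8_pos hp).le hc (by linarith : 0 < p), cc8_pow hp]; linarith

theorem G8_cc8 {p : ℝ} (hp : 2 ≤ p) : G8 p (cc8 p) = 2 ^ p * X8 p := by
  have h := cc8_gt hp
  unfold G8 X8
  rw [Real.mul_rpow (by norm_num) (by linarith), cc8_pow hp, Real.div_rpow (by linarith) (by norm_num),
    Real.div_rpow (by linarith) (by norm_num), Real.rpow_neg (by norm_num)]
  have : (2:ℝ) ^ p ≠ 0 := by positivity
  field_simp
  ring

theorem ccf_convex {c : ℝ} (hc : 0 < c) : ConvexOn ℝ Set.univ (fun p : ℝ => c ^ p + 4 * 2 ^ (-p)) := by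
  have h1 := convexOn_rpow_left hc
  have h2 := (convexOn_rpow_left (b := 1/2) (by norm_num)).smul (by norm_num : (0:ℝ) ≤ 4)
  refine (h1.add h2).congr ?_
  intro p _
  simp only [Pi.add_apply, smul_eq_mul]
  rw [one_div, Real.inv_rpow (by norm_num), Real.rpow_neg (by norm_num)]

theorem le_cc8_of {c p q : ℝ} (hc : 1 < c) (h3 : c ^ 2 ≤ 3) (hp : 2 ≤ p) (hpq : p ≤ q)
    (h : c ^ q + 4 * 2 ^ (-q) ≤ 4) : c ≤ cc8 p := by
  refine le_cc8 hp (by linarith) ?_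
  have := (ccf_convex (by linarith : 0 < c)).le_max_of_mem_Icc (Set.mem_univ 2) (Set.mem_univ q) ⟨hp, hpq⟩
  refine this.trans (max_le ?_ h)
  rw [Real.rpow_neg (by norm_num)]
  norm_num [Real.rpow_two]
  linarith

theorem cc8_le_of {c p q : ℝ} (hc : 1 < c) (h3 : c ^ 2 ≤ 3) (hq : 2 < q) (hpq : q ≤ p)
    (h : 4 < c ^ q + 4 * 2 ^ (-q)) : cc8 p ≤ c := by
  by_contra hlt
  push Not at hlt
  have h2 : c ^ p + 4 * 2 ^ (-p) ≤ 4 := by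
    have := Real.rpow_le_rpow (by linarith) hlt.le (by linarith : 0 ≤ p)
    rw [cc8_pow (by linarith)] at this
    linarith
  have := (ccf_convex (by linarith : 0 < c)).le_max_of_mem_Icc (Set.mem_univ 2) (Set.mem_univ p) ⟨hq.le, hpq⟩
  have h4 : c ^ (2:ℝ) + 4 * 2 ^ (-2:ℝ) ≤ 4 := by
    rw [Real.rpow_neg (by norm_num)]
    norm_num [Real.rpow_two]
    linarith
  have := this.trans (max_le h4 h2)
  linarith

theorem X8_neg_of {c p1 p2 p : ℝ} (hc : 1 < c) (h3 : c ^ 2 ≤ 3) (h2 : 2 < p1) (hp1 : p1 ≤ p) (hp2 : p ≤ p2)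
    (hG : G8 p1 c < 0) (h : c ^ p2 + 4 * 2 ^ (-p2) ≤ 4) : X8 p < 0 := by
  have hc2 : c < 2 := by nlinarith
  have k1 := le_cc8_of hc h3 (by linarith) hp2 h
  have k2 := G8_anti (p := p) (by linarith) hc.le k1
  have k3 := G8_up hc hc2 h2 hp1 hG
  rw [G8_cc8 (by linarith)] at k2
  have : 0 < (2:ℝ) ^ p := by positivity
  by_contra hx
  push Not at hx
  have := mul_nonneg this.le hx
  linarith

theorem X8_neg_of' {c p2 p : ℝ} (hc : 1 < c) (h3 : c ^ 2 ≤ 3) (h2 : 2 < p) (hp2 : p ≤ p2)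
    (hG : k8 c 2 < 0) (h : c ^ p2 + 4 * 2 ^ (-p2) ≤ 4) : X8 p < 0 := by
  have hc2 : c < 2 := by nlinarith
  have k1 := le_cc8_of hc h3 (by linarith) hp2 h
  have k2 := G8_anti (p := p) (by linarith) hc.le k1
  have k3 := G8_up2 hc hc2 hG h2
  rw [G8_cc8 (by linarith)] at k2
  have : 0 < (2:ℝ) ^ p := by positivity
  by_contra hx
  push Not at hx
  have := mul_nonneg this.le hx
  linarith

theorem X8_pos_of {c p1 p2 p : ℝ} (hc : 1 < c) (h3 : c ^ 2 ≤ 3) (h2 : 2 < p1) (hp1 : p1 ≤ p) (hp2 : p ≤ p2)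
    (hG : 0 ≤ G8 p2 c) (h : 4 < c ^ p1 + 4 * 2 ^ (-p1)) : 0 ≤ X8 p := by
  have hc2 : c < 2 := by nlinarith
  have k1 := cc8_le_of hc h3 h2 hp1 h
  have k2 := G8_anti (p := p) (by linarith) (cc8_gt (by linarith)).le k1
  have k3 : 0 ≤ G8 p c := by
    by_contra hlt
    push Not at hlt
    have := G8_up hc hc2 (by linarith) hp2 hlt
    linarith
  rw [G8_cc8 (by linarith)] at k2
  have : 0 < (2:ℝ) ^ p := by positivity
  by_contra hx
  push Not at hx
  have := mul_neg_of_pos_of_neg this hx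
  linarith

theorem pow_upG {x y k S N : ℕ} (hS : 0 < S) (hN : 0 < N) (h : x ^ k * S ^ N ≤ y ^ N * S ^ k) :
    ((x:ℝ) / S) ^ ((k:ℝ) / N) ≤ (y:ℝ) / S := by
  have h' : (x:ℝ) ^ k * S ^ N ≤ (y:ℝ) ^ N * S ^ k := by exact_mod_cast h
  have hS' : (0:ℝ) < S := by exact_mod_cast hS
  have hN' : (0:ℝ) < N := by exact_mod_cast hN
  have hx : (0:ℝ) ≤ (x:ℝ) / S := by positivity
  refine le_of_pow_le_pow_left₀ (n := N) hN.ne' (by positivity) ?_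
  rw [← Real.rpow_natCast (((x:ℝ) / S) ^ ((k:ℝ) / N)), ← Real.rpow_mul hx]
  rw [show (k:ℝ) / N * (N:ℝ) = (k:ℝ) by field_simp, Real.rpow_natCast, div_pow, div_pow,
    div_le_div_iff₀ (by positivity) (by positivity)]
  exact h'

theorem pow_dnG {x y k S N : ℕ} (hS : 0 < S) (hN : 0 < N) (h : y ^ N * S ^ k ≤ x ^ k * S ^ N) :
    (y:ℝ) / S ≤ ((x:ℝ) / S) ^ ((k:ℝ) / N) := by
  have h' : (y:ℝ) ^ N * S ^ k ≤ (x:ℝ) ^ k * S ^ N := by exact_mod_cast h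
  have hS' : (0:ℝ) < S := by exact_mod_cast hS
  have hN' : (0:ℝ) < N := by exact_mod_cast hN
  have hx : (0:ℝ) ≤ (x:ℝ) / S := by positivity
  refine le_of_pow_le_pow_left₀ (n := N) hN.ne' (by positivity) ?_
  rw [← Real.rpow_natCast (((x:ℝ) / S) ^ ((k:ℝ) / N)), ← Real.rpow_mul hx]
  rw [show (k:ℝ) / N * (N:ℝ) = (k:ℝ) by field_simp, Real.rpow_natCast, div_pow, div_pow,
    div_le_div_iff₀ (by positivity) (by positivity)]
  exact h'

def upG (S N x y k : ℕ) : Bool := decide (x ^ k * S ^ N ≤ y ^ N * S ^ k)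
def dnG (S N x y k : ℕ) : Bool := decide (y ^ N * S ^ k ≤ x ^ k * S ^ N)
theorem upG_spec {S N x y k : ℕ} (h : upG S N x y k = true) : x ^ k * S ^ N ≤ y ^ N * S ^ k :=
  of_decide_eq_true h
theorem dnG_spec {S N x y k : ℕ} (h : dnG S N x y k = true) : y ^ N * S ^ k ≤ x ^ k * S ^ N :=
  of_decide_eq_true h
def up8 (x y k : ℕ) : Bool := upG 10000000 1000 x y k
def dn8 (x y k : ℕ) : Bool := dnG 10000000 1000 x y k

theorem pow_up8 {x y k : ℕ} (h : up8 x y k = true) :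
    ((x:ℝ) / 10000000) ^ ((k:ℝ) / 1000) ≤ (y:ℝ) / 10000000 := by
  have := pow_upG (S := 10000000) (N := 1000) (by norm_num) (by norm_num) (upG_spec (by rw [up8] at h; exact h))
  simpa only [Nat.cast_ofNat] using this

theorem pow_dn8 {x y k : ℕ} (h : dn8 x y k = true) :
    (y:ℝ) / 10000000 ≤ ((x:ℝ) / 10000000) ^ ((k:ℝ) / 1000) := by
  have := pow_dnG (S := 10000000) (N := 1000) (by norm_num) (by norm_num) (dnG_spec (by rw [dn8] at h; exact h))
  simpa only [Nat.cast_ofNat] using this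

abbrev Row8 := ℕ × ℕ × ℕ × ℕ × ℕ × ℕ × ℕ


def okN (k : ℕ) (r : Row8) : Bool := match r with
  | (kc, cn, y1, y2, y3, z1, z2) =>
    decide (10000000 < cn) && decide (cn ^ 2 ≤ 3 * 10000000 ^ 2) && decide (2000 < k) &&
    up8 (cn + 10000000) y1 k && up8 (cn - 10000000) y2 k && dn8 (2 * cn) y3 k &&
    up8 (2 * cn) z1 kc && dn8 20000000 z2 kc && decide (2 * y1 + 2 * y2 < y3 + 40000000) &&
    decide (z1 + 40000000 ≤ 4 * z2)

def okP (k : ℕ) (r : Row8) : Bool := match r with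
  | (kc, cn, y1, y2, y3, z1, z2) =>
    decide (10000000 < cn) && decide (cn ^ 2 ≤ 3 * 10000000 ^ 2) && decide (2000 < kc) &&
    dn8 (cn + 10000000) y1 k && dn8 (cn - 10000000) y2 k && up8 (2 * cn) y3 k &&
    dn8 (2 * cn) z1 kc && up8 20000000 z2 kc && decide (y3 + 40000000 < 2 * y1 + 2 * y2) &&
    decide (4 * z2 < z1 + 40000000)

theorem cond8_le {c q : ℝ} (hc : 0 < c) (h : (2 * c) ^ q + 4 ≤ 4 * 2 ^ q) : c ^ q + 4 * 2 ^ (-q) ≤ 4 := by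
  rw [Real.mul_rpow (by norm_num) hc.le] at h
  rw [Real.rpow_neg (by norm_num)]
  have h2 : (0:ℝ) < 2 ^ q := by positivity
  refine le_of_mul_le_mul_left ?_ h2
  rw [mul_add, show (2:ℝ) ^ q * (4 * (2 ^ q)⁻¹) = 4 * (2 ^ q * (2 ^ q)⁻¹) by ring, mul_inv_cancel₀ h2.ne']
  linarith

theorem cond8_lt {c q : ℝ} (hc : 0 < c) (h : 4 * 2 ^ q < (2 * c) ^ q + 4) : 4 < c ^ q + 4 * 2 ^ (-q) := by
  rw [Real.mul_rpow (by norm_num) hc.le] at h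
  rw [Real.rpow_neg (by norm_num)]
  have h2 : (0:ℝ) < 2 ^ q := by positivity
  refine lt_of_mul_lt_mul_left ?_ h2.le
  rw [mul_add, show (2:ℝ) ^ q * (4 * (2 ^ q)⁻¹) = 4 * (2 ^ q * (2 ^ q)⁻¹) by ring, mul_inv_cancel₀ h2.ne']
  linarith

theorem okN_spec {k kc cn y1 y2 y3 z1 z2 : ℕ} (h : okN k (kc, cn, y1, y2, y3, z1, z2) = true) {p : ℝ}
    (hp1 : (k:ℝ) / 1000 ≤ p) (hp2 : p ≤ (kc:ℝ) / 1000) : X8 p < 0 := by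
  simp only [okN, Bool.and_eq_true, decide_eq_true_eq] at h
  obtain ⟨⟨⟨⟨⟨⟨⟨⟨⟨h1, h2⟩, h3⟩, u1⟩, u2⟩, u3⟩, u4⟩, u5⟩, e1⟩, e2⟩ := h
  have v1 := pow_up8 u1
  have v2 := pow_up8 u2
  have v3 := pow_dn8 u3
  have v4 := pow_up8 u4
  have v5 := pow_dn8 u5
  rw [Nat.cast_sub h1.le] at v2
  have e1' : 2 * (y1:ℝ) + 2 * y2 < y3 + 40000000 := by exact_mod_cast e1
  have e2' : (z1:ℝ) + 40000000 ≤ 4 * z2 := by exact_mod_cast e2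
  have h1' : (10000000:ℝ) < cn := by exact_mod_cast h1
  have h2' : (cn:ℝ) ^ 2 ≤ 3 * 10000000 ^ 2 := by exact_mod_cast h2
  have h3' : (2000:ℝ) < k := by exact_mod_cast h3
  push_cast at v1 v2 v3 v4 v5
  rw [show ((cn:ℝ) + 10000000) / 10000000 = 1 + cn / 10000000 by ring] at v1
  rw [show ((cn:ℝ) - 10000000) / 10000000 = cn / 10000000 - 1 by ring] at v2
  rw [show (2 * (cn:ℝ)) / 10000000 = 2 * (cn / 10000000) by ring] at v3 v4
  rw [show (20000000:ℝ) / 10000000 = 2 by norm_num] at v5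
  refine X8_neg_of (c := cn / 10000000) (by rw [lt_div_iff₀ (by norm_num)]; linarith)
    (by rw [div_pow, div_le_iff₀ (by norm_num)]; linarith)
    (by rw [lt_div_iff₀ (by norm_num)]; linarith) hp1 hp2 ?_ (cond8_le (by positivity) ?_)
  · unfold G8
    linarith
  · linarith

theorem okP_spec' {k kc cn y1 y2 y3 z1 z2 : ℕ} (h : okP k (kc, cn, y1, y2, y3, z1, z2) = true) :
   ∃ c : ℝ, 1 < c ∧ c ^ 2 ≤ 3 ∧ (2:ℝ) < (kc:ℝ) / 1000 ∧ 0 < G8 ((k:ℝ) / 1000) c ∧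
    4 < c ^ ((kc:ℝ) / 1000) + 4 * 2 ^ (-((kc:ℝ) / 1000)) := by
  simp only [okP, Bool.and_eq_true, decide_eq_true_eq] at h
  obtain ⟨⟨⟨⟨⟨⟨⟨⟨⟨h1, h2⟩, h3⟩, u1⟩, u2⟩, u3⟩, u4⟩, u5⟩, e1⟩, e2⟩ := h
  have v1 := pow_dn8 u1
  have v2 := pow_dn8 u2
  have v3 := pow_up8 u3
  have v4 := pow_dn8 u4
  have v5 := pow_up8 u5
  rw [Nat.cast_sub h1.le] at v2
  have e1' : (y3:ℝ) + 40000000 < 2 * (y1:ℝ) + 2 * y2 := by exact_mod_cast e1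
  have e2' : 4 * (z2:ℝ) < (z1:ℝ) + 40000000 := by exact_mod_cast e2
  have h1' : (10000000:ℝ) < cn := by exact_mod_cast h1
  have h2' : (cn:ℝ) ^ 2 ≤ 3 * 10000000 ^ 2 := by exact_mod_cast h2
  have h3' : (2000:ℝ) < kc := by exact_mod_cast h3
  push_cast at v1 v2 v3 v4 v5
  rw [show ((cn:ℝ) + 10000000) / 10000000 = 1 + cn / 10000000 by ring] at v1
  rw [show ((cn:ℝ) - 10000000) / 10000000 = cn / 10000000 - 1 by ring] at v2
  rw [show (2 * (cn:ℝ)) / 10000000 = 2 * (cn / 10000000) by ring] at v3 v4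
  rw [show (20000000:ℝ) / 10000000 = 2 by norm_num] at v5
  refine ⟨cn / 10000000, by rw [lt_div_iff₀ (by norm_num)]; linarith,
    by rw [div_pow, div_le_iff₀ (by norm_num)]; linarith,
    by rw [lt_div_iff₀ (by norm_num)]; linarith, ?_, cond8_lt (by positivity) ?_⟩
  · unfold G8
    linarith
  · linarith

def chN (k : ℕ) : List Row8 → Bool
  | [] => decide (k = 2560)
  | r :: l => okN k r && chN r.1 l

def chP (k : ℕ) : List Row8 → Bool
  | [] => decide (k = 2580)
  | r :: l => okP k r && chP r.1 l

theorem chN_spec {p : ℝ} (hp : p ≤ 2.56) : ∀ (l : List Row8) (k : ℕ), chN k l = true → (k:ℝ) / 1000 < p → X8 p < 0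
  | [], k, h, hk => by
    simp only [chN, decide_eq_true_eq] at h
    rw [h] at hk
    norm_num at hk hp
    linarith
  | (kc, cn, y1, y2, y3, z1, z2) :: l, k, h, hk => by
    simp only [chN, Bool.and_eq_true] at h
    rcases le_or_gt p ((kc:ℝ) / 1000) with h' | h'
    · exact okN_spec h.1 hk.le h'
    · exact chN_spec hp l kc h.2 h'

theorem chP_spec {p : ℝ} (hp : 2.58 ≤ p) : ∀ (l : List Row8) (k : ℕ), chP k l = true → p ≤ (k:ℝ) / 1000 → 0 ≤ X8 p
  | [], k, h, hk => by
    simp only [chP, decide_eq_true_eq] at h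
    rw [h] at hk
    norm_num at hk hp
    have : p = 2.58 := by norm_num; linarith
    obtain ⟨c, h1, h2, h3, h4, h5⟩ := okP_spec' (k := 2580) (kc := 2580) (cn := 15942369) (y1 := 116988951) (y2 := 2611052) (y3 := 199179099) (z1 := 199179096) (z2 := 59793971)
      (by decide +kernel)
    exact X8_pos_of h1 h2 h3 (by norm_num; linarith) (by norm_num; linarith) h4.le h5
  | (kc, cn, y1, y2, y3, z1, z2) :: l, k, h, hk => by
    simp only [chP, Bool.and_eq_true] at h
    rcases lt_or_ge p ((kc:ℝ) / 1000) with h' | h'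
    · exact chP_spec hp l kc h.2 h'.le
    · obtain ⟨c, h1, h2, h3, h4, h5⟩ := okP_spec' h.1
      exact X8_pos_of h1 h2 h3 h' hk h4.le h5

def tabN : List Row8 := [(2205, 16783745, 79164367, 4426762, 127183162, 144427904, 46107452),
  (2286, 16587137, 86377539, 3983147, 140723667, 155078670, 48770202),
  (2349, 16440066, 92319228, 3656987, 151953286, 163786054, 50947098),
  (2397, 16331354, 97205656, 3417556, 161253291, 170680183, 52670675),
  (2435, 16247294, 101052169, 3237977, 168581940, 176303070, 54076432),
  (2464, 16184312, 104215004, 3103093, 174643536, 180694996, 55174435),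
  (2487, 16135068, 106669201, 3000455, 179343300, 184241552, 56061096),
  (2505, 16096960, 108657357, 2921306, 183161245, 187056810, 56764933),
  (2519, 16067580, 110238247, 2860580, 186202739, 189270879, 57318465),
  (2530, 16044654, 111479533, 2813681, 188591330, 191025653, 57757166),
  (2539, 16025998, 112455502, 2776346, 190464196, 192471332, 58118600),
  (2546, 16011552, 113267980, 2746928, 192031129, 193602020, 58401279),
  (2551, 16001268, 113913730, 2725254, 193285585, 194413041, 58604033),
  (2555, 15993060, 114367139, 2708831, 194158739, 195063851, 58766744),
  (2558, 15986916, 114735648, 2696214, 194872441, 195553150, 58889073),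
  (2560, 15982826, 115018521, 2687366, 195425198, 195879928, 58970767)]

def tabP : List Row8 := [(2917, 15319840, 162324049, 1505550, 287642250, 262114522, 75527395),
  (2849, 15436503, 152306783, 1690157, 267979581, 248204890, 72050080),
  (2794, 15534023, 144504950, 1853204, 252698356, 237424288, 69355007),
  (2749, 15615991, 138477808, 1994789, 240941236, 228904404, 67225102),
  (2713, 15683020, 133695594, 2115134, 231615541, 222277315, 65568370),
  (2684, 15737976, 129983528, 2215706, 224396815, 217057749, 64263521),
  (2661, 15782184, 127052168, 2298552, 218698102, 212992090, 63247131),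
  (2643, 15817170, 124763880, 2365362, 214250829, 209855158, 62462921),
  (2629, 15844620, 122996939, 2418447, 210819099, 207442234, 61859708),
  (2618, 15866336, 121641029, 2460574, 208190528, 205562735, 61389845),
  (2609, 15884201, 120593807, 2494834, 206169245, 204035584, 61008068),
  (2602, 15898157, 119734264, 2522311, 204503627, 202854371, 60712772),
  (2596, 15910162, 119082863, 2545079, 203253188, 201846457, 60460799),
  (2592, 15918187, 118499791, 2562132, 202110866, 201176831, 60293398),
  (2588, 15926230, 118144209, 2576568, 201440414, 200509072, 60126461),
  (2585, 15932274, 117765877, 2588786, 200706063, 200009472, 60001561),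
  (2583, 15936308, 117476926, 2597405, 200140410, 199676954, 59918439),
  (2581, 15940347, 117300385, 2604688, 199807702, 199344915, 59835432),
  (2580, 15942369, 117100529, 2609694, 199410189, 199179096, 59793971)]

theorem ck_N8 : chN 2100 tabN = true := by decide +kernel
theorem ck_P8 : chP 3000 tabP = true := by decide +kernel

theorem X8_257 : X8 2.57 < 0 := by
  refine okN_spec (k := 2570) (kc := 2570) (cn := 15962442) (y1 := 116109577) (y2 := 2647527) (y3 := 197520588) (z1 := 197520591) (z2 := 59380941)
    (by decide +kernel) ?_ ?_ <;> norm_num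

theorem X8_258 : 0 < X8 2.58 := by
  obtain ⟨c, h1, h2, h3, h4, h5⟩ := okP_spec' (k := 2580) (kc := 2580) (cn := 15942369) (y1 := 116988951) (y2 := 2611052) (y3 := 199179099) (z1 := 199179096) (z2 := 59793971)
    (by decide +kernel)
  have e : ((2580:ℕ):ℝ) / 1000 = 2.58 := by norm_num
  rw [e] at h3 h4 h5
  have k1 := cc8_le_of h1 h2 h3 le_rfl h5
  have k2 := G8_anti (p := 2.58) (by norm_num) (cc8_gt (by norm_num)).le k1
  rw [G8_cc8 (by norm_num)] at k2
  exact (pos_iff_pos_of_mul_pos (h4.trans_le k2)).1 (by positivity)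

theorem log_le8 {x : ℝ} (hx : 0 < x) {m n : ℕ} (hn : 0 < n) (h : x ^ n ≤ 2 ^ m) :
    Real.log x ≤ (m / n : ℝ) * Real.log 2 := by
  have h1 := Real.log_le_log (by positivity) h
  rw [Real.log_pow, Real.log_pow] at h1
  have : (0:ℝ) < n := by exact_mod_cast hn
  rw [div_mul_eq_mul_div, le_div_iff₀ this]
  linarith

theorem le_log8 {x : ℝ} (hx : 0 < x) {m n : ℕ} (hn : 0 < n) (h : 2 ^ m ≤ x ^ n) :
    (m / n : ℝ) * Real.log 2 ≤ Real.log x := by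
  have h1 := Real.log_le_log (by positivity) h
  rw [Real.log_pow, Real.log_pow] at h1
  have : (0:ℝ) < n := by exact_mod_cast hn
  rw [div_mul_eq_mul_div, div_le_iff₀ this]
  linarith

theorem X8_first {p : ℝ} (h2 : 2 < p) (hp : p ≤ 2.1) : X8 p < 0 := by
  refine X8_neg_of' (c := 1.7051) (p2 := 2.1) (by norm_num) (by norm_num) h2 hp ?_ (cond8_le (by norm_num) ?_)
  · unfold k8
    have l1 := log_le8 (x := 2.7051) (m := 56) (n := 39) (by norm_num) (by norm_num) (by norm_num)
    have l2 := le_log8 (x := 3.4102) (m := 23) (n := 13) (by norm_num) (by norm_num) (by norm_num)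
    have l3 : Real.log 0.7051 ≤ -(1/2) * Real.log 2 := by
      have := Real.log_le_log (x := 0.7051 ^ 2) (y := 2⁻¹) (by norm_num) (by norm_num)
      rw [Real.log_pow, Real.log_inv] at this
      push_cast at this; linarith
    have h0 : 0 < Real.log 2 := Real.log_pos (by norm_num)
    rw [Real.rpow_two, Real.rpow_two]
    norm_num at l1 l2 l3 ⊢
    nlinarith
  · have v4 := pow_up8 (x := 34102000) (y := 131473338) (k := 2100) (by decide +kernel)
    have v5 := pow_dn8 (x := 20000000) (y := 42870937) (k := 2100) (by decide +kernel)
    norm_num at v4 v5 ⊢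
    linarith

theorem X8_neg {p : ℝ} (h2 : 2 < p) (hp : p ≤ 2.56) : X8 p < 0 := by
  rcases le_or_gt p 2.1 with h | h
  · exact X8_first h2 h
  · exact chN_spec hp _ _ ck_N8 (by norm_num at h ⊢; linarith)

theorem X8_pos {p : ℝ} (h2 : 2.58 ≤ p) (hp : p ≤ 3) : 0 ≤ X8 p :=
  chP_spec h2 _ _ ck_P8 (by norm_num; linarith)

theorem cc8_deriv {p : ℝ} (hp : 2 ≤ p) : HasDerivAt cc8
    (-(cc8 p / p) * (Real.log (cc8 p) - Real.log 2 * 2 ^ (-p) / (1 - 2 ^ (-p)))) p := by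
  obtain ⟨q0, q1⟩ := two_negp hp
  have hf : 0 < 4 - 4 * (2:ℝ) ^ (-p) := by linarith
  have hp0 : p ≠ 0 := by linarith
  have d1 := (((hasDerivAt_id p).neg.const_rpow (a := 2) (by norm_num)).const_mul 4).const_sub 4
  have d2 : HasDerivAt (fun p : ℝ => 1 / p) (-(1 / p ^ 2)) p := by
    have := hasDerivAt_inv hp0
    simpa [one_div] using this
  have d := HasDerivAt.rpow d1 d2 hf
  refine d.congr_deriv ?_
  have hl : Real.log (cc8 p) = 1 / p * Real.log (4 - 4 * 2 ^ (-p)) := by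
    unfold cc8; rw [Real.log_rpow hf]
  rw [hl]
  have e : (4 - 4 * (2:ℝ) ^ (-p)) ^ (1 / p - 1) = cc8 p / (4 - 4 * 2 ^ (-p)) := by
    unfold cc8; rw [Real.rpow_sub_one hf.ne']
  simp only [id, Pi.neg_apply]
  rw [e]
  rw [show (4 - 4 * (2:ℝ) ^ (-p)) ^ (1 / p) = cc8 p from rfl]
  have h1 : (1 - (2:ℝ) ^ (-p)) ≠ 0 := by linarith
  have h4 : 4 - 4 * (2:ℝ) ^ (-p) = 4 * (1 - 2 ^ (-p)) := by ring
  rw [h4]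
  generalize (2:ℝ) ^ (-p) = q at *
  generalize Real.log (4 * (1 - q)) = l
  field_simp
  ring

theorem X8_deriv {p : ℝ} (hp : 2 ≤ p) : HasDerivAt X8
    (((1 + cc8 p) / 2) ^ p * Real.log ((1 + cc8 p) / 2) + ((cc8 p - 1) / 2) ^ p * Real.log ((cc8 p - 1) / 2)
      - cc8 p / 2 * (((1 + cc8 p) / 2) ^ (p - 1) + ((cc8 p - 1) / 2) ^ (p - 1)) *
       (Real.log (cc8 p) - Real.log 2 * 2 ^ (-p) / (1 - 2 ^ (-p)))) p := by
  have d := cc8_deriv hp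
  have hc := cc8_gt hp
  have d1 := HasDerivAt.rpow ((d.const_add 1).div_const 2) (hasDerivAt_id p) (by linarith)
  have d2 := HasDerivAt.rpow ((d.sub_const 1).div_const 2) (hasDerivAt_id p) (by linarith)
  have d3 := (d1.add d2).sub_const 2
  refine d3.congr_deriv ?_
  have hp0 : p ≠ 0 := by linarith
  simp only [id]
  generalize (Real.log (cc8 p) - Real.log 2 * 2 ^ (-p) / (1 - 2 ^ (-p))) = κ
  field_simp
  ring

theorem X8_deriv_pos {p : ℝ} (h1 : 2.56 ≤ p) (h2 : p ≤ 2.58) : 0 <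
    (((1 + cc8 p) / 2) ^ p * Real.log ((1 + cc8 p) / 2) + ((cc8 p - 1) / 2) ^ p * Real.log ((cc8 p - 1) / 2)
      - cc8 p / 2 * (((1 + cc8 p) / 2) ^ (p - 1) + ((cc8 p - 1) / 2) ^ (p - 1)) *
       (Real.log (cc8 p) - Real.log 2 * 2 ^ (-p) / (1 - 2 ^ (-p)))) := by
  have hp : 2 ≤ p := by norm_num at h1; linarith
  obtain ⟨q0, q1⟩ := two_negp hp
  have hL : 0 < Real.log 2 := Real.log_pos (by norm_num)
  have c1 : 1.594 ≤ cc8 p := by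
    refine le_cc8_of (q := 2.58) (by norm_num) (by norm_num) hp h2 (cond8_le (by norm_num) ?_)
    have v4 := pow_up8 (x := 31880000) (y := 199145000) (k := 2580) (by decide +kernel)
    have v5 := pow_dn8 (x := 20000000) (y := 59790000) (k := 2580) (by decide +kernel)
    norm_num at v4 v5 ⊢
    linarith
  have c2 : cc8 p ≤ 1.599 := by
    refine cc8_le_of (q := 2.56) (by norm_num) (by norm_num) (by norm_num) h1 (cond8_lt (by norm_num) ?_)
    have v4 := pow_dn8 (x := 31980000) (y := 196000000) (k := 2560) (by decide +kernel)
    have v5 := pow_up8 (x := 20000000) (y := 58980000) (k := 2560) (by decide +kernel)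
    norm_num at v4 v5 ⊢
    linarith
  set c := cc8 p
  set q := (2:ℝ) ^ (-p)
  have b1 : 1.297 ≤ (1 + c) / 2 := by norm_num at c1 ⊢; linarith
  have b2 : (1 + c) / 2 ≤ 1.2995 := by norm_num at c2 ⊢; linarith
  have b3 : 0.297 ≤ (c - 1) / 2 := by norm_num at c1 ⊢; linarith
  have b4 : (c - 1) / 2 ≤ 0.2995 := by norm_num at c2 ⊢; linarith
  have hh1 : (256/100:ℝ) ≤ p := by norm_num at h1 ⊢; linarith
  have hh2 : p ≤ (258/100:ℝ) := by norm_num at h2 ⊢; linarith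
  set x := (1 + c) / 2
  set y := (c - 1) / 2
  have hx0 : 0 < x := by norm_num at b1; linarith
  have hx1 : 1 ≤ x := by norm_num at b1; linarith
  have hy0 : 0 < y := by norm_num at b3; linarith
  have hy1 : y ≤ 1 := by norm_num at b4; linarith
  have e1 : 1.9459 ≤ x ^ p := by
    have v := pow_dn8 (x := 12970000) (y := 19459000) (k := 2560) (by decide +kernel)
    norm_num at v
    calc (1.9459:ℝ) = 19459/10000 := by norm_num
      _ ≤ (1297/1000:ℝ) ^ (64/25:ℝ) := v
      _ ≤ x ^ (64/25:ℝ) := Real.rpow_le_rpow (by norm_num) (by norm_num at b1 ⊢; linarith) (by norm_num)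
      _ ≤ x ^ p := Real.rpow_le_rpow_of_exponent_le hx1 (by norm_num at hh1 ⊢; linarith)
  have e2 : y ^ p ≤ 0.0457 := by
    have v := pow_up8 (x := 2995000) (y := 457000) (k := 2560) (by decide +kernel)
    norm_num at v
    calc y ^ p ≤ y ^ (64/25:ℝ) := Real.rpow_le_rpow_of_exponent_ge hy0 hy1 (by norm_num at hh1 ⊢; linarith)
      _ ≤ (599/2000:ℝ) ^ (64/25:ℝ) := Real.rpow_le_rpow hy0.le (by norm_num at b4 ⊢; linarith) (by norm_num)
      _ ≤ _ := v
      _ = _ := by norm_num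
  have e3 : x ^ (p - 1) ≤ 1.5128 := by
    have v := pow_up8 (x := 12995000) (y := 15128000) (k := 1580) (by decide +kernel)
    norm_num at v
    calc x ^ (p - 1) ≤ x ^ (79/50:ℝ) := Real.rpow_le_rpow_of_exponent_le hx1 (by norm_num at hh2 ⊢; linarith)
      _ ≤ (2599/2000:ℝ) ^ (79/50:ℝ) := Real.rpow_le_rpow hx0.le (by norm_num at b2 ⊢; linarith) (by norm_num)
      _ ≤ _ := v
      _ = _ := by norm_num
  have e4 : y ^ (p - 1) ≤ 0.1525 := by
    have v := pow_up8 (x := 2995000) (y := 1525000) (k := 1560) (by decide +kernel)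
    norm_num at v
    calc y ^ (p - 1) ≤ y ^ (39/25:ℝ) := Real.rpow_le_rpow_of_exponent_ge hy0 hy1 (by norm_num at hh1 ⊢; linarith)
      _ ≤ (599/2000:ℝ) ^ (39/25:ℝ) := Real.rpow_le_rpow hy0.le (by norm_num at b4 ⊢; linarith) (by norm_num)
      _ ≤ _ := v
      _ = _ := by norm_num
  have e5 : 0.1672 ≤ q := by
    have v := pow_up8 (x := 20000000) (y := 59808000) (k := 2580) (by decide +kernel)
    norm_num at v
    have h3 : (2:ℝ) ^ p ≤ 3738/625 :=
      (Real.rpow_le_rpow_of_exponent_le (by norm_num) (by norm_num at hh2 ⊢; linarith)).trans v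
    have : q = ((2:ℝ) ^ p)⁻¹ := Real.rpow_neg (by norm_num) p
    rw [this]
    calc (0.1672:ℝ) ≤ (3738/625:ℝ)⁻¹ := by norm_num
      _ ≤ _ := inv_anti₀ (by positivity) h3
  have l1 : (3/8) * Real.log 2 ≤ Real.log x := by
    have := le_log8 (x := x) (m := 3) (n := 8) hx0 (by norm_num) (by
      calc (2:ℝ) ^ 3 ≤ 1.297 ^ 8 := by norm_num
        _ ≤ x ^ 8 := pow_le_pow_left₀ (by norm_num) b1 8)
    exact_mod_cast this
  have l2 : -(1.76 * Real.log 2) ≤ Real.log y := by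
    have := log_le8 (x := y⁻¹) (m := 44) (n := 25) (by positivity) (by norm_num) (by
      calc y⁻¹ ^ 25 ≤ ((0.297:ℝ)⁻¹) ^ 25 := pow_le_pow_left₀ (by positivity) (inv_anti₀ (by norm_num) b3) 25
        _ ≤ _ := by norm_num)
    rw [Real.log_inv] at this
    norm_num at this ⊢
    linarith
  have l3 : Real.log c ≤ (21/31) * Real.log 2 := by
    have hc0 : 0 < c := by norm_num at c1; linarith
    have := log_le8 (x := c) (m := 21) (n := 31) hc0 (by norm_num) (by
      calc c ^ 31 ≤ 1.599 ^ 31 := pow_le_pow_left₀ hc0.le c2 31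
        _ ≤ _ := by norm_num)
    exact_mod_cast this
  have l4 : 0.2007 * Real.log 2 ≤ Real.log 2 * q / (1 - q) := by
    rw [le_div_iff₀ (by linarith)]
    norm_num at e5 ⊢
    nlinarith
  have m1 : 1.9459 * ((3/8) * Real.log 2) ≤ x ^ p * Real.log x :=
    mul_le_mul e1 l1 (by positivity) (by positivity)
  have hyp : 0 ≤ y ^ p := Real.rpow_nonneg hy0.le _
  have m2 : -(0.0457 * (1.76 * Real.log 2)) ≤ y ^ p * Real.log y := by
    have : y ^ p * (1.76 * Real.log 2) ≤ 0.0457 * (1.76 * Real.log 2) :=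
      mul_le_mul_of_nonneg_right e2 (by positivity)
    have := mul_le_mul_of_nonneg_left l2 hyp
    linarith
  have m3 : c / 2 * (x ^ (p - 1) + y ^ (p - 1)) ≤ (1.599 / 2) * (1.5128 + 0.1525) :=
    mul_le_mul (by linarith) (by linarith) (by positivity) (by norm_num)
  have m4 : Real.log c - Real.log 2 * q / (1 - q) ≤ 0.47675 * Real.log 2 := by
    norm_num at l4 l3 ⊢
    linarith
  have hc0 : 0 ≤ c / 2 * (x ^ (p - 1) + y ^ (p - 1)) := by
    have : 0 < c := by norm_num at c1; linarith
    positivity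
  have m5 : c / 2 * (x ^ (p - 1) + y ^ (p - 1)) * (Real.log c - Real.log 2 * q / (1 - q)) ≤
     (1.599 / 2) * (1.5128 + 0.1525) * (0.47675 * Real.log 2) :=
    (mul_le_mul_of_nonneg_left m4 hc0).trans (mul_le_mul_of_nonneg_right m3 (by positivity))
  norm_num at m1 m2 m5 ⊢
  linarith

theorem X8_mono : StrictMonoOn X8 (Set.Icc 2.56 2.58) := by
  have h2 : ∀ p ∈ Set.Icc (2.56:ℝ) 2.58, (2:ℝ) ≤ p := fun p hp => by
    have := hp.1; norm_num at this; linarith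
  apply strictMonoOn_of_deriv_pos (convex_Icc _ _)
  · exact fun p hp => (X8_deriv (h2 p hp)).continuousAt.continuousWithinAt
  · intro p hp
    have hp' := interior_subset hp
    rw [(X8_deriv (h2 p hp')).deriv]
    exact X8_deriv_pos hp'.1 hp'.2

theorem exists_p0 : ∃ p₀ : ℝ, 2.57 < p₀ ∧ p₀ < 2.58 ∧ (∀ p, 2 < p → p ≤ p₀ → X8 p ≤ 0) ∧
    (∀ p, p₀ ≤ p → p ≤ 3 → 0 ≤ X8 p) := by
  have hcont : ContinuousOn X8 (Set.Icc 2.57 2.58) := fun p hp =>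
    (X8_deriv (by have := hp.1; norm_num at this; linarith)).continuousAt.continuousWithinAt
  obtain ⟨p0, hp, h0⟩ := intermediate_value_Icc (by norm_num) hcont ⟨X8_257.le, X8_258.le⟩
  have hpm : p0 ∈ Set.Icc (2.56:ℝ) 2.58 := ⟨le_trans (by norm_num) hp.1, hp.2⟩
  refine ⟨p0, lt_of_le_of_ne hp.1 ?_, lt_of_le_of_ne hp.2 ?_, ?_, ?_⟩
  · rintro rfl; linarith [X8_257]
  · rintro rfl; linarith [X8_258]
  · intro p h1 h2
    rcases le_or_gt p 2.56 with h | h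
    · exact (X8_neg h1 h).le
    · rw [← h0]
      exact X8_mono.monotoneOn ⟨h.le, h2.trans hp.2⟩ hpm h2
  · intro p h1 h2
    rcases le_or_gt p 2.58 with h | h
    · rw [← h0]
      exact X8_mono.monotoneOn hpm ⟨hpm.1.trans h1, h⟩ h1
    · exact X8_pos h.le h2

theorem Hc_tau {p τ : ℝ} (hp : 1 < p) (h0 : 0 ≤ τ) (h1 : τ < 1) (h : 2 * (1 - τ) ^ p = 1 + τ ^ p) :
    Hc p τ τ = 0 := by
  unfold Hc
  rw [Real.mul_rpow h0 h0, Real.mul_rpow h0 (by linarith)]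
  have : (1 - τ) ^ p = (1 + τ ^ p) / 2 := by linarith
  rw [this]; ring

theorem tau_le {p τ : ℝ} (hp : 1 < p) (h0 : 0 ≤ τ) (h1 : τ < 1) (h : 2 * (1 - τ) ^ p = 1 + τ ^ p) :
    τ ≤ 1/2 := by
  have hc := (Hc_zero_iff hp h0 h1 h0 h1).1 (Hc_tau hp h0 h1 h)
  by_contra hlt
  push Not at hlt
  have := hf_strictMono hp (⟨by norm_num, by norm_num⟩ : (1/2:ℝ) ∈ Set.Ico (0:ℝ) 1) ⟨h0, h1⟩ hlt
  rw [hf_half hp] at this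
  linarith

theorem lnG_tau {p τ : ℝ} (hp : 1 < p) (h0 : 0 ≤ τ) (h1 : τ < 1) (h : 2 * (1 - τ) ^ p = 1 + τ ^ p) :
    lnG p τ τ = Real.log (((1 + τ) / (1 - τ)) ^ p / 4) := by
  have hA := rpow_lt_one_aux hp h0 h1
  have hA0 : 0 ≤ τ ^ p := Real.rpow_nonneg h0 p
  have h1' : 0 < 1 - τ := by linarith
  unfold lnG
  rw [show 1 - τ * τ = (1 + τ) * (1 - τ) by ring, show 1 - τ ^ p * τ ^ p = (1 - τ ^ p) * (1 + τ ^ p) by ring,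
    Real.log_mul (by linarith) (by linarith), Real.log_mul (by linarith) (by linarith), ← h,
    Real.log_mul (by norm_num) (Real.rpow_pos_of_pos h1' p).ne', Real.log_rpow h1',
    Real.log_div (Real.rpow_pos_of_pos (by positivity) p).ne' (by norm_num), Real.log_rpow (by positivity),
    Real.log_div (by linarith) (by linarith), show (4:ℝ) = 2 ^ 2 by norm_num, Real.log_pow]
  push_cast
  ring

theorem lnG_end {p : ℝ} (hp : 1 < p) : lnG p (1/2) 0 = Real.log (1 - 2 ^ (-p)) := by
  unfold lnG
  rw [Real.zero_rpow (by linarith), Real.rpow_neg (by norm_num), one_div, Real.inv_rpow (by norm_num)]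
  simp

theorem end_mid {p τ : ℝ} (hp : 2 ≤ p) (h0 : 0 ≤ τ) (h1 : τ < 1) (h : 2 * (1 - τ) ^ p = 1 + τ ^ p) :
    (X8 p ≤ 0 → lnG p (1/2) 0 ≤ lnG p τ τ) ∧ (0 ≤ X8 p → lnG p τ τ ≤ lnG p (1/2) 0) := by
  have h1' : 0 < 1 - τ := by linarith
  obtain ⟨q0, q1⟩ := two_negp hp
  have hp0 : 0 < p := by linarith
  rw [lnG_tau (by linarith) h0 h1 h, lnG_end (by linarith)]
  set C := (1 + τ) / (1 - τ) with hC
  have hC1 : 1 ≤ C := by rw [hC, le_div_iff₀ h1']; linarith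
  have e1 : (1 + C) / 2 = 1 / (1 - τ) := by rw [hC]; field_simp; ring
  have e2 : (C - 1) / 2 = τ / (1 - τ) := by rw [hC]; field_simp; ring
  have eC : ((1 + C) / 2) ^ p + ((C - 1) / 2) ^ p = 2 := by
    rw [e1, e2, Real.div_rpow (by norm_num) h1'.le, Real.div_rpow h0 h1'.le, Real.one_rpow, ← add_div, ← h,
      mul_div_assoc, div_self (Real.rpow_pos_of_pos h1' p).ne', mul_one]
  have hcc := cc8_gt hp
  have hmono : ∀ x y : ℝ, 1 ≤ x → x < y → ((1 + x) / 2) ^ p + ((x - 1) / 2) ^ p <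
      ((1 + y) / 2) ^ p + ((y - 1) / 2) ^ p := by
    intro x y hx hy
    exact add_lt_add (Real.rpow_lt_rpow (by linarith) (by linarith) hp0)
      (Real.rpow_lt_rpow (by linarith) (by linarith) hp0)
  have hCp : 0 < C ^ p := by positivity
  refine ⟨fun hX => ?_, fun hX => ?_⟩
  · have : cc8 p ≤ C := by
      by_contra hlt
      push Not at hlt
      have := hmono _ _ hC1 hlt
      unfold X8 at hX; linarith
    have := Real.rpow_le_rpow (by linarith) this hp0.le
    rw [cc8_pow hp] at this
    exact Real.log_le_log (by linarith) (by linarith)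
  · have : C ≤ cc8 p := by
      by_contra hlt
      push Not at hlt
      have := hmono _ _ hcc.le hlt
      unfold X8 at hX; linarith
    have := Real.rpow_le_rpow (by linarith) this hp0.le
    rw [cc8_pow hp] at this
    exact Real.log_le_log (by linarith) (by linarith)

theorem X8_two : X8 2 = 0 := by
  have := G8_cc8 (p := 2) le_rfl
  rw [G8_two] at this
  norm_num at this
  exact this

/-- The analytic core. -/
theorem core : ∃ p₀ : ℝ, 2.57 < p₀ ∧ p₀ < 2.58 ∧ ∀ p τ : ℝ, 0 ≤ τ → τ < 1 → 2 * (1 - τ) ^ p = 1 + τ ^ p →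
    (((1 < p ∧ p ≤ 2) ∨ p₀ ≤ p) → ∀ a b, 0 ≤ b → b ≤ a → a ≤ 1/2 → Hc p a b = 0 → lnG p τ τ ≤ lnG p a b) ∧
    ((2 ≤ p ∧ p ≤ p₀) → ∀ a b, 0 ≤ b → b ≤ a → a ≤ 1/2 → Hc p a b = 0 → lnG p (1/2) 0 ≤ lnG p a b) := by
  obtain ⟨p₀, h1, h2, hneg, hpos⟩ := exists_p0
  have h1' : (2.5:ℝ) < p₀ := lt_trans (by norm_num) h1
  have h2' : p₀ < (2.6:ℝ) := lt_trans h2 (by norm_num)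
  norm_num at h1' h2'
  refine ⟨p₀, h1, h2, fun p τ t0 t1 ht => ?_⟩
  have mid : 1 < p → (p ≤ 2 ∨ 3 ≤ p) → ∀ a b, 0 ≤ b → b ≤ a → a ≤ 1/2 → Hc p a b = 0 →
      lnG p τ τ ≤ lnG p a b := by
    intro hp hp2 a b hb hba ha hc
    refine mid_of_path hp ?_ hb hba ha hc t0 (tau_le hp t0 t1 ht) (Hc_tau hp t0 t1 ht)
    intro a b hb hba ha hc
    rcases hp2 with hp2 | hp2
    · rcases eq_or_lt_of_le hp2 with rfl | hp2
      · rw [show (2:ℝ) - 1 = 1 by norm_num, En_one]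
      · exact En_low hp hp2 hb hba ha hc
    · rcases lt_or_ge p 4 with h4 | h4
      · exact En_mid hp2 h4 hb hba ha hc
      · exact En_high h4 hb hba ha hc
  have mn : 2 < p → p < 3 → ∀ a b, 0 ≤ b → b ≤ a → a ≤ 1/2 → Hc p a b = 0 →
      lnG p τ τ ≤ lnG p a b ∨ lnG p (1/2) 0 ≤ lnG p a b := by
    intro hp hp3 a b hb hba ha hc
    have hp1 : 1 < p := by linarith
    exact min_of_path hp1 (fun a1 b1 a2 b2 => En_23 hp hp3) hb hba ha hc t0 (tau_le hp1 t0 t1 ht)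
      (Hc_tau hp1 t0 t1 ht)
  constructor
  · intro hp a b hb hba ha hc
    rcases hp with hp | hp
    · exact mid hp.1 (Or.inl hp.2) a b hb hba ha hc
    · rcases lt_or_ge p 3 with h3 | h3
      · rcases mn (by linarith) h3 a b hb hba ha hc with h | h
        · exact h
        · exact ((end_mid (by linarith) t0 t1 ht).2 (hpos p hp h3.le)).trans h
      · exact mid (by linarith) (Or.inr h3) a b hb hba ha hc
  · intro hp a b hb hba ha hc
    rcases eq_or_lt_of_le hp.1 with rfl | h2
    · exact ((end_mid le_rfl t0 t1 ht).1 X8_two.le).trans (mid (by norm_num) (Or.inl le_rfl) a b hb hba ha hc)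
    · rcases mn h2 (by linarith) a b hb hba ha hc with h | h
      · exact ((end_mid hp.1 t0 t1 ht).1 (hneg p h2 hp.2)).trans h
      · exact h

noncomputable def FF (p : ℝ) (v : ℝ × ℝ) : ℝ := |v.1| ^ p + |v.2| ^ p

theorem FF_nonneg (p : ℝ) (v : ℝ × ℝ) : 0 ≤ FF p v :=
  add_nonneg (Real.rpow_nonneg (abs_nonneg _) _) (Real.rpow_nonneg (abs_nonneg _) _)

theorem FF_smul (p : ℝ) (t : ℝ) (v : ℝ × ℝ) : FF p (t • v) = |t| ^ p * FF p v := by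
  simp only [FF, Prod.smul_fst, Prod.smul_snd, smul_eq_mul, abs_mul]
  rw [Real.mul_rpow (abs_nonneg _) (abs_nonneg _), Real.mul_rpow (abs_nonneg _) (abs_nonneg _)]
  ring

theorem FF_neg (p : ℝ) (v : ℝ × ℝ) : FF p (-v) = FF p v := by simp [FF]

theorem FF_zero {p : ℝ} (hp : 0 < p) : FF p 0 = 0 := by simp [FF, Real.zero_rpow hp.ne']

theorem FF_pos {p : ℝ} {v : ℝ × ℝ} (hv : v ≠ 0) : 0 < FF p v := by
  unfold FF
  by_cases h : v.1 = 0
  · have h2 : v.2 ≠ 0 := fun h2 => hv (Prod.ext h h2)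
    have := Real.rpow_pos_of_pos (abs_pos.2 h2) p
    have := Real.rpow_nonneg (abs_nonneg v.1) p
    linarith
  · have := Real.rpow_pos_of_pos (abs_pos.2 h) p
    have := Real.rpow_nonneg (abs_nonneg v.2) p
    linarith

theorem abs_rpow_conv {p : ℝ} (hp : 1 ≤ p) {α β x y : ℝ} (hα : 0 ≤ α) (hβ : 0 ≤ β) (h : α + β = 1) :
    |α * x + β * y| ^ p ≤ α * |x| ^ p + β * |y| ^ p := by
  have h1 : |α * x + β * y| ≤ α * |x| + β * |y| := by
    calc _ ≤ |α * x| + |β * y| := abs_add_le _ _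
      _ = _ := by rw [abs_mul, abs_mul, abs_of_nonneg hα, abs_of_nonneg hβ]
  calc _ ≤ (α * |x| + β * |y|) ^ p := Real.rpow_le_rpow (abs_nonneg _) h1 (by linarith)
    _ ≤ _ := (convexOn_rpow hp).2 (abs_nonneg x) (abs_nonneg y) hα hβ h

theorem FF_conv {p : ℝ} (hp : 1 ≤ p) {α β : ℝ} (u v : ℝ × ℝ) (hα : 0 ≤ α) (hβ : 0 ≤ β) (h : α + β = 1) :
    FF p (α • u + β • v) ≤ α * FF p u + β * FF p v := by
  have h1 := abs_rpow_conv hp (x := u.1) (y := v.1) hα hβ h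
  have h2 := abs_rpow_conv hp (x := u.2) (y := v.2) hα hβ h
  simp only [FF, Prod.fst_add, Prod.snd_add, Prod.smul_fst, Prod.smul_snd, smul_eq_mul]
  linarith

theorem FF_conv' {p : ℝ} (hp : 1 ≤ p) {α β : ℝ} (u v : ℝ × ℝ) (hα : 0 ≤ α) (hβ : 0 ≤ β) (h : α + β ≤ 1) :
    FF p (α • u + β • v) ≤ α * FF p u + β * FF p v := by
  rcases eq_or_lt_of_le (add_nonneg hα hβ) with h0 | h0
  · have h1 : α = 0 := by linarith
    have h2 : β = 0 := by linarith
    rw [h1, h2]; simp [FF_zero (by linarith : 0 < p)]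
  set s := α + β with hs
  have e : α • u + β • v = s • ((α / s) • u + (β / s) • v) := by
    rw [smul_add, smul_smul, smul_smul, mul_div_cancel₀ _ h0.ne', mul_div_cancel₀ _ h0.ne']
  have h1 := FF_conv hp (α := α / s) (β := β / s) u v (by positivity) (by positivity) (by rw [← add_div, ← hs, div_self h0.ne'])
  rw [e, FF_smul, abs_of_pos h0]
  have h2 : s ^ p ≤ s := by
    have := Real.rpow_le_rpow_of_exponent_ge h0 h hp
    rwa [Real.rpow_one] at this
  have h3 : 0 ≤ FF p ((α / s) • u + (β / s) • v) := FF_nonneg _ _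
  calc _ ≤ s * FF p ((α / s) • u + (β / s) • v) := mul_le_mul_of_nonneg_right h2 h3
    _ ≤ s * (α / s * FF p u + β / s * FF p v) := mul_le_mul_of_nonneg_left h1 h0.le
    _ = _ := by field_simp

/-- Existence of the third point. -/
theorem exists_Y {p : ℝ} (hp : 1 < p) {X : ℝ × ℝ} (hX : FF p X = 1) :
    ∃ Y, FF p Y = 1 ∧ FF p (Y - X) = 1 ∧ det2 X Y ≠ 0 := by
  have hp0 : 0 < p := by linarith
  have hX0 : 0 < X.1 ^ 2 + X.2 ^ 2 := by
    rcases eq_or_ne X.1 0 with h | h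
    · rcases eq_or_ne X.2 0 with h' | h'
      · exfalso
        have : X = 0 := Prod.ext h h'
        rw [this, FF_zero hp0] at hX; norm_num at hX
      · positivity
    · positivity
  let γ : ℝ → ℝ × ℝ := fun t => (t * X.1 - (1 - t ^ 2) * X.2, t * X.2 + (1 - t ^ 2) * X.1)
  have hγ0 : ∀ t, γ t ≠ 0 := by
    intro t h
    have h1 : t * X.1 - (1 - t ^ 2) * X.2 = 0 := congrArg Prod.fst h
    have h2 : t * X.2 + (1 - t ^ 2) * X.1 = 0 := congrArg Prod.snd h
    have h3 : t * (X.1 ^ 2 + X.2 ^ 2) = 0 := by linear_combination X.1 * h1 + X.2 * h2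
    have h4 : (1 - t ^ 2) * (X.1 ^ 2 + X.2 ^ 2) = 0 := by linear_combination X.1 * h2 - X.2 * h1
    have h5 : t = 0 := by
      rcases mul_eq_zero.1 h3 with h | h
      · exact h
      · linarith
    rw [h5] at h4
    norm_num at h4
    linarith
  have hFc : Continuous (FF p) := by
    unfold FF
    exact ((continuous_fst.abs).rpow_const (fun _ => Or.inr hp0.le)).add
      ((continuous_snd.abs).rpow_const (fun _ => Or.inr hp0.le))
  have hγc : Continuous γ := by
    apply Continuous.prodMk <;> fun_prop
  let Y : ℝ → ℝ × ℝ := fun t => ((FF p (γ t)) ^ (-(1 / p))) • γ t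
  have hYc : Continuous Y := by
    have hs : Continuous (fun t => (FF p (γ t)) ^ (-(1 / p))) :=
      (hFc.comp hγc).rpow_const (fun t => Or.inl (FF_pos (hγ0 t)).ne')
    exact hs.smul hγc
  have hY1 : ∀ t, FF p (Y t) = 1 := by
    intro t
    have h := FF_pos (p := p) (hγ0 t)
    show FF p (((FF p (γ t)) ^ (-(1 / p))) • γ t) = 1
    rw [FF_smul, abs_of_pos (Real.rpow_pos_of_pos h _), ← Real.rpow_mul h.le]
    rw [show -(1 / p) * p = -1 by field_simp, Real.rpow_neg_one, inv_mul_cancel₀ h.ne']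
  have y1 : Y 1 = X := by
    have : γ 1 = X := by simp [γ]
    show ((FF p (γ 1)) ^ (-(1 / p))) • γ 1 = X
    rw [this, hX, Real.one_rpow, one_smul]
  have y2 : Y (-1) = -X := by
    have : γ (-1) = -X := by ext <;> simp [γ]
    show ((FF p (γ (-1))) ^ (-(1 / p))) • γ (-1) = -X
    rw [this, FF_neg, hX, Real.one_rpow, one_smul]
  have hg : ContinuousOn (fun t => FF p (Y t - X)) (Set.Icc (-1) 1) :=
    (hFc.comp (hYc.sub continuous_const)).continuousOn
  have e2 : FF p (Y (-1) - X) = 2 ^ p := by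
    rw [y2, show -X - X = (-2:ℝ) • X by rw [neg_smul, two_smul]; abel, FF_smul, hX]
    norm_num
  have e1 : FF p (Y 1 - X) = 0 := by rw [y1, sub_self, FF_zero hp0]
  obtain ⟨t, ht, h⟩ := intermediate_value_Icc' (by norm_num : (-1:ℝ) ≤ 1) hg
    (show (1:ℝ) ∈ Set.Icc (FF p (Y 1 - X)) (FF p (Y (-1) - X)) from
      ⟨by rw [e1]; norm_num, by rw [e2]; exact Real.one_le_rpow (by norm_num) hp0.le⟩)
  refine ⟨Y t, hY1 t, h, fun hd => ?_⟩
  have hμ : ∃ μ : ℝ, Y t = μ • X := by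
    refine ⟨((Y t).1 * X.1 + (Y t).2 * X.2) / (X.1 ^ 2 + X.2 ^ 2), ?_⟩
    unfold det2 at hd
    ext
    · simp only [Prod.smul_fst, smul_eq_mul]; field_simp; linear_combination -X.2 * hd
    · simp only [Prod.smul_snd, smul_eq_mul]; field_simp; linear_combination X.1 * hd
  obtain ⟨μ, hμ⟩ := hμ
  have h1 := hY1 t
  simp only at h
  rw [hμ, FF_smul, hX, mul_one] at h1
  rw [hμ, show μ • X - X = (μ - 1) • X by rw [sub_smul, one_smul], FF_smul, hX, mul_one] at h
  have g : ∀ x : ℝ, |x| ^ p = 1 → x ^ 2 = 1 := by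
    intro x hx
    have : |x| = 1 := by
      rcases lt_trichotomy |x| 1 with h | h | h
      · have := Real.rpow_lt_one (abs_nonneg x) h hp0; linarith
      · exact h
      · have := Real.one_lt_rpow h hp0; linarith
    rw [← sq_abs, this]; norm_num
  have g1 := g _ h1
  have g2 := g _ h
  have : μ = 1/2 := by linarith
  rw [this] at g1; norm_num at g1

theorem row_bound {p : ℝ} (hp : 1 < p) {X W Y : ℝ × ℝ} (hX : FF p X = 1) (hW : ∀ k : ℤ, 1 ≤ FF p (W + (k:ℝ) • X))
    (hd : det2 X W ≠ 0) (hY : FF p Y = 1) (hYX : FF p (Y - X) = 1) (hs : 0 < det2 X W / det2 X Y)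
    (hD : det2 X Y ≠ 0) : |det2 X Y| ≤ |det2 X W| := by
  by_contra hlt
  push Not at hlt
  set θ := det2 X W / det2 X Y with hθ
  have hθ1 : θ < 1 := by
    have : |θ| < 1 := by rw [hθ, abs_div, div_lt_one (abs_pos.2 hD)]; exact hlt
    exact (abs_lt.1 this).2
  have hX0 : 0 < X.1 ^ 2 + X.2 ^ 2 := by
    rcases eq_or_ne X.1 0 with h | h
    · rcases eq_or_ne X.2 0 with h' | h'
      · exfalso; apply hd; unfold det2; rw [h, h']; ring
      · positivity
    · positivity
  have hμ : ∃ μ : ℝ, W = θ • Y + μ • X := by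
    have hd0 : det2 X (W - θ • Y) = 0 := by
      have : det2 X W = θ * det2 X Y := by rw [hθ]; field_simp
      unfold det2 at this ⊢
      simp only [Prod.fst_sub, Prod.snd_sub, Prod.smul_fst, Prod.smul_snd, smul_eq_mul]
      linear_combination this
    set V := W - θ • Y with hV
    refine ⟨(V.1 * X.1 + V.2 * X.2) / (X.1 ^ 2 + X.2 ^ 2), ?_⟩
    have : V = ((V.1 * X.1 + V.2 * X.2) / (X.1 ^ 2 + X.2 ^ 2)) • X := by
      unfold det2 at hd0
      ext
      · simp only [Prod.smul_fst, smul_eq_mul]; field_simp; linear_combination -X.2 * hd0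
      · simp only [Prod.smul_snd, smul_eq_mul]; field_simp; linear_combination X.1 * hd0
    rw [← this, hV]; abel
  obtain ⟨μ, hμ⟩ := hμ
  obtain ⟨k, hk1, hk2⟩ : ∃ k : ℤ, -1 < μ + k ∧ μ + k < 1 - θ := by
    refine ⟨⌊-1 - μ⌋ + 1, ?_, ?_⟩
    · have := Int.lt_floor_add_one (-1 - μ)
      push_cast; linarith
    · have := Int.floor_le (-1 - μ)
      push_cast; linarith
  set s := (1 - θ - (μ + k)) / (2 - θ) with hs'
  have h2θ : 0 < 2 - θ := by linarith
  have s0 : 0 < s := div_pos (by linarith) h2θ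
  have s1 : s < 1 := by rw [hs', div_lt_one h2θ]; linarith
  have e : W + (k:ℝ) • X = θ • (Y - s • X) + (1 - θ) • ((1 - 2 * s) • X) := by
    have : s * (2 - θ) = 1 - θ - (μ + k) := by rw [hs']; field_simp
    rw [hμ]
    ext
    · simp only [Prod.fst_add, Prod.fst_sub, Prod.smul_fst, smul_eq_mul]; linear_combination X.1 * this
    · simp only [Prod.snd_add, Prod.snd_sub, Prod.smul_snd, smul_eq_mul]; linear_combination X.2 * this
  have h1 := hW k
  rw [e] at h1
  have h2 := FF_conv hp.le (Y - s • X) ((1 - 2 * s) • X) hs.le (by linarith : 0 ≤ 1 - θ) (by ring)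
  have h3 : FF p (Y - s • X) ≤ 1 := by
    have := FF_conv hp.le Y (Y - X) (by linarith : 0 ≤ 1 - s) s0.le (by ring)
    rw [show (1 - s) • Y + s • (Y - X) = Y - s • X by rw [sub_smul, one_smul, smul_sub]; abel, hY, hYX] at this
    linarith
  have h4 : FF p ((1 - 2 * s) • X) < 1 := by
    rw [FF_smul, hX, mul_one]
    exact Real.rpow_lt_one (abs_nonneg _) (abs_lt.2 ⟨by linarith, by linarith⟩) (by linarith)
  nlinarith [mul_le_mul_of_nonneg_left h3 hs.le, mul_lt_mul_of_pos_left h4 (by linarith : 0 < 1 - θ)]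

theorem row_bound' {p : ℝ} (hp : 1 < p) {X W : ℝ × ℝ} (hX : FF p X = 1) (hW : ∀ k : ℤ, 1 ≤ FF p (W + (k:ℝ) • X))
    (hd : det2 X W ≠ 0) : ∃ Y, FF p Y = 1 ∧ FF p (Y - X) = 1 ∧ |det2 X Y| ≤ |det2 X W| := by
  obtain ⟨Y, h1, h2, h3⟩ := exists_Y hp hX
  rcases lt_or_gt_of_ne (div_ne_zero hd h3) with h | h
  · have e : det2 X (X - Y) = - det2 X Y := by unfold det2; simp; ring
    have k1 : FF p (X - Y) = 1 := by rw [← FF_neg, neg_sub]; exact h2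
    have k2 : FF p (X - Y - X) = 1 := by rw [show X - Y - X = -Y by abel, FF_neg]; exact h1
    refine ⟨X - Y, k1, k2, row_bound hp hX hW hd k1 k2 ?_ ?_⟩
    · rw [e, div_neg]; linarith
    · rw [e]; exact neg_ne_zero.2 h3
  · exact ⟨Y, h1, h2, row_bound hp hX hW hd h1 h2 h h3⟩

theorem FF_coord {p R : ℝ} (hp : 1 < p) (hR : 1 ≤ R) {v : ℝ × ℝ} (h : FF p v ≤ R) : |v.1| ≤ R ∧ |v.2| ≤ R := by
  have hR0 : 0 ≤ R := by linarith
  have hRp : R ≤ R ^ p := by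
    have := Real.rpow_le_rpow_of_exponent_le hR hp.le
    rwa [Real.rpow_one] at this
  unfold FF at h
  have h1 := Real.rpow_nonneg (abs_nonneg v.1) p
  have h2 := Real.rpow_nonneg (abs_nonneg v.2) p
  constructor
  · by_contra hc
    push Not at hc
    have := Real.rpow_lt_rpow hR0 hc (by linarith : 0 < p)
    linarith
  · by_contra hc
    push Not at hc
    have := Real.rpow_lt_rpow hR0 hc (by linarith : 0 < p)
    linarith

theorem exists_shortest {p : ℝ} (hp : 1 < p) {a b : ℝ × ℝ} (hd : det2 a b ≠ 0)
    (hF : ∀ i j : ℤ, (i, j) ≠ (0, 0) → 1 ≤ FF p ((i:ℝ) • a + (j:ℝ) • b)) :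
    ∃ i j : ℤ, (i, j) ≠ (0, 0) ∧ ∀ k l : ℤ, (k, l) ≠ (0, 0) →
      FF p ((i:ℝ) • a + (j:ℝ) • b) ≤ FF p ((k:ℝ) • a + (l:ℝ) • b) := by
  classical
  set R := FF p a with hR
  have hR1 : 1 ≤ R := by
    have := hF 1 0 (by simp)
    simpa using this
  have hD : 0 < |det2 a b| := abs_pos.2 hd
  set M := R * (|a.1| + |a.2| + |b.1| + |b.2|) / |det2 a b| with hM
  set N : ℤ := ⌈M⌉ + 1 with hN
  have hM0 : 0 ≤ M := by positivity
  have hNM : M ≤ N := by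
    have := Int.le_ceil M
    rw [hN]; push_cast; linarith
  have hN1 : 1 ≤ N := by
    have := Int.ceil_nonneg hM0
    omega
  have key : ∀ k l : ℤ, FF p ((k:ℝ) • a + (l:ℝ) • b) ≤ R → (-N ≤ k ∧ k ≤ N) ∧ (-N ≤ l ∧ l ≤ N) := by
    intro k l h
    obtain ⟨h1, h2⟩ := FF_coord hp hR1 h
    set v := (k:ℝ) • a + (l:ℝ) • b with hv
    have e1 : (k:ℝ) * det2 a b = v.1 * b.2 - v.2 * b.1 := by
      rw [hv]; unfold det2; simp; ring
    have e2 : (l:ℝ) * det2 a b = a.1 * v.2 - a.2 * v.1 := by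
      rw [hv]; unfold det2; simp; ring
    have g : ∀ x y z w : ℝ, |x| ≤ R → |z| ≤ R → |x * y - z * w| ≤ R * (|y| + |w|) := by
      intro x y z w hx hz
      calc _ ≤ |x * y| + |z * w| := abs_sub _ _
        _ = |x| * |y| + |z| * |w| := by rw [abs_mul, abs_mul]
        _ ≤ R * |y| + R * |w| := add_le_add (mul_le_mul_of_nonneg_right hx (abs_nonneg _)) (mul_le_mul_of_nonneg_right hz (abs_nonneg _))
        _ = _ := by ring
    have hR0 : 0 ≤ R := by linarith
    have f1 : |(k:ℝ)| ≤ M := by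
      rw [hM, le_div_iff₀ hD, ← abs_mul, e1]
      refine (g _ _ _ _ h1 h2).trans (mul_le_mul_of_nonneg_left ?_ hR0)
      linarith [abs_nonneg a.1, abs_nonneg a.2]
    have f2 : |(l:ℝ)| ≤ M := by
      rw [hM, le_div_iff₀ hD, ← abs_mul, e2, show a.1 * v.2 - a.2 * v.1 = v.2 * a.1 - v.1 * a.2 by ring]
      refine (g _ _ _ _ h2 h1).trans (mul_le_mul_of_nonneg_left ?_ hR0)
      linarith [abs_nonneg b.1, abs_nonneg b.2]
    have c1 := abs_le.1 (f1.trans hNM)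
    have c2 := abs_le.1 (f2.trans hNM)
    exact ⟨⟨by exact_mod_cast c1.1, by exact_mod_cast c1.2⟩, ⟨by exact_mod_cast c2.1, by exact_mod_cast c2.2⟩⟩
  let S : Finset (ℤ × ℤ) := ((Finset.Icc (-N) N) ×ˢ (Finset.Icc (-N) N)).filter (fun q => q ≠ (0, 0))
  have hS : ((1, 0) : ℤ × ℤ) ∈ S := by
    simp only [S, Finset.mem_filter, Finset.mem_product, Finset.mem_Icc]
    refine ⟨⟨⟨by omega, by omega⟩, ⟨by omega, by omega⟩⟩, by simp⟩
  obtain ⟨⟨i, j⟩, hij, hmin⟩ := Finset.exists_min_image S (fun q => FF p ((q.1:ℝ) • a + (q.2:ℝ) • b)) ⟨_, hS⟩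
  refine ⟨i, j, (Finset.mem_filter.1 hij).2, fun k l hkl => ?_⟩
  by_cases hle : FF p ((k:ℝ) • a + (l:ℝ) • b) ≤ R
  · have hk := key k l hle
    exact hmin (k, l) (by
      simp only [S, Finset.mem_filter, Finset.mem_product, Finset.mem_Icc]
      exact ⟨hk, hkl⟩)
  · have := hmin (1, 0) hS
    simp only [Int.cast_one, Int.cast_zero, one_smul, zero_smul, add_zero] at this
    exact this.trans (le_of_lt (not_le.1 hle))

theorem lattice_reduce {p : ℝ} (hp : 1 < p) {a b : ℝ × ℝ} (hd : det2 a b ≠ 0)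
    (hF : ∀ i j : ℤ, (i, j) ≠ (0, 0) → 1 ≤ FF p ((i:ℝ) • a + (j:ℝ) • b)) :
    ∃ X Y, FF p X = 1 ∧ FF p Y = 1 ∧ FF p (Y - X) = 1 ∧ |det2 X Y| ≤ |det2 a b| := by
  have hp0 : 0 < p := by linarith
  obtain ⟨i, j, hij, hmin⟩ := exists_shortest hp hd hF
  set V := (i:ℝ) • a + (j:ℝ) • b with hV
  have hR1 : 1 ≤ FF p V := hF i j hij
  have hg : Int.gcd i j = 1 := by
    set g := Int.gcd i j with hg
    have hg0 : g ≠ 0 := by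
      intro h
      rw [hg, Int.gcd_eq_zero_iff] at h
      exact hij (Prod.ext h.1 h.2)
    by_contra hne
    have hg2 : 2 ≤ g := by omega
    obtain ⟨i', hi'⟩ : (g:ℤ) ∣ i := Int.gcd_dvd_left ..
    obtain ⟨j', hj'⟩ : (g:ℤ) ∣ j := Int.gcd_dvd_right ..
    have hne' : (i', j') ≠ (0, 0) := by
      intro h
      simp only [Prod.mk.injEq] at h
      apply hij
      rw [hi', hj', h.1, h.2]; simp
    have h1 := hmin i' j' hne'
    have h2 := hF i' j' hne'
    have e : V = (g:ℝ) • ((i':ℝ) • a + (j':ℝ) • b) := by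
      have e1 : (i:ℝ) = (g:ℝ) * i' := by exact_mod_cast hi'
      have e2 : (j:ℝ) = (g:ℝ) * j' := by exact_mod_cast hj'
      rw [hV, e1, e2, smul_add, smul_smul, smul_smul]
    rw [e, FF_smul] at h1
    have h3 : (1:ℝ) < |(g:ℝ)| ^ p := by
      apply Real.one_lt_rpow _ hp0
      have : (2:ℝ) ≤ g := by exact_mod_cast hg2
      rw [abs_of_nonneg (by linarith)]; linarith
    nlinarith
  obtain ⟨u, w, huw⟩ := Int.isCoprime_iff_gcd_eq_one.2 hg
  have huw' : (u:ℝ) * i + w * j = 1 := by exact_mod_cast huw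
  set Z := (-(w:ℝ)) • a + (u:ℝ) • b with hZ
  have hdet : det2 V Z = det2 a b := by
    rw [hV, hZ]; unfold det2; simp
    linear_combination (a.1 * b.2 - a.2 * b.1) * huw'
  have hZk : ∀ k : ℤ, FF p V ≤ FF p (Z + (k:ℝ) • V) := by
    intro k
    have hne : (-w + k * i, u + k * j) ≠ (0, 0) := by
      intro h
      simp only [Prod.mk.injEq] at h
      have : u * i + w * j = 0 := by linear_combination i * h.2 - j * h.1
      omega
    have h := hmin _ _ hne
    convert h using 2
    rw [hV, hZ]; push_cast; module
  set R := FF p V with hR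
  have hR0 : 0 < R := by linarith
  set r := R ^ (-(1 / p)) with hr
  have hr0 : 0 < r := Real.rpow_pos_of_pos hR0 _
  have hrp : r ^ p = R⁻¹ := by
    rw [hr, ← Real.rpow_mul hR0.le, show -(1 / p) * p = -1 by field_simp, Real.rpow_neg_one]
  have hr1 : r ≤ 1 := Real.rpow_le_one_of_one_le_of_nonpos hR1 (by
    have : 0 < 1 / p := by positivity
    linarith)
  have hX1 : FF p (r • V) = 1 := by
    rw [FF_smul, abs_of_pos hr0, hrp, ← hR, inv_mul_cancel₀ hR0.ne']
  have hdd : det2 (r • V) (r • Z) = r ^ 2 * det2 a b := by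
    rw [← hdet]; unfold det2; simp; ring
  obtain ⟨Y, hY1, hY2, hY3⟩ := row_bound' hp hX1 (W := r • Z) (by
    intro k
    rw [smul_comm, ← smul_add, FF_smul, abs_of_pos hr0, hrp, ← div_eq_inv_mul, le_div_iff₀ hR0, one_mul]
    exact hZk k) (by rw [hdd]; positivity)
  refine ⟨r • V, Y, hX1, hY1, hY2, hY3.trans ?_⟩
  rw [hdd, abs_mul, abs_of_pos (by positivity)]
  have : r ^ 2 ≤ 1 := by nlinarith
  nlinarith [abs_nonneg (det2 a b)]

theorem lnG_of {p a b u v : ℝ} (hp : 1 < p) (ha0 : 0 ≤ a) (ha1 : a < 1) (hb0 : 0 ≤ b) (hb1 : b < 1)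
    (hu : 0 < u) (hv : 0 < v) (hU : u ^ p * (1 - a ^ p * b ^ p) = 1 - b ^ p) (hV : v ^ p * (1 - a ^ p * b ^ p) = 1 - a ^ p) :
    lnG p a b = p * Real.log (u * v * (1 - a * b)) := by
  have hA := rpow_lt_one_aux hp ha0 ha1
  have hB := rpow_lt_one_aux hp hb0 hb1
  have hA0 : 0 ≤ a ^ p := Real.rpow_nonneg ha0 p
  have hB0 : 0 ≤ b ^ p := Real.rpow_nonneg hb0 p
  have hAB : 0 < 1 - a ^ p * b ^ p := by nlinarith
  have hab : 0 < 1 - a * b := by nlinarith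
  have h1 := congrArg Real.log hU
  have h2 := congrArg Real.log hV
  have hup := Real.rpow_pos_of_pos hu p
  have hvp := Real.rpow_pos_of_pos hv p
  rw [Real.log_mul hup.ne' hAB.ne', Real.log_rpow hu] at h1
  rw [Real.log_mul hvp.ne' hAB.ne', Real.log_rpow hv] at h2
  rw [Real.log_mul (by positivity) hab.ne', Real.log_mul hu.ne' hv.ne']
  unfold lnG
  linarith

theorem Hc_symm (p a b : ℝ) : Hc p a b = Hc p b a := by
  unfold Hc; rw [mul_comm a b]; ring

theorem lnG_symm (p a b : ℝ) : lnG p a b = lnG p b a := by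
  unfold lnG; rw [mul_comm a b, mul_comm (a ^ p)]; ring

theorem Hc_le_half {p a b : ℝ} (hp : 1 < p) (ha0 : 0 ≤ a) (ha1 : a < 1) (hb0 : 0 ≤ b) (hb1 : b < 1)
    (h : Hc p a b = 0) : a ≤ 1/2 := by
  have h1 := (Hc_zero_iff hp ha0 ha1 hb0 hb1).1 h
  have h2 : hf p 0 ≤ hf p b := (hf_strictMono hp).monotoneOn ⟨le_rfl, by norm_num⟩ ⟨hb0, hb1⟩ hb0
  rw [hf_zero hp] at h2
  have h3 : hf p a ≤ hf p (1/2) := by rw [hf_half hp]; linarith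
  exact ((hf_strictMono hp).le_iff_le ⟨ha0, ha1⟩ ⟨by norm_num, by norm_num⟩).1 h3

theorem sign_core {p u1 u2 u3 v1 v2 v3 : ℝ} (hp : 1 < p) (hu2 : 0 ≤ u2) (hu3 : 0 ≤ u3)
    (hv1 : 0 ≤ v1) (hv3 : 0 ≤ v3) (hu : u1 = u2 + u3) (hv : v2 = v1 + v3)
    (h1 : u1 ^ p + v1 ^ p = 1) (h2 : u2 ^ p + v2 ^ p = 1) (h3 : u3 ^ p + v3 ^ p = 1) :
    ∃ a b, 0 ≤ a ∧ a < 1 ∧ 0 ≤ b ∧ b < 1 ∧ Hc p a b = 0 ∧ 0 < u1 * v2 - v1 * u2 ∧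
      lnG p a b = p * Real.log (u1 * v2 - v1 * u2) := by
  have hp0 : p ≠ 0 := by linarith
  have su := Real.add_rpow_le_rpow_add hu2 hu3 hp.le
  have sv := Real.add_rpow_le_rpow_add hv1 hv3 hp.le
  rw [← hu] at su
  rw [← hv] at sv
  have hu3' : 0 < u3 := by
    rcases hu3.lt_or_eq with h | h
    · exact h
    · rw [← h] at hu h3
      rw [Real.zero_rpow hp0] at h3
      rw [add_zero] at hu
      rw [hu] at h1
      linarith
  have hv3' : 0 < v3 := by
    rcases hv3.lt_or_eq with h | h
    · exact h
    · rw [← h] at hv h3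
      rw [Real.zero_rpow hp0] at h3
      rw [add_zero] at hv
      rw [hv] at h2
      linarith
  have hu1 : 0 < u1 := by linarith
  have hv2 : 0 < v2 := by linarith
  obtain ⟨a, ha⟩ : ∃ a, a = u2 / u1 := ⟨_, rfl⟩
  obtain ⟨b, hb⟩ : ∃ b, b = v1 / v2 := ⟨_, rfl⟩
  have ha0 : 0 ≤ a := by rw [ha]; positivity
  have hb0 : 0 ≤ b := by rw [hb]; positivity
  have ha1 : a < 1 := by rw [ha, div_lt_one hu1]; linarith
  have hb1 : b < 1 := by rw [hb, div_lt_one hv2]; linarith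
  have eu2 : u2 = a * u1 := by rw [ha]; field_simp
  have ev1 : v1 = b * v2 := by rw [hb]; field_simp
  have eu3 : u3 = (1 - a) * u1 := by linarith
  have ev3 : v3 = (1 - b) * v2 := by linarith
  rw [ev1, Real.mul_rpow hb0 hv2.le] at h1
  rw [eu2, Real.mul_rpow ha0 hu1.le] at h2
  rw [eu3, ev3, Real.mul_rpow (by linarith) hu1.le, Real.mul_rpow (by linarith) hv2.le] at h3
  have hA := rpow_lt_one_aux hp ha0 ha1
  have hB := rpow_lt_one_aux hp hb0 hb1
  have hU : u1 ^ p * (1 - a ^ p * b ^ p) = 1 - b ^ p := by linear_combination h1 - b ^ p * h2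
  have hV : v2 ^ p * (1 - a ^ p * b ^ p) = 1 - a ^ p := by linear_combination h2 - a ^ p * h1
  have e : u1 * v2 - v1 * u2 = u1 * v2 * (1 - a * b) := by rw [eu2, ev1]; ring
  refine ⟨a, b, ha0, ha1, hb0, hb1, ?_, ?_, ?_⟩
  · unfold Hc
    rw [Real.mul_rpow ha0 hb0, Real.mul_rpow hb0 (by linarith), Real.mul_rpow ha0 (by linarith)]
    linear_combination (1 - a ^ p * b ^ p) * (-h3) + (1 - a) ^ p * hU + (1 - b) ^ p * hV
  · rw [e]
    have : 0 < 1 - a * b := by nlinarith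
    positivity
  · rw [e]; exact lnG_of hp ha0 ha1 hb0 hb1 hu1 hv2 hU hV

theorem sign_gen {p L : ℝ} (hp : 1 < p)
    (hL : ∀ a b, 0 ≤ b → b ≤ a → a ≤ 1/2 → Hc p a b = 0 → L ≤ lnG p a b)
    {P Q S : ℝ × ℝ} (hP : FF p P = 1) (hQ : FF p Q = 1) (hS : FF p S = 1)
    (h1 : |P.1| = |Q.1| + |S.1|) (h2 : |Q.2| = |P.2| + |S.2|) : Real.exp (L / p) ≤ |det2 P Q| := by
  obtain ⟨a, b, ha0, ha1, hb0, hb1, hH, hpos, hG⟩ := sign_core hp (abs_nonneg Q.1) (abs_nonneg S.1)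
    (abs_nonneg P.2) (abs_nonneg S.2) h1 h2 hP hQ hS
  have hLe : L ≤ lnG p a b := by
    rcases le_total b a with h | h
    · exact hL a b hb0 h (Hc_le_half hp ha0 ha1 hb0 hb1 hH) hH
    · rw [lnG_symm]
      rw [Hc_symm] at hH
      exact hL b a ha0 h (Hc_le_half hp hb0 hb1 ha0 ha1 hH) hH
  have h3 : |P.1| * |Q.2| - |P.2| * |Q.1| ≤ |det2 P Q| := by
    unfold det2
    rw [← abs_mul, ← abs_mul]
    exact abs_sub_abs_le_abs_sub _ _
  refine le_trans ?_ h3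
  rw [← Real.le_log_iff_exp_le hpos, div_le_iff₀ (by linarith), mul_comm]
  linarith

theorem sign_same {p : ℝ} (hp : 1 < p) {P Q S : ℝ × ℝ} (hP : FF p P = 1) (hQ : FF p Q = 1) (hS : FF p S = 1)
    (h1 : |P.1| = |Q.1| + |S.1|) (h2 : |P.2| = |Q.2| + |S.2|) : False := by
  have a1 := Real.add_rpow_le_rpow_add (abs_nonneg Q.1) (abs_nonneg S.1) hp.le
  have a2 := Real.add_rpow_le_rpow_add (abs_nonneg Q.2) (abs_nonneg S.2) hp.le
  rw [← h1] at a1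
  rw [← h2] at a2
  unfold FF at hP hQ hS
  linarith

theorem abs_three (x y : ℝ) : |x| = |y - x| + |y| ∨ |y - x| = |x| + |y| ∨ |y| = |x| + |y - x| := by
  rcases abs_cases x with ⟨h1, h1'⟩ | ⟨h1, h1'⟩ <;> rcases abs_cases y with ⟨h2, h2'⟩ | ⟨h2, h2'⟩ <;>
    rcases abs_cases (y - x) with ⟨h3, h3'⟩ | ⟨h3, h3'⟩ <;> rw [h1, h2, h3] <;>
    first
    | (left; linarith)
    | (right; left; linarith)
    | (right; right; linarith)

theorem sign_all {p L : ℝ} (hp : 1 < p)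
    (hL : ∀ a b, 0 ≤ b → b ≤ a → a ≤ 1/2 → Hc p a b = 0 → L ≤ lnG p a b)
    {X Y : ℝ × ℝ} (hX : FF p X = 1) (hY : FF p Y = 1) (hS : FF p (Y - X) = 1) :
    Real.exp (L / p) ≤ |det2 X Y| := by
  have d1 : |det2 Y X| = |det2 X Y| := by rw [← abs_neg]; congr 1; unfold det2; ring
  have d2 : |det2 X (Y - X)| = |det2 X Y| := by congr 1; unfold det2; simp; ring
  have d3 : |det2 (Y - X) X| = |det2 X Y| := by rw [← abs_neg]; congr 1; unfold det2; simp; ring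
  have d4 : |det2 Y (Y - X)| = |det2 X Y| := by congr 1; unfold det2; simp; ring
  have d5 : |det2 (Y - X) Y| = |det2 X Y| := by rw [← abs_neg]; congr 1; unfold det2; simp; ring
  rcases abs_three X.1 Y.1 with h | h | h <;> rcases abs_three X.2 Y.2 with k | k | k
  · exact (sign_same hp hX hS hY h k).elim
  · rw [← d2]; exact sign_gen hp hL hX hS hY h k
  · exact sign_gen hp hL hX hY hS (by rw [h]; simp [add_comm]) (by rw [k]; simp)
  · rw [← d3]; exact sign_gen hp hL hS hX hY (by simpa using h) (by simpa using k)
  · exact (sign_same hp hS hX hY h k).elim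
  · rw [← d5]; exact sign_gen hp hL hS hY hX (by simp; linarith) (by simp; linarith)
  · rw [← d1]; exact sign_gen hp hL hY hX hS (by simpa using h) (by simp; linarith)
  · rw [← d4]; exact sign_gen hp hL hY hS hX (by simp; linarith) (by simp; linarith)
  · exact (sign_same hp hY hX hS h k).elim

theorem sector_aux {p : ℝ} (hp : 1 < p) {P Q : ℝ × ℝ} (hP : FF p P = 1) (hPQ : FF p (P - Q) = 1)
    {m n : ℝ} (hm : 1 ≤ m) (hn : 0 ≤ n) : 1 ≤ FF p (m • P + n • Q) := by
  have hmn : 0 < m + n := by linarith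
  have h := FF_conv' hp.le (α := 1 / (m + n)) (β := n / (m + n)) (m • P + n • Q) (P - Q) (by positivity) (by positivity)
    (by rw [← add_div, div_le_one hmn]; linarith)
  have e : (1 / (m + n)) • (m • P + n • Q) + (n / (m + n)) • (P - Q) = P := by
    ext
    · simp only [Prod.fst_add, Prod.fst_sub, Prod.smul_fst, smul_eq_mul]; field_simp; ring
    · simp only [Prod.snd_add, Prod.snd_sub, Prod.smul_snd, smul_eq_mul]; field_simp; ring
  rw [e, hP, hPQ, mul_one, ← mul_le_mul_iff_right₀ hmn] at h
  have e2 : (m + n) * (1 / (m + n) * FF p (m • P + n • Q) + n / (m + n)) = FF p (m • P + n • Q) + n := by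
    field_simp
  rw [e2] at h
  linarith

theorem sector {p : ℝ} (hp : 1 < p) {P Q : ℝ × ℝ} (hP : FF p P = 1) (hQ : FF p Q = 1) (hPQ : FF p (P - Q) = 1)
    {m n : ℤ} (hm : 0 ≤ m) (hn : 0 ≤ n) (h : m ≠ 0 ∨ n ≠ 0) : 1 ≤ FF p ((m:ℝ) • P + (n:ℝ) • Q) := by
  rcases eq_or_lt_of_le hm with h0 | h0
  · have hn1 : 1 ≤ n := by omega
    rw [add_comm]
    exact sector_aux hp hQ (by rw [← FF_neg, neg_sub]; exact hPQ) (by exact_mod_cast hn1) (by exact_mod_cast hm)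
  · exact sector_aux hp hP hPQ (by exact_mod_cast h0) (by exact_mod_cast hn)

theorem hex_adm {p : ℝ} (hp : 1 < p) {X Y : ℝ × ℝ} (hX : FF p X = 1) (hY : FF p Y = 1) (hS : FF p (Y - X) = 1)
    (i j : ℤ) (h : i ≠ 0 ∨ j ≠ 0) : 1 ≤ FF p ((i:ℝ) • X + (j:ℝ) • Y) := by
  have hXY : FF p (X - Y) = 1 := by rw [← FF_neg, neg_sub]; exact hS
  have main : ∀ i j : ℤ, 0 ≤ j → (i ≠ 0 ∨ j ≠ 0) → 1 ≤ FF p ((i:ℝ) • X + (j:ℝ) • Y) := by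
    intro i j hj h
    rcases le_total 0 i with hi | hi
    · exact sector hp hX hY hXY hi hj h
    · rcases le_total 0 (i + j) with hij | hij
      · have := sector hp hY hS (by rw [show Y - (Y - X) = X by abel]; exact hX) hij (by omega : 0 ≤ -i) (by omega)
        convert this using 2
        push_cast; module
      · have := sector hp hS (by rw [FF_neg]; exact hX : FF p (-X) = 1)
          (by rw [show Y - X - -X = Y by abel]; exact hY) hj (by omega : 0 ≤ -(i + j)) (by omega)
        convert this using 2
        push_cast; module
  rcases le_total 0 j with hj | hj
  · exact main i j hj h
  · have := main (-i) (-j) (by omega) (by omega)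
    rw [← FF_neg]
    convert this using 2
    push_cast; module

theorem attain {p a b : ℝ} (hp : 1 < p) (ha0 : 0 ≤ a) (ha1 : a < 1) (hb0 : 0 ≤ b) (hb1 : b < 1) (hH : Hc p a b = 0) :
    ∃ X Y : ℝ × ℝ, FF p X = 1 ∧ FF p Y = 1 ∧ FF p (Y - X) = 1 ∧ det2 X Y = Real.exp (lnG p a b / p) := by
  have hp0 : 0 < p := by linarith
  have hA := rpow_lt_one_aux hp ha0 ha1
  have hB := rpow_lt_one_aux hp hb0 hb1
  have hA0 : 0 ≤ a ^ p := Real.rpow_nonneg ha0 p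
  have hB0 : 0 ≤ b ^ p := Real.rpow_nonneg hb0 p
  have hAB : 0 < 1 - a ^ p * b ^ p := by nlinarith
  have hab : 0 < 1 - a * b := by nlinarith
  have g : ∀ x : ℝ, 0 < x → ∃ u : ℝ, 0 < u ∧ u ^ p = x := fun x hx =>
    ⟨x ^ (1 / p), Real.rpow_pos_of_pos hx _, by
      rw [← Real.rpow_mul hx.le, one_div, inv_mul_cancel₀ hp0.ne', Real.rpow_one]⟩
  obtain ⟨u, hu, hU⟩ := g ((1 - b ^ p) / (1 - a ^ p * b ^ p)) (div_pos (by linarith) hAB)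
  obtain ⟨v, hv, hV⟩ := g ((1 - a ^ p) / (1 - a ^ p * b ^ p)) (div_pos (by linarith) hAB)
  have hU' : u ^ p * (1 - a ^ p * b ^ p) = 1 - b ^ p := by rw [hU, div_mul_cancel₀ _ hAB.ne']
  have hV' : v ^ p * (1 - a ^ p * b ^ p) = 1 - a ^ p := by rw [hV, div_mul_cancel₀ _ hAB.ne']
  refine ⟨(u, b * v), (a * u, v), ?_, ?_, ?_, ?_⟩
  · simp only [FF]
    rw [abs_of_pos hu, abs_of_nonneg (by positivity), Real.mul_rpow hb0 hv.le]
    have : (u ^ p + b ^ p * v ^ p - 1) * (1 - a ^ p * b ^ p) = 0 := by linear_combination hU' + b ^ p * hV'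
    rcases mul_eq_zero.1 this with h | h <;> linarith
  · simp only [FF]
    rw [abs_of_pos hv, abs_of_nonneg (by positivity), Real.mul_rpow ha0 hu.le]
    have : (a ^ p * u ^ p + v ^ p - 1) * (1 - a ^ p * b ^ p) = 0 := by linear_combination a ^ p * hU' + hV'
    rcases mul_eq_zero.1 this with h | h <;> linarith
  · simp only [FF, Prod.fst_sub, Prod.snd_sub]
    rw [show a * u - u = -((1 - a) * u) by ring, show v - b * v = (1 - b) * v by ring, abs_neg,
      abs_of_pos (mul_pos (by linarith) hu), abs_of_pos (mul_pos (by linarith) hv),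
      Real.mul_rpow (by linarith) hu.le, Real.mul_rpow (by linarith) hv.le]
    unfold Hc at hH
    rw [Real.mul_rpow ha0 hb0, Real.mul_rpow hb0 (by linarith), Real.mul_rpow ha0 (by linarith)] at hH
    have : ((1 - a) ^ p * u ^ p + (1 - b) ^ p * v ^ p - 1) * (1 - a ^ p * b ^ p) = 0 := by
      linear_combination (1 - a) ^ p * hU' + (1 - b) ^ p * hV' - hH
    rcases mul_eq_zero.1 this with h | h <;> linarith
  · rw [lnG_of hp ha0 ha1 hb0 hb1 hu hv hU' hV', mul_div_cancel_left₀ _ hp0.ne', Real.exp_log (by positivity)]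
    unfold det2; simp only; ring

theorem linInd_iff_det (a b : ℝ × ℝ) : LinearIndependent ℝ ![a, b] ↔ det2 a b ≠ 0 := by
  rw [LinearIndependent.pair_iff]
  constructor
  · intro h hd
    unfold det2 at hd
    have h1 := h b.2 (-a.2) (by ext <;> simp <;> linarith)
    have h2 := h b.1 (-a.1) (by ext <;> simp <;> linarith)
    have h3 := h 1 0 (by
      ext
      · simp; linarith [h2.2]
      · simp; linarith [h1.2])
    exact one_ne_zero h3.1
  · intro hd s t h
    have h1 : s * a.1 + t * b.1 = 0 := by simpa using congrArg Prod.fst h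
    have h2 : s * a.2 + t * b.2 = 0 := by simpa using congrArg Prod.snd h
    have k1 : s * det2 a b = 0 := by unfold det2; linear_combination b.2 * h1 - b.1 * h2
    have k2 : t * det2 a b = 0 := by unfold det2; linear_combination a.1 * h2 - a.2 * h1
    exact ⟨(mul_eq_zero.1 k1).resolve_right hd, (mul_eq_zero.1 k2).resolve_right hd⟩

theorem critDet_eq {p s L a₀ b₀ : ℝ} (hp : 1 < p) (hs : 0 < s) (ha0 : 0 ≤ a₀) (ha1 : a₀ < 1) (hb0 : 0 ≤ b₀) (hb1 : b₀ < 1)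
    (hH : Hc p a₀ b₀ = 0) (hL0 : lnG p a₀ b₀ = L)
    (hL : ∀ a b, 0 ≤ b → b ≤ a → a ≤ 1/2 → Hc p a b = 0 → L ≤ lnG p a b) :
    criticalDet (s • ballD p) = ENNReal.ofReal (s ^ 2 * Real.exp (L / p)) := by
  have hmem : ∀ v, v ∈ s • ballD p ↔ FF p (s⁻¹ • v) < 1 := fun v => by
    rw [Set.mem_smul_set_iff_inv_smul_mem₀ hs.ne']; rfl
  unfold criticalDet
  apply le_antisymm
  · obtain ⟨X, Y, hX, hY, hS, hdet⟩ := attain hp ha0 ha1 hb0 hb1 hH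
    rw [hL0] at hdet
    have hd : det2 (s • X) (s • Y) = s ^ 2 * Real.exp (L / p) := by
      rw [← hdet]; unfold det2; simp; ring
    have hpos : 0 < s ^ 2 * Real.exp (L / p) := by positivity
    apply sInf_le
    refine ⟨s • X, s • Y, ?_, ?_, ?_⟩
    · rw [linInd_iff_det, hd]; exact hpos.ne'
    · rintro v ⟨⟨i, j, rfl⟩, hv⟩
      rw [hmem] at hv
      by_contra hne
      have hij : i ≠ 0 ∨ j ≠ 0 := by
        by_contra hc
        push Not at hc
        apply hne
        rw [hc.1, hc.2]; simp
      have := hex_adm hp hX hY hS i j hij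
      have e : s⁻¹ • ((i:ℝ) • s • X + (j:ℝ) • s • Y) = (i:ℝ) • X + (j:ℝ) • Y := by
        rw [smul_comm _ s X, smul_comm _ s Y, ← smul_add, inv_smul_smul₀ hs.ne']
      rw [e] at hv
      linarith
    · rw [hd, abs_of_pos hpos]
  · apply le_sInf
    rintro d ⟨a, b, hli, hadm, rfl⟩
    apply ENNReal.ofReal_le_ofReal
    have hd0 := (linInd_iff_det a b).1 hli
    have hd : det2 (s⁻¹ • a) (s⁻¹ • b) = s⁻¹ ^ 2 * det2 a b := by
      unfold det2; simp; ring
    obtain ⟨X, Y, hX, hY, hS, hle⟩ := lattice_reduce hp (a := s⁻¹ • a) (b := s⁻¹ • b)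
      (by rw [hd]; exact mul_ne_zero (by positivity) hd0) (by
        intro i j hij
        by_contra hc
        push Not at hc
        have e : (i:ℝ) • s⁻¹ • a + (j:ℝ) • s⁻¹ • b = s⁻¹ • ((i:ℝ) • a + (j:ℝ) • b) := by
          rw [smul_comm _ s⁻¹ a, smul_comm _ s⁻¹ b, ← smul_add]
        rw [e, ← hmem] at hc
        have h0 : (i:ℝ) • a + (j:ℝ) • b = 0 := hadm ⟨⟨i, j, rfl⟩, hc⟩
        have := LinearIndependent.pair_iff.1 hli _ _ h0
        apply hij
        exact Prod.ext (by exact_mod_cast this.1) (by exact_mod_cast this.2))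
    have h1 := sign_all hp hL hX hY hS
    rw [hd, abs_mul, abs_of_pos (by positivity : (0:ℝ) < s⁻¹ ^ 2)] at hle
    have h2 := mul_le_mul_of_nonneg_left (h1.trans hle) (by positivity : 0 ≤ s ^ 2)
    calc _ ≤ _ := h2
      _ = _ := by field_simp

theorem final_stmt (m : ℕ) :
    ∃ p₀ : ℝ, 2.57 < p₀ ∧ p₀ < 2.58 ∧ ∀ p τ : ℝ, 0 ≤ τ → τ < 1 → 2 * (1 - τ) ^ p = 1 + τ ^ p →
      (((1 < p ∧ p ≤ 2) ∨ p₀ ≤ p) →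
        criticalDet ((2:ℝ) ^ m • ballD p) = ENNReal.ofReal ((4:ℝ) ^ ((m:ℝ) - 1 / p) * (1 + τ) / (1 - τ))) ∧
      ((2 ≤ p ∧ p ≤ p₀) →
        criticalDet ((2:ℝ) ^ m • ballD p) = ENNReal.ofReal ((2:ℝ) ^ (2 * (m:ℝ) - 1) * ((2:ℝ) ^ p - 1) ^ (1 / p))) := by
  obtain ⟨p₀, h1, h2, h⟩ := core
  refine ⟨p₀, h1, h2, fun p τ ht0 ht1 ht => ?_⟩
  obtain ⟨k1, k2⟩ := h p τ ht0 ht1 ht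
  have hs : (0:ℝ) < 2 ^ m := by positivity
  have hs2 : ((2:ℝ) ^ m) ^ 2 = 4 ^ (m:ℝ) := by
    rw [Real.rpow_natCast, ← pow_mul, mul_comm, pow_mul]; norm_num
  constructor
  · intro hc
    have hp : 1 < p := by rcases hc with hc | hc <;> [exact hc.1; linarith]
    have hp0 : 0 < p := by linarith
    rw [critDet_eq hp hs ht0 ht1 ht0 ht1 (Hc_tau hp ht0 ht1 ht) rfl (k1 hc), hs2, lnG_tau hp ht0 ht1 ht]
    congr 1
    have hq : 0 < (1 + τ) / (1 - τ) := div_pos (by linarith) (by linarith)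
    have hq' : 0 < ((1 + τ) / (1 - τ)) ^ p / 4 := div_pos (Real.rpow_pos_of_pos hq p) (by norm_num)
    rw [div_eq_mul_one_div _ p, ← Real.rpow_def_of_pos hq', Real.div_rpow (Real.rpow_nonneg hq.le p) (by norm_num),
      ← Real.rpow_mul hq.le, mul_one_div_cancel hp0.ne', Real.rpow_one, Real.rpow_sub (by norm_num)]
    ring
  · intro hc
    have hp : 1 < p := by linarith [hc.1]
    have hp0 : 0 < p := by linarith
    have hH : Hc p (1/2) 0 = 0 :=
      (Hc_zero_iff hp (by norm_num) (by norm_num) le_rfl (by norm_num)).2 (by rw [hf_half hp, hf_zero hp]; ring)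
    rw [critDet_eq hp hs (by norm_num) (by norm_num) le_rfl (by norm_num) hH rfl (k2 hc), hs2, lnG_end hp]
    congr 1
    have h2p : (1:ℝ) < 2 ^ p := Real.one_lt_rpow (by norm_num) hp0
    have e : (1:ℝ) - 2 ^ (-p) = (2 ^ p - 1) / 2 ^ p := by
      rw [Real.rpow_neg (by norm_num)]; field_simp
    have hq : (0:ℝ) < (2 ^ p - 1) / 2 ^ p := div_pos (by linarith) (by linarith)
    rw [e, div_eq_mul_one_div _ p, ← Real.rpow_def_of_pos hq, Real.div_rpow (by linarith) (by linarith),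
      ← Real.rpow_mul (by norm_num : (0:ℝ) ≤ 2), mul_one_div_cancel hp0.ne', Real.rpow_one,
      Real.rpow_sub (by norm_num), Real.rpow_one, Real.rpow_mul (by norm_num)]
    norm_num
    ring

/-- for integer `m ≥ 1` there is `p₀ ∈ (2.57, 2.58)` such that the
critical determinant of the Minkowski domain `2^m • D_p` equals
`4^(m - 1/p)·(1+τ_p)/(1-τ_p)` for `1 < p ≤ 2` or `p ≥ p₀`, and equals
`2^(2m-1)·(2^p-1)^(1/p)` for `2 ≤ p ≤ p₀`, where `τ_p ∈ [0,1)` satisfies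
`2(1-τ_p)^p = 1+τ_p^p`. -/
theorem stmt_13 (m : ℕ) (hm : 1 ≤ m) :
    ∃ p₀ : ℝ, 2.57 < p₀ ∧ p₀ < 2.58 ∧
      ∀ p τ : ℝ, 0 ≤ τ → τ < 1 → 2 * (1 - τ) ^ p = 1 + τ ^ p →
        (((1 < p ∧ p ≤ 2) ∨ p₀ ≤ p) →
          criticalDet (((2 : ℝ) ^ m) • ballD p) =
            ENNReal.ofReal ((4 : ℝ) ^ ((m : ℝ) - 1 / p) * (1 + τ) / (1 - τ))) ∧
        ((2 ≤ p ∧ p ≤ p₀) →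
          criticalDet (((2 : ℝ) ^ m) • ballD p) =
            ENNReal.ofReal ((2 : ℝ) ^ (2 * (m : ℝ) - 1) * ((2 : ℝ) ^ p - 1) ^ (1 / p))) := by
  exact final_stmt m
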